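/- Let (M,τ) be a separable II₁ factor and M ⊂ 𝒜 an inclusion of separable von Neumann algebras such that there exists an (M,τ)-hypertrace on 𝒜 but no normal conditional expectation from 𝒜 onto M. Then the inclusion M ⊂ 𝒜 admits vanishing Furstenberg entropy: for every normal regular strongly generating hyperstate φ ∈ S_τ(B(L²(M))) with finite entropy H(φ) < ∞, there exists a net of normal faithful hyperstates (ζ_i) on 𝒜 with lim_i h_φ(𝒜,ζ_i) = 0. -/

import Mathlib

open scoped InnerProductSpace ComplexOrder ENNReal
open Filter Topology

set_option synthInstance.maxHeartbeats 400000
set_option maxHeartbeats 1000000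

noncomputable section

namespace Paper

instance (priority := 100) {H : Type} [NormedAddCommGroup H] [InnerProductSpace ℂ H]
    [CompleteSpace H] (M : VonNeumannAlgebra H) : Algebra ℂ M :=
  inferInstanceAs (Algebra ℂ M.toStarSubalgebra)

variable {H : Type} [NormedAddCommGroup H] [InnerProductSpace ℂ H] [CompleteSpace H]

/-! ### States on a von Neumann algebra -/

section States

variable (M : VonNeumannAlgebra H)

/-- A state on a von Neumann algebra: a unital positive linear functional. -/
def IsStateOn (φ : M →ₗ[ℂ] ℂ) : Prop :=
  φ 1 = 1 ∧ ∀ x : M, 0 ≤ φ (star x * x)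

/-- A linear functional on a (concretely represented) von Neumann algebra is normal iff it is
a countable sum of vector functionals. -/
def IsNormalOn (φ : M →ₗ[ℂ] ℂ) : Prop :=
  ∃ ξ : ℕ → H, Summable (fun k => ‖ξ k‖ ^ 2) ∧
    ∀ x : M, HasSum (fun k => ⟪ξ k, (x : H →L[ℂ] H) (ξ k)⟫_ℂ) (φ x)

def IsFaithfulOn (φ : M →ₗ[ℂ] ℂ) : Prop := ∀ x : M, φ (star x * x) = 0 → x = 0

def IsTracialOn (φ : M →ₗ[ℂ] ℂ) : Prop := ∀ x y : M, φ (x * y) = φ (y * x)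

def IsFactor : Prop := ∀ x : M, (∀ y : M, x * y = y * x) → ∃ c : ℂ, x = c • (1 : M)

def IsUnitaryEl (u : M) : Prop := star u * u = 1 ∧ u * star u = 1

/-- A `II₁` factor: an infinite-dimensional factor with a faithful normal tracial state. -/
structure IsII1Factor (τ : M →ₗ[ℂ] ℂ) : Prop where
  factor : IsFactor M
  state : IsStateOn M τ
  normal : IsNormalOn M τ
  tracial : IsTracialOn M τ
  faithful : IsFaithfulOn M τ
  infDim : ¬ FiniteDimensional ℂ M

/-- A net of unitaries of `M` converging weakly to `0`. -/
def WOTNullNet {ι : Type} (F : Filter ι) (u : ι → M) : Prop :=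
  ∀ v w : H, Tendsto (fun i => ⟪v, ((u i : M) : H →L[ℂ] H) w⟫_ℂ) F (𝓝 (0 : ℂ))

end States

/-! ### Representations and bimodules -/

variable {L : Type} [NormedAddCommGroup L] [InnerProductSpace ℂ L] [CompleteSpace L]

/-- A unital *-representation (no normality assumption). -/
structure Rep₀ (M : VonNeumannAlgebra H) (L : Type) [NormedAddCommGroup L]
    [InnerProductSpace ℂ L] [CompleteSpace L] where
  ρ : M → (L →L[ℂ] L)
  map_add : ∀ x y, ρ (x + y) = ρ x + ρ y
  map_smul : ∀ (c : ℂ) x, ρ (c • x) = c • ρ x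
  map_mul : ∀ x y, ρ (x * y) = ρ x * ρ y
  map_one : ρ 1 = 1
  map_star : ∀ x, ρ (star x) = ContinuousLinearMap.adjoint (ρ x)

/-- Normality of a map into `B(L)`: all its vector functionals are normal on `M`. -/
def RepNormal (M : VonNeumannAlgebra H) (ρ : M → (L →L[ℂ] L)) : Prop :=
  ∀ ξ : L, ∃ η : ℕ → H, Summable (fun k => ‖η k‖ ^ 2) ∧
    ∀ x : M, HasSum (fun k => ⟪η k, (x : H →L[ℂ] H) (η k)⟫_ℂ) ⟪ξ, ρ x ξ⟫_ℂ

/-- A normal unital *-representation. -/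
structure Rep (M : VonNeumannAlgebra H) (L : Type) [NormedAddCommGroup L]
    [InnerProductSpace ℂ L] [CompleteSpace L] extends Rep₀ M L where
  normal : RepNormal M ρ

/-- A normal unital *-antirepresentation (for right actions). -/
structure AntiRep (M : VonNeumannAlgebra H) (L : Type) [NormedAddCommGroup L]
    [InnerProductSpace ℂ L] [CompleteSpace L] where
  ρ : M → (L →L[ℂ] L)
  map_add : ∀ x y, ρ (x + y) = ρ x + ρ y
  map_smul : ∀ (c : ℂ) x, ρ (c • x) = c • ρ x
  map_mul : ∀ x y, ρ (x * y) = ρ y * ρ x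
  map_one : ρ 1 = 1
  map_star : ∀ x, ρ (star x) = ContinuousLinearMap.adjoint (ρ x)
  normal : RepNormal M ρ

/-- A (normal) Hilbert `M`-bimodule structure on `L`. -/
structure Bimodule (M : VonNeumannAlgebra H) (L : Type) [NormedAddCommGroup L]
    [InnerProductSpace ℂ L] [CompleteSpace L] where
  l : Rep M L
  r : AntiRep M L
  comm : ∀ x y, l.ρ x * r.ρ y = r.ρ y * l.ρ x

namespace Bimodule

variable {M : VonNeumannAlgebra H} (b : Bimodule M L)

/-- A central vector: `xξ = ξx` for all `x ∈ M`. -/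
def IsCentralVec (ξ : L) : Prop := ∀ x : M, b.l.ρ x ξ = b.r.ρ x ξ

/-- A net of `M`-almost central unit vectors. -/
def HasAlmostCentralUnitVecs : Prop :=
  ∃ (ι : Type) (F : Filter ι), F.NeBot ∧ ∃ ξ : ι → L, (∀ i, ‖ξ i‖ = 1) ∧
    ∀ x : M, Tendsto (fun i => ‖b.l.ρ x (ξ i) - b.r.ρ x (ξ i)‖) F (𝓝 0)

def LeftTracialVec (τ : M →ₗ[ℂ] ℂ) (ξ : L) : Prop := ∀ x : M, ⟪ξ, b.l.ρ x ξ⟫_ℂ = τ x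

def RightTracialVec (τ : M →ₗ[ℂ] ℂ) (ξ : L) : Prop := ∀ x : M, ⟪ξ, b.r.ρ x ξ⟫_ℂ = τ x

/-- `sup_{y ∈ (M)₁} |⟨u ξ y, η⟩|`. -/
def mixSupL (u : M) (ξ η : L) : ℝ :=
  ⨆ y : {y : M // ‖(y : H →L[ℂ] H)‖ ≤ 1}, ‖⟪η, b.l.ρ u (b.r.ρ y.1 ξ)⟫_ℂ‖

/-- `sup_{y ∈ (M)₁} |⟨y ξ u, η⟩|`. -/
def mixSupR (u : M) (ξ η : L) : ℝ :=
  ⨆ y : {y : M // ‖(y : H →L[ℂ] H)‖ ≤ 1}, ‖⟪η, b.r.ρ u (b.l.ρ y.1 ξ)⟫_ℂ‖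

def LeftMixing : Prop :=
  ∀ (ι : Type) (F : Filter ι) (u : ι → M), F.NeBot → (∀ i, IsUnitaryEl M (u i)) →
    WOTNullNet M F u →
    ∀ ξ η : L, Tendsto (fun i => b.mixSupL (u i) ξ η) F (𝓝 0)

def RightMixing : Prop :=
  ∀ (ι : Type) (F : Filter ι) (u : ι → M), F.NeBot → (∀ i, IsUnitaryEl M (u i)) →
    WOTNullNet M F u →
    ∀ ξ η : L, Tendsto (fun i => b.mixSupR (u i) ξ η) F (𝓝 0)

def Mixing : Prop := b.LeftMixing ∧ b.RightMixing

def LeftWeaklyMixing : Prop :=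
  ∃ (ι : Type) (F : Filter ι), F.NeBot ∧ ∃ u : ι → M, (∀ i, IsUnitaryEl M (u i)) ∧
    ∀ ξ η : L, Tendsto (fun i => b.mixSupL (u i) ξ η) F (𝓝 0)

def RightWeaklyMixing : Prop :=
  ∃ (ι : Type) (F : Filter ι), F.NeBot ∧ ∃ u : ι → M, (∀ i, IsUnitaryEl M (u i)) ∧
    ∀ ξ η : L, Tendsto (fun i => b.mixSupR (u i) ξ η) F (𝓝 0)

def WeaklyMixing : Prop := b.LeftWeaklyMixing ∧ b.RightWeaklyMixing

end Bimodule

/-- A bundled Hilbert `M`-bimodule. -/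
structure BimoduleSpace (M : VonNeumannAlgebra H) where
  carrier : Type
  [nacg : NormedAddCommGroup carrier]
  [ips : InnerProductSpace ℂ carrier]
  [cs : CompleteSpace carrier]
  bm : Bimodule M carrier

attribute [instance] BimoduleSpace.nacg BimoduleSpace.ips BimoduleSpace.cs

/-- Property (T): every `M`-bimodule with almost central unit vectors has a nonzero
central vector. -/
def HasPropertyT (M : VonNeumannAlgebra H) : Prop :=
  ∀ X : BimoduleSpace M, X.bm.HasAlmostCentralUnitVecs →
    ∃ ξ : X.carrier, ξ ≠ 0 ∧ X.bm.IsCentralVec ξ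

/-- The Haagerup property: `M` admits a mixing bimodule with almost central unit vectors. -/
def HasHaagerup (M : VonNeumannAlgebra H) : Prop :=
  ∃ X : BimoduleSpace M, X.bm.Mixing ∧ X.bm.HasAlmostCentralUnitVecs

end Paper

namespace Paper

variable {H : Type} [NormedAddCommGroup H] [InnerProductSpace ℂ H] [CompleteSpace H]

/-! ### Inclusions of von Neumann algebras -/

/-- A normal unital embedding `M ⊆ 𝒜` of von Neumann algebras. -/
structure Inclusion (M : VonNeumannAlgebra H) {K : Type} [NormedAddCommGroup K]
    [InnerProductSpace ℂ K] [CompleteSpace K] (A : VonNeumannAlgebra K) where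
  π : M →ₗ[ℂ] A
  map_one : π 1 = 1
  map_mul : ∀ x y, π (x * y) = π x * π y
  map_star : ∀ x, π (star x) = star (π x)
  inj : Function.Injective π
  normal : ∀ φ : A →ₗ[ℂ] ℂ, IsStateOn A φ → IsNormalOn A φ → IsNormalOn M (φ ∘ₗ π)

section Hyperstates

variable {M : VonNeumannAlgebra H} {K : Type} [NormedAddCommGroup K]
  [InnerProductSpace ℂ K] [CompleteSpace K] {A : VonNeumannAlgebra K}

/-- A `τ`-hyperstate on `𝒜`: a state restricting to `τ` on `M`. -/
def IsHyperstate (τ : M →ₗ[ℂ] ℂ) (inc : Inclusion M A) (ψ : A →ₗ[ℂ] ℂ) : Prop :=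
  IsStateOn A ψ ∧ ∀ x : M, ψ (inc.π x) = τ x

/-- An `(M,τ)`-hypertrace on `𝒜`: a hyperstate with `ψ(xT) = ψ(Tx)` for `x ∈ M`. -/
def IsHypertrace (τ : M →ₗ[ℂ] ℂ) (inc : Inclusion M A) (ψ : A →ₗ[ℂ] ℂ) : Prop :=
  IsHyperstate τ inc ψ ∧ ∀ (x : M) (T : A), ψ (inc.π x * T) = ψ (T * inc.π x)

/-- A conditional expectation from `𝒜` onto `M`. -/
structure CondExp (inc : Inclusion M A) where
  E : A →ₗ[ℂ] M
  map_one : E 1 = 1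
  pos : ∀ T : A, ((E (star T * T) : M) : H →L[ℂ] H).IsPositive
  bimod : ∀ (x y : M) (T : A), E (inc.π x * T * inc.π y) = x * E T * y
  retract : ∀ x : M, E (inc.π x) = x

/-- Normality for a conditional expectation. -/
def CondExp.IsNormal {inc : Inclusion M A} (CE : CondExp inc) : Prop :=
  ∀ φ : M →ₗ[ℂ] ℂ, IsStateOn M φ → IsNormalOn M φ → IsNormalOn A (φ ∘ₗ CE.E)

end Hyperstates

/-! ### Standard forms -/

/-- The Haagerup standard form `(𝒜, L²(𝒜), J, L²(𝒜)₊)` of a von Neumann algebra. -/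
structure StandardForm {K : Type} [NormedAddCommGroup K] [InnerProductSpace ℂ K]
    [CompleteSpace K] (A : VonNeumannAlgebra K) (L : Type) [NormedAddCommGroup L]
    [InnerProductSpace ℂ L] [CompleteSpace L] where
  rep : Rep A L
  J : L → L
  J_add : ∀ v w, J (v + w) = J v + J w
  J_smul : ∀ (c : ℂ) v, J (c • v) = (starRingEnd ℂ) c • J v
  J_inner : ∀ v w, ⟪J v, J w⟫_ℂ = ⟪w, v⟫_ℂ
  J_invol : ∀ v, J (J v) = v
  cone : Set L
  J_fix : ∀ v ∈ cone, J v = v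
  cone_pos : ∀ v ∈ cone, ∀ w ∈ cone, 0 ≤ (⟪v, w⟫_ℂ).re ∧ (⟪v, w⟫_ℂ).im = 0
  commutant : ∀ (T S : A) (v : L), rep.ρ T (J (rep.ρ S (J v))) = J (rep.ρ S (J (rep.ρ T v)))
  vec : ∀ ψ : A →ₗ[ℂ] ℂ, IsStateOn A ψ → IsNormalOn A ψ →
    ∃! ξ : L, ξ ∈ cone ∧ ∀ T : A, ψ T = ⟪ξ, rep.ρ T ξ⟫_ℂ

namespace StandardForm

variable {K : Type} [NormedAddCommGroup K] [InnerProductSpace ℂ K] [CompleteSpace K]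
  {A : VonNeumannAlgebra K} {L : Type} [NormedAddCommGroup L] [InnerProductSpace ℂ L]
  [CompleteSpace L]

/-- The canonical right action `ξ ↦ ξT = J T* J ξ` on the standard form. -/
def rmul (sf : StandardForm A L) (T : A) (v : L) : L := sf.J (sf.rep.ρ (star T) (sf.J v))

/-- Compatibility of an `M`-bimodule structure on `L²(𝒜)` with the standard form of `𝒜`,
for an inclusion `M ⊆ 𝒜`: the left action comes from the representation of `𝒜` and the
right action from `J (·)* J`. -/
def Compat {M : VonNeumannAlgebra H} (sf : StandardForm A L) (inc : Inclusion M A)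
    (b : Bimodule M L) : Prop :=
  (∀ x : M, b.l.ρ x = sf.rep.ρ (inc.π x)) ∧
  (∀ (x : M) (v : L), b.r.ρ x v = sf.rmul (inc.π x) v)

end StandardForm

/-- A bundled inclusion `M ⊆ 𝒜` of von Neumann algebras (with `𝒜` separable), together
with a standard form of `𝒜`. -/
structure InclusionData (M : VonNeumannAlgebra H) where
  K : Type
  [nacgK : NormedAddCommGroup K]
  [ipsK : InnerProductSpace ℂ K]
  [csK : CompleteSpace K]
  sepK : TopologicalSpace.SeparableSpace K
  A : VonNeumannAlgebra K
  inc : Inclusion M A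
  L : Type
  [nacgL : NormedAddCommGroup L]
  [ipsL : InnerProductSpace ℂ L]
  [csL : CompleteSpace L]
  sf : StandardForm A L

attribute [instance] InclusionData.nacgK InclusionData.ipsK InclusionData.csK
attribute [instance] InclusionData.nacgL InclusionData.ipsL InclusionData.csL

end Paper

namespace Paper

variable {H : Type} [NormedAddCommGroup H] [InnerProductSpace ℂ H] [CompleteSpace H]

/-! ### The GNS representation `L²(M,τ)` and hyperstates on `B(L²(M))` -/

/-- The GNS (standard) representation of `(M,τ)` on `L²(M,τ)`. -/
structure GNSRep (M : VonNeumannAlgebra H) (τ : M →ₗ[ℂ] ℂ) (L2M : Type)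
    [NormedAddCommGroup L2M] [InnerProductSpace ℂ L2M] [CompleteSpace L2M] where
  rep : Rep M L2M
  Ω : L2M
  cyclic : Dense (↑(Submodule.span ℂ (Set.range fun x : M => rep.ρ x Ω)) : Set L2M)
  repr : ∀ x : M, τ x = ⟪Ω, rep.ρ x Ω⟫_ℂ

section BL2M

variable {M : VonNeumannAlgebra H} {L2M : Type} [NormedAddCommGroup L2M]
  [InnerProductSpace ℂ L2M] [CompleteSpace L2M]

/-- A state on all of `B(L²(M))`. -/
def IsStateB (φ : (L2M →L[ℂ] L2M) →ₗ[ℂ] ℂ) : Prop :=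
  φ 1 = 1 ∧ ∀ T : L2M →L[ℂ] L2M, 0 ≤ φ (star T * T)

/-- A normal functional on `B(L²(M))` (a countable sum of vector functionals). -/
def IsNormalB (φ : (L2M →L[ℂ] L2M) →ₗ[ℂ] ℂ) : Prop :=
  ∃ ξ : ℕ → L2M, Summable (fun k => ‖ξ k‖ ^ 2) ∧
    ∀ T : L2M →L[ℂ] L2M, HasSum (fun k => ⟪ξ k, T (ξ k)⟫_ℂ) (φ T)

/-- A `τ`-hyperstate on `B(L²(M))`. -/
def IsHyperstateB (τ : M →ₗ[ℂ] ℂ) (gns : GNSRep M τ L2M)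
    (φ : (L2M →L[ℂ] L2M) →ₗ[ℂ] ℂ) : Prop :=
  IsStateB φ ∧ ∀ x : M, φ (gns.rep.ρ x) = τ x

/-- `∑ₙ zₙ* zₙ = 1` (in the strong sense). -/
def SumsToOne (z : ℕ → M) : Prop :=
  ∀ v : H, HasSum (fun n => ⟪((z n : M) : H →L[ℂ] H) v, ((z n : M) : H →L[ℂ] H) v⟫_ℂ) ⟪v, v⟫_ℂ

/-- The standard form `φ = ∑ₙ ⟨· ẑₙ*, ẑₙ*⟩` of a normal hyperstate on `B(L²(M))`. -/
def IsStdFormOf (τ : M →ₗ[ℂ] ℂ) (gns : GNSRep M τ L2M)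
    (φ : (L2M →L[ℂ] L2M) →ₗ[ℂ] ℂ) (z : ℕ → M) : Prop :=
  SumsToOne z ∧
  ∀ T : L2M →L[ℂ] L2M,
    HasSum (fun n => ⟪gns.rep.ρ (star (z n)) gns.Ω, T (gns.rep.ρ (star (z n)) gns.Ω)⟫_ℂ) (φ T)

/-- Regularity: `∑ₙ zₙ* zₙ = ∑ₙ zₙ zₙ* = 1`. -/
def IsRegularSeq (z : ℕ → M) : Prop :=
  SumsToOne z ∧ SumsToOne (fun n => star (z n))

/-- Strong generation: the unital (non-*) algebra generated by `{zₙ}` is weakly dense in `M`. -/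
def IsStronglyGenerating (z : ℕ → M) : Prop :=
  ∀ x : M, ∃ (ι : Type) (F : Filter ι), F.NeBot ∧
    ∃ a : ι → Algebra.adjoin ℂ (Set.range z),
      ∀ v w : H, Tendsto (fun i => ⟪v, (((a i : M) : M) : H →L[ℂ] H) w⟫_ℂ) F
        (𝓝 ⟪v, ((x : M) : H →L[ℂ] H) w⟫_ℂ)

end BL2M

/-! ### Modular theory data and Furstenberg entropy -/

/-- The GNS space of a normal faithful hyperstate `ζ` on `𝒜`, together with the embedding of
`L²(M)`, and the spectral data of the modular operator `Δ_ζ`: `P` is its projection-valued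
spectral measure, `μ ξ` the associated scalar spectral measures, `res t = (Δ_ζ + t)⁻¹`.  The
field `modular_rel` expresses `⟨Δ_ζ T Ω, T Ω⟩ = ‖T* Ω‖²`, i.e. `Δ_ζ = S* S` with
`S(TΩ) = T*Ω`. -/
structure ModularData {K : Type} [NormedAddCommGroup K] [InnerProductSpace ℂ K]
    [CompleteSpace K] {M : VonNeumannAlgebra H} {A : VonNeumannAlgebra K}
    {L2M : Type} [NormedAddCommGroup L2M] [InnerProductSpace ℂ L2M] [CompleteSpace L2M]
    (τ : M →ₗ[ℂ] ℂ) (inc : Inclusion M A) (gns : GNSRep M τ L2M) (ζ : A →ₗ[ℂ] ℂ) where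
  L : Type
  [nacg : NormedAddCommGroup L]
  [ips : InnerProductSpace ℂ L]
  [cs : CompleteSpace L]
  rep : Rep A L
  Ω : L
  cyclic : Dense (↑(Submodule.span ℂ (Set.range fun T : A => rep.ρ T Ω)) : Set L)
  state_eq : ∀ T : A, ζ T = ⟪Ω, rep.ρ T Ω⟫_ℂ
  emb : L2M →ₗᵢ[ℂ] L
  emb_Ω : emb gns.Ω = Ω
  emb_equiv : ∀ (x : M) (v : L2M), emb (gns.rep.ρ x v) = rep.ρ (inc.π x) (emb v)
  P : Set ℝ → (L →L[ℂ] L)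
  P_sa : ∀ S, IsSelfAdjoint (P S)
  P_idem : ∀ S, P S * P S = P S
  P_inter : ∀ S T : Set ℝ, MeasurableSet S → MeasurableSet T → P (S ∩ T) = P S * P T
  P_univ : P Set.univ = 1
  P_nonpos : P (Set.Iic 0) = 0
  P_sigma : ∀ S : ℕ → Set ℝ, (∀ n, MeasurableSet (S n)) → Pairwise (Function.onFun Disjoint S) →
    ∀ ξ : L, HasSum (fun n => P (S n) ξ) (P (⋃ n, S n) ξ)
  μ : L → MeasureTheory.Measure ℝ
  μ_eq : ∀ (ξ : L) (S : Set ℝ), MeasurableSet S → μ ξ S = ENNReal.ofReal (⟪ξ, P S ξ⟫_ℂ).re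
  modular_rel : ∀ T : A,
    ∫⁻ l, ENNReal.ofReal l ∂(μ (rep.ρ T Ω)) = ENNReal.ofReal (‖rep.ρ (star T) Ω‖ ^ 2)
  res : ℝ → (L →L[ℂ] L)
  res_eq : ∀ t : ℝ, 0 < t → ∀ ξ : L,
    ⟪ξ, res t ξ⟫_ℂ = ((∫ l, (l + t)⁻¹ ∂(μ ξ) : ℝ) : ℂ)

attribute [instance] ModularData.nacg ModularData.ips ModularData.cs

variable {K : Type} [NormedAddCommGroup K] [InnerProductSpace ℂ K] [CompleteSpace K]
  {M : VonNeumannAlgebra H} {A : VonNeumannAlgebra K} {L2M : Type}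
  [NormedAddCommGroup L2M] [InnerProductSpace ℂ L2M] [CompleteSpace L2M]

/-- The Furstenberg-type entropy `h_φ(𝒜,ζ) = -φ(e log Δ_ζ e)`, where the normal hyperstate
`φ = ∑ₙ ⟨· vecsₙ, vecsₙ⟩` is given by its defining sequence of vectors in `L²(M)`. -/
def fEntropy {τ : M →ₗ[ℂ] ℂ} {inc : Inclusion M A} {gns : GNSRep M τ L2M} {ζ : A →ₗ[ℂ] ℂ}
    (md : ModularData τ inc gns ζ) (vecs : ℕ → L2M) : ℝ :=
  - ∑' n, ∫ l, Real.log l ∂(md.μ (md.emb (vecs n)))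

/-- The canonical sequence of vectors `ẑₙ* = z_n^* Ω` attached to the standard form of a
normal hyperstate on `B(L²(M))`. -/
def stdVecs (gns : GNSRep M τ L2M) (z : ℕ → M) : ℕ → L2M :=
  fun n => gns.rep.ρ (star (z n)) gns.Ω

/-- The inclusion `M ⊆ 𝒜` admits vanishing Furstenberg entropy: there is a normal regular
strongly generating hyperstate `φ` on `B(L²(M))` and a net of normal faithful hyperstates
`ζᵢ` on `𝒜` with `h_φ(𝒜,ζᵢ) → 0`. -/
def AdmitsVanishingEntropy (τ : M →ₗ[ℂ] ℂ) (inc : Inclusion M A)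
    (gns : GNSRep M τ L2M) : Prop :=
  ∃ (φ : (L2M →L[ℂ] L2M) →ₗ[ℂ] ℂ) (z : ℕ → M),
    IsNormalB φ ∧ IsHyperstateB τ gns φ ∧ IsStdFormOf τ gns φ z ∧ IsRegularSeq z ∧
    IsStronglyGenerating z ∧
    ∃ (ι : Type) (F : Filter ι), F.NeBot ∧
      ∃ (ζ : ι → (A →ₗ[ℂ] ℂ)) (md : ∀ i, ModularData τ inc gns (ζ i)),
        (∀ i, IsHyperstate τ inc (ζ i) ∧ IsNormalOn A (ζ i) ∧ IsFaithfulOn A (ζ i)) ∧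
        Tendsto (fun i => fEntropy (md i) (stdVecs gns z)) F (𝓝 0)

/-- `M` has entropy gap: for every normal regular strongly generating hyperstate `φ` on
`B(L²(M))` there is `ε > 0` such that `h_φ(𝒜,ζ) > ε` for every inclusion `M ⊆ 𝒜` without
normal conditional expectation and every normal faithful hyperstate `ζ` on `𝒜`. -/
def HasEntropyGap (M : VonNeumannAlgebra H) (τ : M →ₗ[ℂ] ℂ) (gns : GNSRep M τ L2M) : Prop :=
  ∀ (φ : (L2M →L[ℂ] L2M) →ₗ[ℂ] ℂ) (z : ℕ → M),
    IsNormalB φ → IsHyperstateB τ gns φ → IsStdFormOf τ gns φ z → IsRegularSeq z →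
    IsStronglyGenerating z →
    ∃ ε : ℝ, 0 < ε ∧
      ∀ X : InclusionData M, (¬ ∃ CE : CondExp X.inc, CE.IsNormal) →
        ∀ (ζ : X.A →ₗ[ℂ] ℂ) (md : ModularData τ X.inc gns ζ),
          IsHyperstate τ X.inc ζ → IsNormalOn X.A ζ → IsFaithfulOn X.A ζ →
          ε < fEntropy md (stdVecs gns z)

end Paper

namespace Paper

set_option linter.unusedSectionVars false

/-! ### Weak operator limits -/

section WeakLimits

variable {L : Type*} [NormedAddCommGroup L] [InnerProductSpace ℂ L]

theorem clm_ext_inner {S T : L →L[ℂ] L} (h : ∀ ξ, ⟪ξ, S ξ⟫_ℂ = ⟪ξ, T ξ⟫_ℂ) : S = T := by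
  apply ContinuousLinearMap.coe_injective
  rw [← ext_inner_map]
  intro x
  have := congrArg (starRingEnd ℂ) (h x)
  simpa using this

theorem re_inner_nonneg_of_nonneg {T : L →L[ℂ] L} (hT : 0 ≤ T) (ξ : L) :
    0 ≤ (⟪ξ, T ξ⟫_ℂ).re :=
  ((ContinuousLinearMap.nonneg_iff_isPositive T).1 hT).re_inner_nonneg_right ξ

theorem tendsto_inner_of_tendsto_quadratic {ι : Type*} {F : Filter ι} {T : ι → L →L[ℂ] L}
    (h : ∀ ξ, ∃ c, Tendsto (fun i => ⟪ξ, T i ξ⟫_ℂ) F (𝓝 c)) (ξ η : L) :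
    ∃ c, Tendsto (fun i => ⟪ξ, T i η⟫_ℂ) F (𝓝 c) := by
  have h' : ∀ ξ, ∃ c, Tendsto (fun i => ⟪T i ξ, ξ⟫_ℂ) F (𝓝 c) := fun ξ => by
    obtain ⟨c, hc⟩ := h ξ
    refine ⟨starRingEnd ℂ c, ?_⟩
    exact ((Complex.continuous_conj.tendsto c).comp hc).congr fun i => inner_conj_symm _ _
  obtain ⟨c1, h1⟩ := h' (ξ + η)
  obtain ⟨c2, h2⟩ := h' (ξ - η)
  obtain ⟨c3, h3⟩ := h' (ξ + Complex.I • η)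
  obtain ⟨c4, h4⟩ := h' (ξ - Complex.I • η)
  have key : Tendsto (fun i => ⟪T i η, ξ⟫_ℂ) F
      (𝓝 ((c1 - c2 + Complex.I * c3 - Complex.I * c4) / 4)) := by
    have := ((((h1.sub h2).add (h3.const_mul Complex.I)).sub (h4.const_mul Complex.I)).div_const 4)
    refine this.congr fun i => ?_
    exact (inner_map_polarization (T i : L →ₗ[ℂ] L) ξ η).symm
  refine ⟨starRingEnd ℂ _, ((Complex.continuous_conj.tendsto _).comp key).congr fun i => ?_⟩
  simp

variable [CompleteSpace L]

theorem exists_weak_limit {ι : Type*} {F : Filter ι} [F.NeBot] {T : ι → L →L[ℂ] L} {R : ℝ}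
    (hR : ∀ᶠ i in F, ‖T i‖ ≤ R)
    (h : ∀ ξ η, ∃ c, Tendsto (fun i => ⟪ξ, T i η⟫_ℂ) F (𝓝 c)) :
    ∃ S : L →L[ℂ] L, ‖S‖ ≤ R ∧ ∀ ξ η, Tendsto (fun i => ⟪ξ, T i η⟫_ℂ) F (𝓝 ⟪ξ, S η⟫_ℂ) := by
  choose c hc using h
  have hR0 : 0 ≤ R := by
    obtain ⟨i, hi⟩ := hR.exists
    exact (norm_nonneg _).trans hi
  have hb : ∀ ξ η, ‖c ξ η‖ ≤ R * ‖ξ‖ * ‖η‖ := fun ξ η => by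
    refine le_of_tendsto (hc ξ η).norm (hR.mono fun i hi => ?_)
    calc ‖⟪ξ, T i η⟫_ℂ‖ ≤ ‖ξ‖ * ‖T i η‖ := norm_inner_le_norm _ _
      _ ≤ ‖ξ‖ * (R * ‖η‖) := by gcongr; exact (T i).le_of_opNorm_le hi η
      _ = R * ‖ξ‖ * ‖η‖ := by ring
  let Bl : L →ₛₗ[starRingEnd ℂ] L →ₗ[ℂ] ℂ := LinearMap.mk₂'ₛₗ (starRingEnd ℂ) (RingHom.id ℂ) c
    (fun x y w => tendsto_nhds_unique (hc (x + y) w)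
      (((hc x w).add (hc y w)).congr fun i => (inner_add_left _ _ _).symm))
    (fun a x w => tendsto_nhds_unique (hc (a • x) w)
      (((hc x w).const_mul (starRingEnd ℂ a)).congr fun i => (inner_smul_left _ _ _).symm))
    (fun x y w => tendsto_nhds_unique (hc x (y + w))
      (((hc x y).add (hc x w)).congr fun i => by simp))
    (fun a x w => tendsto_nhds_unique (hc x (a • w))
      (((hc x w).const_mul a).congr fun i => by simp))
  let B : L →L⋆[ℂ] L →L[ℂ] ℂ := LinearMap.mkContinuous₂ Bl R hb
  refine ⟨ContinuousLinearMap.adjoint (InnerProductSpace.continuousLinearMapOfBilin B), ?_, ?_⟩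
  · rw [LinearIsometryEquiv.norm_map]
    refine ContinuousLinearMap.opNorm_le_bound _ hR0 fun v => ?_
    have h1 := hb v (InnerProductSpace.continuousLinearMapOfBilin B v)
    have h2 : ⟪InnerProductSpace.continuousLinearMapOfBilin B v,
        InnerProductSpace.continuousLinearMapOfBilin B v⟫_ℂ = c v _ :=
      InnerProductSpace.continuousLinearMapOfBilin_apply B v _
    rw [← h2, inner_self_eq_norm_sq_to_K] at h1
    set t := ‖InnerProductSpace.continuousLinearMapOfBilin B v‖ with ht
    have h3 : t ^ 2 ≤ R * ‖v‖ * t := by simpa using h1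
    rcases (norm_nonneg (InnerProductSpace.continuousLinearMapOfBilin B v)).eq_or_lt with h0 | h0
    · rw [← ht] at h0; rw [← h0]; positivity
    · rw [← ht] at h0; nlinarith
  · intro ξ η
    rw [ContinuousLinearMap.adjoint_inner_right,
      InnerProductSpace.continuousLinearMapOfBilin_apply]
    exact hc ξ η

end WeakLimits

/-! ### The spectral measure of a self-adjoint operator -/

section SpectralMeasure

open MeasureTheory

variable {L : Type*} [NormedAddCommGroup L] [InnerProductSpace ℂ L] [CompleteSpace L]

theorem inner_clm_eq_re {T : L →L[ℂ] L} (hT : IsSelfAdjoint T) (ξ : L) :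
    ⟪ξ, T ξ⟫_ℂ = ((⟪ξ, T ξ⟫_ℂ).re : ℂ) := by
  have h : (⟪ξ, T ξ⟫_ℂ).im = 0 := by
    have h2 : ⟪T ξ, ξ⟫_ℂ = ⟪ξ, T ξ⟫_ℂ := hT.isSymmetric ξ ξ
    rw [← h2]
    exact hT.isSymmetric.im_inner_apply_self ξ
  exact Complex.ext (by simp) (by simpa using h)

theorem exists_scalar_spectral_measure {B : L →L[ℂ] L} (hB : IsSelfAdjoint B) (ξ : L) :
    ∃ ν : Measure ℝ, IsFiniteMeasure ν ∧ ν (spectrum ℝ B)ᶜ = 0 ∧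
      ∀ f : ℝ → ℝ, Continuous f → Integrable f ν ∧ ⟪ξ, cfc f B ξ⟫_ℂ = ((∫ l, f l ∂ν : ℝ) : ℂ) := by
  have : CompactSpace (spectrum ℝ B) := isCompact_iff_compactSpace.mp (spectrum.isCompact B)
  let Φ : CompactlySupportedContinuousMap (spectrum ℝ B) ℝ → (L →L[ℂ] L) :=
    fun f => cfcHom hB f.toContinuousMap
  have hmono : ∀ f g : CompactlySupportedContinuousMap (spectrum ℝ B) ℝ, f ≤ g →
      (⟪ξ, Φ f ξ⟫_ℂ).re ≤ (⟪ξ, Φ g ξ⟫_ℂ).re := fun f g h => by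
    have h1 : cfcHom hB f.toContinuousMap ≤ cfcHom hB g.toContinuousMap :=
      cfcHom_mono hB fun x => h x
    have h2 := re_inner_nonneg_of_nonneg (sub_nonneg.2 h1) ξ
    rw [sub_apply, inner_sub_right, Complex.sub_re] at h2
    exact sub_nonneg.1 h2
  let Λ : CompactlySupportedContinuousMap (spectrum ℝ B) ℝ →ₚ[ℝ] ℝ :=
    { toFun := fun f => (⟪ξ, Φ f ξ⟫_ℂ).re
      map_add' := fun f g => by
        have : Φ (f + g) = Φ f + Φ g := map_add (cfcHom hB) f.toContinuousMap g.toContinuousMap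
        rw [this, add_apply, inner_add_right, Complex.add_re]
      map_smul' := fun c f => by
        have : Φ (c • f) = c • Φ f := map_smul (cfcHom hB) c f.toContinuousMap
        rw [this, smul_apply, inner_smul_right_eq_smul]
        simp
      monotone' := fun f g h => hmono f g h }
  refine ⟨(RealRMK.rieszMeasure Λ).map Subtype.val, inferInstance, ?_, fun f hf => ⟨?_, ?_⟩⟩
  · rw [Measure.map_apply measurable_subtype_coe
      (spectrum.isCompact B).isClosed.measurableSet.compl]
    convert measure_empty (μ := RealRMK.rieszMeasure Λ)
    ext x; simp
  · rw [integrable_map_measure hf.aestronglyMeasurable measurable_subtype_coe.aemeasurable]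
    exact (hf.comp continuous_subtype_val).integrable_of_hasCompactSupport
      (HasCompactSupport.of_compactSpace _)
  · rw [integral_map measurable_subtype_coe.aemeasurable hf.aestronglyMeasurable]
    let g : CompactlySupportedContinuousMap (spectrum ℝ B) ℝ :=
      CompactlySupportedContinuousMap.continuousMapEquiv ⟨_, hf.comp continuous_subtype_val⟩
    have h1 := RealRMK.integral_rieszMeasure Λ g
    have h2 : Φ g = cfc f B := by
      rw [cfc_apply f B hB hf.continuousOn]
      rfl
    have h3 : Λ g = (⟪ξ, cfc f B ξ⟫_ℂ).re := by rw [← h2]; rfl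
    rw [inner_clm_eq_re (cfc_predicate f B), ← h3, ← h1]
    rfl

end SpectralMeasure

/-! ### The projection-valued spectral measure of a self-adjoint operator -/

section PVM

open MeasureTheory

variable {L : Type*} [NormedAddCommGroup L] [InnerProductSpace ℂ L]

theorem nonneg_of_inner_eq {T : L →L[ℂ] L} {q : L → ℝ} (h : ∀ ξ, ⟪ξ, T ξ⟫_ℂ = q ξ)
    (h0 : ∀ ξ, 0 ≤ q ξ) : 0 ≤ T := by
  rw [ContinuousLinearMap.nonneg_iff_isPositive, ContinuousLinearMap.isPositive_iff_complex]
  intro ξ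
  have h1 : ⟪T ξ, ξ⟫_ℂ = q ξ := by rw [← inner_conj_symm, h]; simp
  rw [h1]
  exact ⟨by simp, by simpa using h0 ξ⟩

variable [CompleteSpace L]

theorem norm_le_one_of_inner_eq {T : L →L[ℂ] L} {q : L → ℝ} (h : ∀ ξ, ⟪ξ, T ξ⟫_ℂ = q ξ)
    (h0 : ∀ ξ, 0 ≤ q ξ) (h1 : ∀ ξ, q ξ ≤ ‖ξ‖ ^ 2) : ‖T‖ ≤ 1 := by
  rw [CStarAlgebra.norm_le_one_iff_of_nonneg T (nonneg_of_inner_eq h h0), ← sub_nonneg]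
  refine nonneg_of_inner_eq (q := fun ξ => ‖ξ‖ ^ 2 - q ξ) (fun ξ => ?_)
    fun ξ => sub_nonneg.2 (h1 ξ)
  rw [sub_apply, inner_sub_right, h, one_apply_eq_self, inner_self_eq_norm_sq_to_K]
  push_cast
  rfl

theorem commute_of_weak_limit {T : ℕ → L →L[ℂ] L} {S U : L →L[ℂ] L}
    (h : ∀ ξ η, Tendsto (fun i => ⟪ξ, T i η⟫_ℂ) atTop (𝓝 ⟪ξ, S η⟫_ℂ))
    (hU : ∀ n, Commute U (T n)) : Commute U S := by
  refine clm_ext_inner fun ξ => ?_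
  have h1 := h (ContinuousLinearMap.adjoint U ξ) ξ
  have h2 := h ξ (U ξ)
  have h3 : ⟪ξ, (U * S) ξ⟫_ℂ = ⟪ContinuousLinearMap.adjoint U ξ, S ξ⟫_ℂ := by
    rw [ContinuousLinearMap.adjoint_inner_left]; rfl
  rw [h3]
  refine tendsto_nhds_unique h1 (h2.congr fun n => ?_)
  rw [ContinuousLinearMap.adjoint_inner_left]
  exact congrArg _ (DFunLike.congr_fun (hU n).eq ξ).symm

theorem cfc_sqrt_mul_self {T : L →L[ℂ] L} (hT : 0 ≤ T) :
    cfc Real.sqrt T * cfc Real.sqrt T = T := by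
  rw [← cfc_mul Real.sqrt Real.sqrt T]
  conv_rhs => rw [← cfc_id' ℝ T]
  exact cfc_congr fun x hx => Real.mul_self_sqrt (spectrum_nonneg_of_nonneg hT hx)

/-- The projection-valued measure `E` of `B` and its scalar measures `ν`. -/
theorem exists_pvm {B : L →L[ℂ] L} (hB : IsSelfAdjoint B) :
    ∃ (ν : L → Measure ℝ) (E : Set ℝ → L →L[ℂ] L), (∀ ξ, IsFiniteMeasure (ν ξ)) ∧
      (∀ ξ, ν ξ (spectrum ℝ B)ᶜ = 0) ∧
      (∀ ξ (f : ℝ → ℝ), Continuous f → Integrable f (ν ξ) ∧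
        ⟪ξ, cfc f B ξ⟫_ℂ = ((∫ l, f l ∂(ν ξ) : ℝ) : ℂ)) ∧
      (∀ ξ S, MeasurableSet S → ⟪ξ, E S ξ⟫_ℂ = ((ν ξ).real S : ℂ)) ∧
      (∀ S, IsSelfAdjoint (E S)) ∧ (∀ S, E S * E S = E S) ∧
      (∀ S T, MeasurableSet S → MeasurableSet T → E (S ∩ T) = E S * E T) ∧
      E Set.univ = 1 ∧
      (∀ S : ℕ → Set ℝ, (∀ n, MeasurableSet (S n)) → Pairwise (Function.onFun Disjoint S) →
        ∀ ξ, HasSum (fun n => E (S n) ξ) (E (⋃ n, S n) ξ)) := by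
  classical
  choose ν hfin hsupp hcfc using fun ξ => exists_scalar_spectral_measure hB ξ
  have huniv : ∀ ξ, (ν ξ).real Set.univ = ‖ξ‖ ^ 2 := fun ξ => by
    have h := (hcfc ξ (fun _ => 1) continuous_const).2
    rw [cfc_const_one ℝ B] at h
    rw [one_apply_eq_self, inner_self_eq_norm_sq_to_K, integral_const] at h
    have : (((ν ξ).real Set.univ : ℝ) : ℂ) = ((‖ξ‖ ^ 2 : ℝ) : ℂ) := by
      rw [smul_eq_mul, mul_one] at h
      rw [← h]; push_cast; rfl
    exact_mod_cast this
  have hle : ∀ ξ S, (ν ξ).real S ≤ ‖ξ‖ ^ 2 := fun ξ S => by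
    rw [← huniv]; exact measureReal_mono (Set.subset_univ S)
  let Good : Set ℝ → Prop := fun S => ∃ T : L →L[ℂ] L,
    (∀ U, Commute U B → Commute U T) ∧ ∀ ξ, ⟪ξ, T ξ⟫_ℂ = ((ν ξ).real S : ℂ)
  have hlim : ∀ (S : Set ℝ) (T : ℕ → L →L[ℂ] L) (q : ℕ → L → ℝ),
      (∀ n U, Commute U B → Commute U (T n)) → (∀ n ξ, ⟪ξ, T n ξ⟫_ℂ = q n ξ) →
      (∀ n ξ, 0 ≤ q n ξ) → (∀ n ξ, q n ξ ≤ ‖ξ‖ ^ 2) →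
      (∀ ξ, Tendsto (fun n => q n ξ) atTop (𝓝 ((ν ξ).real S))) → Good S := by
    intro S T q hc hq h0 h1 ht
    have ht' : ∀ ξ, Tendsto (fun n => ⟪ξ, T n ξ⟫_ℂ) atTop (𝓝 ((ν ξ).real S : ℂ)) := fun ξ => by
      simp_rw [hq]
      exact (Complex.continuous_ofReal.tendsto _).comp (ht ξ)
    obtain ⟨E, -, hE⟩ := exists_weak_limit (T := T) (F := atTop) (R := 1)
      (Eventually.of_forall fun n => norm_le_one_of_inner_eq (hq n) (h0 n) (h1 n))
      (tendsto_inner_of_tendsto_quadratic fun ξ => ⟨_, ht' ξ⟩)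
    exact ⟨E, fun U hU => commute_of_weak_limit hE fun n => hc n U hU,
      fun ξ => tendsto_nhds_unique (hE ξ ξ) (ht' ξ)⟩
  have hgood : ∀ S, MeasurableSet S → Good S := by
    refine MeasurableSpace.induction_on_inter (C := fun S _ => Good S)
      ((borel_eq_generateFrom_isClosed (α := ℝ)) ▸ BorelSpace.measurable_eq) isPiSystem_isClosed
      ⟨0, fun U _ => Commute.zero_right U, fun ξ => by simp⟩ ?_ ?_ ?_
    · intro S hS
      have hS : IsClosed S := hS
      have hcont : ∀ n, Continuous fun x => ((hS.apprSeq n x : NNReal) : ℝ) := fun n =>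
        NNReal.continuous_coe.comp (hS.apprSeq n).continuous
      refine hlim S (fun n => cfc (fun x => ((hS.apprSeq n x : NNReal) : ℝ)) B)
        (fun n ξ => ∫ l, ((hS.apprSeq n l : NNReal) : ℝ) ∂(ν ξ)) ?_ ?_ ?_ ?_ ?_
      · exact fun n U hU => (hU.symm.cfc_real _).symm
      · exact fun n ξ => (hcfc ξ _ (hcont n)).2
      · exact fun n ξ => integral_nonneg fun l => NNReal.coe_nonneg _
      · intro n ξ
        rw [← huniv ξ]
        have h1 : ∫ l, ((hS.apprSeq n l : NNReal) : ℝ) ∂(ν ξ) ≤ ∫ _, (1 : ℝ) ∂(ν ξ) :=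
          integral_mono (hcfc ξ _ (hcont n)).1 (integrable_const 1) fun l => by
            exact_mod_cast HasOuterApproxClosed.apprSeq_apply_le_one hS n l
        simpa using h1
      · intro ξ
        have h := HasOuterApproxClosed.tendsto_lintegral_apprSeq hS (ν ξ)
        have h2 := (ENNReal.tendsto_toReal (measure_ne_top (ν ξ) S)).comp h
        refine h2.congr fun n => ?_
        rw [integral_eq_lintegral_of_nonneg_ae (Eventually.of_forall fun l => NNReal.coe_nonneg _)
          (hcont n).aestronglyMeasurable]
        simp
    · rintro S hS ⟨T, hc, hT⟩
      refine ⟨1 - T, fun U hU => (Commute.one_right U).sub_right (hc U hU), fun ξ => ?_⟩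
      rw [sub_apply, inner_sub_right, hT, measureReal_compl hS, huniv,
        one_apply_eq_self, inner_self_eq_norm_sq_to_K]
      push_cast
      rfl
    · intro S hd hm h
      choose T hc hT using h
      have hpart : ∀ n ξ, ∑ i ∈ Finset.range n, (ν ξ).real (S i)
          = (ν ξ).real (⋃ i ∈ Finset.range n, S i) := fun n ξ =>
        (measureReal_biUnion_finset (fun i _ j _ hij => hd hij) fun i _ => hm i).symm
      refine hlim _ (fun n => ∑ i ∈ Finset.range n, T i)
        (fun n ξ => ∑ i ∈ Finset.range n, (ν ξ).real (S i)) ?_ ?_ ?_ ?_ ?_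
      · exact fun n U hU => Commute.sum_right _ _ _ fun i _ => hc i U hU
      · intro n ξ
        rw [sum_apply, inner_sum]
        push_cast
        exact Finset.sum_congr rfl fun i _ => hT i ξ
      · exact fun n ξ => Finset.sum_nonneg fun i _ => measureReal_nonneg
      · intro n ξ
        rw [hpart]; exact hle _ _
      · intro ξ
        have h2 := ENNReal.summable.hasSum (f := fun i => ν ξ (S i))
        rw [← measure_iUnion hd hm] at h2
        have h3 := (ENNReal.tendsto_toReal (measure_ne_top (ν ξ) _)).comp h2.tendsto_sum_nat
        refine h3.congr fun n => ?_
        simp only [Function.comp_apply]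
        rw [ENNReal.toReal_sum fun i _ => measure_ne_top _ _]
        rfl
  choose! E hEc hE using hgood
  have hE0 : ∀ S, MeasurableSet S → 0 ≤ E S := fun S hS =>
    nonneg_of_inner_eq (hE S hS) fun ξ => measureReal_nonneg
  have hcfcB : ∀ (f : ℝ → ℝ) S, MeasurableSet S → Commute (cfc f B) (E S) := fun f S hS =>
    hEc S hS _ ((Commute.refl B).cfc_real f)
  -- the scalar measure of `√E(S) ξ` is the restriction of that of `ξ` to `S`
  have hrestr : ∀ S, MeasurableSet S → ∀ ξ,
      ν (cfc Real.sqrt (E S) ξ) = (ν ξ).restrict S := by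
    intro S hS ξ
    refine ext_of_forall_lintegral_eq_of_IsFiniteMeasure fun f => ?_
    have hf : Continuous fun x => ((f x : NNReal) : ℝ) :=
      NNReal.continuous_coe.comp f.continuous
    set g : ℝ → ℝ := fun x => √(f x) with hg
    have hgc : Continuous g := Real.continuous_sqrt.comp hf
    have hsq : cfc g B * cfc g B = cfc (fun x => ((f x : NNReal) : ℝ)) B := by
      rw [← cfc_mul g g B hgc.continuousOn hgc.continuousOn]
      congr 1; ext x; exact Real.mul_self_sqrt (NNReal.coe_nonneg _)
    have hsa : IsSelfAdjoint (cfc g B) := cfc_predicate g B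
    have hdens : ν (cfc g B ξ) = (ν ξ).withDensity fun x => (f x : ENNReal) := by
      have : IsFiniteMeasure ((ν ξ).withDensity fun x => (f x : ENNReal)) :=
        isFiniteMeasure_withDensity (by
          have := (hcfc ξ _ hf).1.lintegral_lt_top
          simpa using this.ne)
      refine ext_of_forall_lintegral_eq_of_IsFiniteMeasure fun k => ?_
      have hk : Continuous fun x => ((k x : NNReal) : ℝ) :=
        NNReal.continuous_coe.comp k.continuous
      rw [lintegral_withDensity_eq_lintegral_mul _ f.measurable_coe_ennreal_comp
        k.measurable_coe_ennreal_comp]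
      have h1 := (hcfc (cfc g B ξ) _ hk).2
      have h2 := (hcfc ξ (fun x => ((f x : NNReal) : ℝ) * ((k x : NNReal) : ℝ)) (hf.mul hk)).2
      have h3 : ⟪cfc g B ξ, cfc (fun x => ((k x : NNReal) : ℝ)) B (cfc g B ξ)⟫_ℂ
          = ⟪ξ, cfc (fun x => ((f x : NNReal) : ℝ) * ((k x : NNReal) : ℝ)) B ξ⟫_ℂ := by
        rw [cfc_mul _ _ B hf.continuousOn hk.continuousOn, ← hsq]
        have h4 : ⟪cfc g B ξ, cfc (fun x => ((k x : NNReal) : ℝ)) B (cfc g B ξ)⟫_ℂ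
          = ⟪ξ, cfc g B (cfc (fun x => ((k x : NNReal) : ℝ)) B (cfc g B ξ))⟫_ℂ :=
          hsa.isSymmetric ξ _
        rw [h4]
        have h5 : Commute (cfc (fun x => ((k x : NNReal) : ℝ)) B) (cfc g B) := cfc_commute_cfc _ _ B
        have h6 := DFunLike.congr_fun h5.eq ξ
        have h7 : cfc (fun x => ((k x : NNReal) : ℝ)) B (cfc g B ξ)
          = cfc g B (cfc (fun x => ((k x : NNReal) : ℝ)) B ξ) := h6
        rw [h7]; rfl
      rw [h1, h2, Complex.ofReal_inj] at h3
      have h4 : (∫⁻ x, (k x : ENNReal) ∂ν (cfc g B ξ)) =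
          ENNReal.ofReal (∫ x, ((k x : NNReal) : ℝ) ∂ν (cfc g B ξ)) := by
        rw [ofReal_integral_eq_lintegral_ofReal (hcfc _ _ hk).1
          (Eventually.of_forall fun x => NNReal.coe_nonneg _)]
        simp
      have h5 : (∫⁻ x, ((fun x => (f x : ENNReal)) * fun x => (k x : ENNReal)) x ∂ν ξ) =
          ENNReal.ofReal (∫ x, ((f x : NNReal) : ℝ) * ((k x : NNReal) : ℝ) ∂ν ξ) := by
        rw [ofReal_integral_eq_lintegral_ofReal
          (f := fun x => ((f x : NNReal) : ℝ) * ((k x : NNReal) : ℝ)) (hcfc _ _ (hf.mul hk)).1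
          (Eventually.of_forall fun x => mul_nonneg (NNReal.coe_nonneg _) (NNReal.coe_nonneg _))]
        refine lintegral_congr fun x => ?_
        rw [ENNReal.ofReal_mul (NNReal.coe_nonneg _)]
        simp
      rw [h4, h5, h3]
    have hs : IsSelfAdjoint (cfc Real.sqrt (E S)) := cfc_predicate _ _
    have h1 : ⟪cfc Real.sqrt (E S) ξ,
        cfc (fun x => ((f x : NNReal) : ℝ)) B (cfc Real.sqrt (E S) ξ)⟫_ℂ
        = ⟪cfc g B ξ, E S (cfc g B ξ)⟫_ℂ := by
      have hc1 : cfc Real.sqrt (E S) * cfc g B = cfc g B * cfc Real.sqrt (E S) :=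
        (((hcfcB g S hS).symm).cfc_real _).eq
      calc _ = ⟪ξ, (cfc Real.sqrt (E S) * (cfc g B * cfc g B) * cfc Real.sqrt (E S)) ξ⟫_ℂ := by
            rw [hsq]; exact hs.isSymmetric ξ _
        _ = ⟪ξ, (cfc g B * (cfc Real.sqrt (E S) * cfc Real.sqrt (E S)) * cfc g B) ξ⟫_ℂ := by
            congr 2
            rw [← mul_assoc, hc1, mul_assoc, mul_assoc, ← hc1, mul_assoc, mul_assoc]
        _ = _ := by
            rw [cfc_sqrt_mul_self (hE0 S hS)]; exact (hsa.isSymmetric ξ _).symm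
    rw [(hcfc _ _ hf).2, hE S hS, Complex.ofReal_inj] at h1
    have h4 : (∫⁻ x, (f x : ENNReal) ∂ν (cfc Real.sqrt (E S) ξ)) =
          ENNReal.ofReal (∫ x, ((f x : NNReal) : ℝ) ∂ν (cfc Real.sqrt (E S) ξ)) := by
        rw [ofReal_integral_eq_lintegral_ofReal (hcfc _ _ hf).1
          (Eventually.of_forall fun x => NNReal.coe_nonneg _)]
        simp
    rw [h4, h1, ofReal_measureReal, hdens, withDensity_apply _ hS]
  have hmul : ∀ S T, MeasurableSet S → MeasurableSet T → E (S ∩ T) = E S * E T := by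
    intro S T hS hT
    refine clm_ext_inner fun ξ => ?_
    have hs : IsSelfAdjoint (cfc Real.sqrt (E T)) := cfc_predicate _ _
    have hc1 : E S * cfc Real.sqrt (E T) = cfc Real.sqrt (E T) * E S :=
      ((hEc S hS _ ((hEc T hT _ (Commute.refl B)).symm)).cfc_real _).symm.eq
    calc ⟪ξ, E (S ∩ T) ξ⟫_ℂ = ⟪cfc Real.sqrt (E T) ξ, E S (cfc Real.sqrt (E T) ξ)⟫_ℂ := by
          rw [hE _ (hS.inter hT), hE _ hS, hrestr T hT, measureReal_restrict_apply hS]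
      _ = ⟪ξ, (cfc Real.sqrt (E T) * E S * cfc Real.sqrt (E T)) ξ⟫_ℂ := hs.isSymmetric ξ _
      _ = _ := by rw [← hc1, mul_assoc, cfc_sqrt_mul_self (hE0 T hT)]
  have huniv' : E Set.univ = 1 := by
    refine clm_ext_inner fun ξ => ?_
    rw [hE _ MeasurableSet.univ, huniv, one_apply_eq_self, inner_self_eq_norm_sq_to_K]
    push_cast
    rfl
  have hidem : ∀ S, MeasurableSet S → E S * E S = E S := fun S hS => by
    rw [← hmul S S hS hS, Set.inter_self]
  have hsa : ∀ S, MeasurableSet S → IsSelfAdjoint (E S) := fun S hS => (hE0 S hS).isSelfAdjoint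
  refine ⟨ν, fun S => if MeasurableSet S then E S else 0, hfin, hsupp, hcfc, fun ξ S hS => ?_,
    fun S => ?_, fun S => ?_, fun S T hS hT => ?_, ?_, fun S hm hd ξ => ?_⟩
  · simp only [if_pos hS]; exact hE S hS ξ
  · dsimp only
    split_ifs with h
    exacts [hsa S h, IsSelfAdjoint.zero _]
  · dsimp only
    split_ifs with h
    exacts [hidem S h, mul_zero 0]
  · simp only [if_pos hS, if_pos hT, if_pos (hS.inter hT)]
    exact hmul S T hS hT
  · simp only [if_pos MeasurableSet.univ]
    exact huniv'
  · simp only [if_pos (hm _), if_pos (MeasurableSet.iUnion hm)]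
    have hsub : ∀ F : Finset ℕ, E (⋃ n, S n) - ∑ n ∈ F, E (S n)
        = E ((⋃ n, S n) \ ⋃ n ∈ F, S n) := by
      intro F
      have hmF : MeasurableSet (⋃ n ∈ F, S n) := F.measurableSet_biUnion fun n _ => hm n
      refine clm_ext_inner fun ξ => ?_
      rw [hE _ ((MeasurableSet.iUnion hm).diff hmF), sub_apply, inner_sub_right,
        hE _ (MeasurableSet.iUnion hm), sum_apply, inner_sum,
        measureReal_sdiff (Set.iUnion₂_subset fun n _ => Set.subset_iUnion S n) hmF,
        measureReal_biUnion_finset (fun i _ j _ hij => hd hij) fun i _ => hm i]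
      push_cast
      congr 1
      exact Finset.sum_congr rfl fun n _ => hE _ (hm n) ξ
    have hnorm : ∀ F : Finset ℕ, ‖(∑ n ∈ F, E (S n) ξ) - E (⋃ n, S n) ξ‖ ^ 2
        = (ν ξ).real (⋃ n, S n) - ∑ n ∈ F, (ν ξ).real (S n) := by
      intro F
      have hmF : MeasurableSet (⋃ n ∈ F, S n) := F.measurableSet_biUnion fun n _ => hm n
      have hmD := (MeasurableSet.iUnion hm).diff hmF
      have h1 : E (⋃ n, S n) ξ - (∑ n ∈ F, E (S n) ξ) = E ((⋃ n, S n) \ ⋃ n ∈ F, S n) ξ := by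
        rw [← hsub F, sub_apply, sum_apply]
      rw [norm_sub_rev, h1]
      have h2 : ((‖E ((⋃ n, S n) \ ⋃ n ∈ F, S n) ξ‖ ^ 2 : ℝ) : ℂ)
          = ⟪ξ, E ((⋃ n, S n) \ ⋃ n ∈ F, S n) ξ⟫_ℂ := by
        push_cast
        have h3 := inner_self_eq_norm_sq_to_K (𝕜 := ℂ) (E ((⋃ n, S n) \ ⋃ n ∈ F, S n) ξ)
        have h4 : ⟪E ((⋃ n, S n) \ ⋃ n ∈ F, S n) ξ, E ((⋃ n, S n) \ ⋃ n ∈ F, S n) ξ⟫_ℂ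
          = ⟪ξ, (E ((⋃ n, S n) \ ⋃ n ∈ F, S n) * E ((⋃ n, S n) \ ⋃ n ∈ F, S n)) ξ⟫_ℂ :=
          (hsa _ hmD).isSymmetric ξ _
        rw [hidem _ hmD] at h4
        rw [← h4]
        exact h3.symm
      rw [hE _ hmD, Complex.ofReal_inj,
        measureReal_sdiff (Set.iUnion₂_subset fun n _ => Set.subset_iUnion S n) hmF,
        measureReal_biUnion_finset (fun i _ j _ hij => hd hij) fun i _ => hm i] at h2
      exact h2
    have hsum : HasSum (fun n => (ν ξ).real (S n)) ((ν ξ).real (⋃ n, S n)) := by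
      simp only [Measure.real]
      have hne : ∑' n, ν ξ (S n) ≠ ⊤ := by
        rw [← measure_iUnion hd hm]
        exact measure_ne_top _ _
      rw [measure_iUnion hd hm, ENNReal.tsum_toReal_eq fun n => measure_ne_top _ _]
      exact ENNReal.hasSum_toReal hne
    rw [HasSum, tendsto_iff_norm_sub_tendsto_zero]
    have h5 : Tendsto (fun F : Finset ℕ => ‖(∑ n ∈ F, E (S n) ξ) - E (⋃ n, S n) ξ‖ ^ 2) atTop
        (𝓝 0) := by
      simp_rw [hnorm]
      simpa using hsum.const_sub ((ν ξ).real (⋃ n, S n))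
    have h6 := (Real.continuous_sqrt.tendsto 0).comp h5
    simpa [Function.comp_def, Real.sqrt_sq (norm_nonneg _)] using h6

end PVM

/-! ### The countable amplification of a Hilbert space -/

section Amplification

variable {G : Type*} [NormedAddCommGroup G] [InnerProductSpace ℂ G]

/-- The Hilbert space `G ⊗ ℓ²`. -/
abbrev Amp (G : Type*) [NormedAddCommGroup G] : Type _ := lp (fun _ : ℕ => G) 2

theorem hasSum_norm_sq (Ω : Amp G) : HasSum (fun k => ‖Ω k‖ ^ 2) (‖Ω‖ ^ 2) := by
  have h := lp.hasSum_norm (p := 2) (by norm_num) Ω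
  simpa using h

/-- The operator `T ⊗ 1` on `G ⊗ ℓ²`. -/
def amp (T : G →L[ℂ] G) : Amp G →L[ℂ] Amp G :=
  lp.mapCLM 2 (fun _ => T) (norm_nonneg T) (fun _ => le_rfl)

@[simp] theorem amp_apply (T : G →L[ℂ] G) (Ω : Amp G) (k : ℕ) : amp T Ω k = T (Ω k) := rfl

variable [CompleteSpace G]

/-- The amplification `T ↦ T ⊗ 1` as a `*`-homomorphism. -/
def ampHom (G : Type*) [NormedAddCommGroup G] [InnerProductSpace ℂ G] [CompleteSpace G] :
    (G →L[ℂ] G) →⋆ₐ[ℂ] (Amp G →L[ℂ] Amp G) where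
  toFun := amp
  map_one' := by ext Ω k; rfl
  map_mul' S T := by ext Ω k; rfl
  map_zero' := by ext Ω k; rfl
  map_add' S T := by ext Ω k; rfl
  commutes' c := by ext Ω k; rfl
  map_star' T := by
    symm
    rw [ContinuousLinearMap.star_eq_adjoint, ContinuousLinearMap.star_eq_adjoint]
    refine ContinuousLinearMap.ext fun Ω => ext_inner_left ℂ fun Ω' => ?_
    rw [ContinuousLinearMap.adjoint_inner_right, lp.inner_eq_tsum, lp.inner_eq_tsum]
    refine tsum_congr fun k => ?_
    rw [amp_apply, amp_apply, ContinuousLinearMap.adjoint_inner_right]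

theorem amp_add (S T : G →L[ℂ] G) : amp (S + T) = amp S + amp T := map_add (ampHom G) S T

theorem amp_sub (S T : G →L[ℂ] G) : amp (S - T) = amp S - amp T := map_sub (ampHom G) S T

theorem amp_smul (c : ℂ) (T : G →L[ℂ] G) : amp (c • T) = c • amp T := map_smul (ampHom G) c T

theorem amp_mul (S T : G →L[ℂ] G) : amp (S * T) = amp S * amp T := map_mul (ampHom G) S T

theorem amp_one : amp (1 : G →L[ℂ] G) = 1 := map_one (ampHom G)

theorem amp_star (T : G →L[ℂ] G) : amp (star T) = star (amp T) := map_star (ampHom G) T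

theorem amp_nonneg {T : G →L[ℂ] G} (hT : 0 ≤ T) : 0 ≤ amp T := map_nonneg (ampHom G) hT

theorem norm_amp_le (T : G →L[ℂ] G) : ‖amp T‖ ≤ ‖T‖ :=
  lp.norm_mapCLM_le 2 _ (norm_nonneg T) _

theorem hasSum_inner_amp (T : G →L[ℂ] G) (Ω Ω' : Amp G) :
    HasSum (fun k => ⟪Ω k, T (Ω' k)⟫_ℂ) ⟪Ω, amp T Ω'⟫_ℂ :=
  lp.hasSum_inner Ω (amp T Ω')

theorem amp_mul_apply (S T : G →L[ℂ] G) (Ω : Amp G) : amp (S * T) Ω = amp S (amp T Ω) := by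
  rw [amp_mul]; rfl

theorem inner_amp_star (T : G →L[ℂ] G) (Ω Ω' : Amp G) :
    ⟪amp (star T) Ω, Ω'⟫_ℂ = ⟪Ω, amp T Ω'⟫_ℂ := by
  rw [amp_star, ContinuousLinearMap.star_eq_adjoint, ContinuousLinearMap.adjoint_inner_left]

theorem inner_amp_star_right (T : G →L[ℂ] G) (Ω Ω' : Amp G) :
    ⟪Ω, amp (star T) Ω'⟫_ℂ = ⟪amp T Ω, Ω'⟫_ℂ := by
  rw [amp_star, ContinuousLinearMap.star_eq_adjoint, ContinuousLinearMap.adjoint_inner_right]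

/-- The normal functional `T ↦ ⟨(T ⊗ 1) Ω, Ω⟩`. -/
def wv (Ω : Amp G) : (G →L[ℂ] G) →ₗ[ℂ] ℂ where
  toFun T := ⟪Ω, amp T Ω⟫_ℂ
  map_add' S T := by rw [amp_add, add_apply, inner_add_right]
  map_smul' c T := by rw [amp_smul, smul_apply, inner_smul_right]; rfl

theorem wv_apply (Ω : Amp G) (T : G →L[ℂ] G) : wv Ω T = ⟪Ω, amp T Ω⟫_ℂ := rfl

theorem wv_star_mul (Ω : Amp G) (S T : G →L[ℂ] G) :
    wv Ω (star S * T) = ⟪amp S Ω, amp T Ω⟫_ℂ := by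
  rw [wv_apply, amp_mul_apply, inner_amp_star_right]

theorem wv_star_mul_self (Ω : Amp G) (S : G →L[ℂ] G) :
    wv Ω (star S * S) = ((‖amp S Ω‖ ^ 2 : ℝ) : ℂ) := by
  rw [wv_star_mul, inner_self_eq_norm_sq_to_K]; push_cast; rfl

theorem wv_one (Ω : Amp G) : wv Ω 1 = ((‖Ω‖ ^ 2 : ℝ) : ℂ) := by
  have := wv_star_mul_self Ω 1
  simpa [amp_one] using this

theorem wv_amp (Ω : Amp G) (S T : G →L[ℂ] G) : wv (amp S Ω) T = wv Ω (star S * T * S) := by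
  rw [wv_apply, wv_apply, amp_mul_apply, amp_mul_apply, inner_amp_star_right]

theorem wv_smul (c : ℂ) (Ω : Amp G) (T : G →L[ℂ] G) :
    wv (c • Ω) T = ((‖c‖ ^ 2 : ℝ) : ℂ) * wv Ω T := by
  rw [wv_apply, wv_apply, map_smul, inner_smul_left, inner_smul_right, ← mul_assoc,
    Complex.conj_mul']
  push_cast; rfl

theorem wv_nonneg (Ω : Amp G) {T : G →L[ℂ] G} (hT : 0 ≤ T) : 0 ≤ wv Ω T := by
  have h := ((ContinuousLinearMap.nonneg_iff_isPositive _).1 (amp_nonneg hT))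
  exact h.inner_nonneg_right Ω

theorem wv_mono (Ω : Amp G) {S T : G →L[ℂ] G} (h : S ≤ T) : wv Ω S ≤ wv Ω T := by
  have := wv_nonneg Ω (sub_nonneg.2 h)
  rw [map_sub] at this
  exact sub_nonneg.1 this

theorem norm_wv_le (Ω : Amp G) (T : G →L[ℂ] G) : ‖wv Ω T‖ ≤ ‖T‖ * ‖Ω‖ ^ 2 := by
  rw [wv_apply]
  calc _ ≤ ‖Ω‖ * ‖amp T Ω‖ := norm_inner_le_norm _ _
    _ ≤ ‖Ω‖ * (‖T‖ * ‖Ω‖) := by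
      gcongr; exact (amp T).le_of_opNorm_le (norm_amp_le T) Ω
    _ = _ := by ring

theorem hasSum_wv (Ω : Amp G) (T : G →L[ℂ] G) : HasSum (fun k => ⟪Ω k, T (Ω k)⟫_ℂ) (wv Ω T) :=
  hasSum_inner_amp T Ω Ω

theorem exists_amp_of_summable {ξ : ℕ → G} (h : Summable fun k => ‖ξ k‖ ^ 2) :
    ∃ Ω : Amp G, ∀ k, Ω k = ξ k :=
  ⟨⟨ξ, memℓp_gen (by simpa using h)⟩, fun _ => rfl⟩

theorem exists_wv_hasSum {ι : Type*} [Countable ι] (Ω : ι → Amp G)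
    (h : Summable fun j => ‖Ω j‖ ^ 2) :
    ∃ Ω' : Amp G, ∀ T, HasSum (fun j => wv (Ω j) T) (wv Ω' T) := by
  obtain ⟨e, he⟩ := exists_injective_nat (ι × ℕ)
  let ξ : ι × ℕ → G := fun p => Ω p.1 p.2
  have h1 : Summable fun p => ‖ξ p‖ ^ 2 := by
    rw [summable_prod_of_nonneg (fun p => by positivity)]
    refine ⟨fun j => (hasSum_norm_sq (Ω j)).summable, ?_⟩
    refine h.congr fun j => ?_
    exact (hasSum_norm_sq (Ω j)).tsum_eq.symm
  have h0 : ∀ n, n ∉ Set.range e → Function.extend e ξ 0 n = 0 := fun n hn => by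
    rw [Function.extend_apply' _ _ _ (by simpa using hn)]; rfl
  have h2 : Summable fun n => ‖Function.extend e ξ 0 n‖ ^ 2 := by
    rw [← he.summable_iff (fun n hn => by rw [h0 n hn]; simp)]
    refine h1.congr fun p => ?_
    rw [Function.comp_apply, he.extend_apply]
  obtain ⟨Ω', hΩ'⟩ := exists_amp_of_summable h2
  refine ⟨Ω', fun T => ?_⟩
  have h3 := hasSum_wv Ω' T
  simp only [hΩ'] at h3
  rw [← he.hasSum_iff (fun n hn => by rw [h0 n hn]; simp)] at h3
  refine HasSum.prod_fiberwise h3 fun j => ?_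
  have h4 := hasSum_wv (Ω j) T
  refine h4.congr_fun ?_ |> id
  intro k
  simp only [Function.comp_apply, he.extend_apply, ξ]

theorem exists_wv_add (Ω₁ Ω₂ : Amp G) : ∃ Ω' : Amp G, ∀ T, wv Ω' T = wv Ω₁ T + wv Ω₂ T := by
  obtain ⟨Ω', h⟩ := exists_wv_hasSum ![Ω₁, Ω₂] Summable.of_finite
  refine ⟨Ω', fun T => ?_⟩
  have := (h T).unique (hasSum_fintype _)
  simpa using this

theorem exists_wv_smul (Ω : Amp G) {c : ℝ} (hc : 0 ≤ c) :
    ∃ Ω' : Amp G, ∀ T, wv Ω' T = c * wv Ω T := by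
  refine ⟨((√c : ℝ) : ℂ) • Ω, fun T => ?_⟩
  rw [wv_smul, Complex.norm_real, Real.norm_of_nonneg (Real.sqrt_nonneg c), Real.sq_sqrt hc]

theorem exists_wv_vector (ξ : G) : ∃ Ω : Amp G, ∀ T, wv Ω T = ⟪ξ, T ξ⟫_ℂ := by
  obtain ⟨Ω, hΩ⟩ := exists_amp_of_summable (ξ := fun k : ℕ => if k = 0 then ξ else 0)
    (summable_of_ne_finset_zero (s := {0}) fun k hk => by simp_all)
  refine ⟨Ω, fun T => (hasSum_wv Ω T).unique ?_⟩
  convert! hasSum_ite_eq (0 : ℕ) (⟪ξ, T ξ⟫_ℂ) using 2 with k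
  rw [hΩ]
  split_ifs <;> simp

end Amplification

/-! ### Ultraweak compactness and positive functionals -/

section VonNeumann

variable {G : Type} [NormedAddCommGroup G] [InnerProductSpace ℂ G] [CompleteSpace G]

theorem isNormalOn_iff {S : VonNeumannAlgebra G} {f : S →ₗ[ℂ] ℂ} :
    IsNormalOn S f ↔ ∃ Ω : Amp G, ∀ x : S, f x = wv Ω x := by
  constructor
  · rintro ⟨ξ, h1, h2⟩
    obtain ⟨Ω, hΩ⟩ := exists_amp_of_summable h1
    refine ⟨Ω, fun x => (h2 x).unique ?_⟩
    have := hasSum_wv Ω (x : G →L[ℂ] G)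
    simpa only [hΩ] using this
  · rintro ⟨Ω, hΩ⟩
    exact ⟨Ω, (hasSum_norm_sq Ω).summable, fun x => by rw [hΩ]; exact hasSum_wv Ω _⟩

theorem cfc_mem {S : VonNeumannAlgebra G} {a : G →L[ℂ] G} (ha : a ∈ S)
    (f : ℝ → ℝ) : cfc f a ∈ S := by
  rw [← S.commutant_commutant, VonNeumannAlgebra.mem_commutant_iff]
  intro y hy
  have h : Commute a y := (VonNeumannAlgebra.mem_commutant_iff.1 hy) a ha
  exact ((Commute.cfc_real h f).symm).eq

theorem exists_wot_limit {ι : Type*} (𝒰 : Ultrafilter ι) {T : ι → G →L[ℂ] G} {R : ℝ}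
    (hR : ∀ᶠ i in 𝒰, ‖T i‖ ≤ R) :
    ∃ T' : G →L[ℂ] G, ‖T'‖ ≤ R ∧
      (∀ Ω Ω' : Amp G, Tendsto (fun i => ⟪Ω, amp (T i) Ω'⟫_ℂ) 𝒰 (𝓝 ⟪Ω, amp T' Ω'⟫_ℂ)) ∧
      ∀ S : VonNeumannAlgebra G, (∀ᶠ i in 𝒰, T i ∈ S) → T' ∈ S := by
  have hb : ∀ ξ η : G, ∀ᶠ i in 𝒰, ‖⟪ξ, T i η⟫_ℂ‖ ≤ ‖ξ‖ * (R * ‖η‖) := fun ξ η =>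
    hR.mono fun i hi => by
      calc ‖⟪ξ, T i η⟫_ℂ‖ ≤ ‖ξ‖ * ‖T i η‖ := norm_inner_le_norm _ _
        _ ≤ ‖ξ‖ * (R * ‖η‖) := by gcongr; exact (T i).le_of_opNorm_le hi η
  obtain ⟨T', h1, h2⟩ := exists_weak_limit (F := (𝒰 : Filter ι)) hR fun ξ η => by
    obtain ⟨c, -, hc⟩ := (isCompact_closedBall (0 : ℂ) (‖ξ‖ * (R * ‖η‖))).ultrafilter_le_nhds
      (𝒰.map fun i => ⟪ξ, T i η⟫_ℂ) (by
        rw [le_principal_iff]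
        change ∀ᶠ i in 𝒰, ⟪ξ, T i η⟫_ℂ ∈ Metric.closedBall (0 : ℂ) (‖ξ‖ * (R * ‖η‖))
        exact (hb ξ η).mono fun i hi => by simpa using hi)
    exact ⟨c, hc⟩
  refine ⟨T', h1, fun Ω Ω' => ?_, fun S hS => ?_⟩
  · have hs : Summable fun k => ‖Ω k‖ * (R * ‖Ω' k‖) := by
      have := (lp.summable_mul (by rw [Real.holderConjugate_iff]; norm_num) Ω Ω').mul_left R
      exact this.congr fun k => by ring
    have := tendsto_tsum_of_dominated_convergence (𝓕 := (𝒰 : Filter ι))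
      (f := fun i k => ⟪Ω k, T i (Ω' k)⟫_ℂ) hs (fun k => h2 (Ω k) (Ω' k))
      (hR.mono fun i hi k => by
        calc ‖⟪Ω k, T i (Ω' k)⟫_ℂ‖ ≤ ‖Ω k‖ * ‖T i (Ω' k)‖ := norm_inner_le_norm _ _
          _ ≤ ‖Ω k‖ * (R * ‖Ω' k‖) := by gcongr; exact (T i).le_of_opNorm_le hi _)
    rw [(hasSum_inner_amp T' Ω Ω').tsum_eq] at this
    exact this.congr fun i => (hasSum_inner_amp (T i) Ω Ω').tsum_eq
  · rw [← S.commutant_commutant, VonNeumannAlgebra.mem_commutant_iff]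
    intro y hy
    refine ContinuousLinearMap.ext fun η => ext_inner_left ℂ fun ξ => ?_
    have ha : Tendsto (fun i => ⟪ξ, y (T i η)⟫_ℂ) 𝒰 (𝓝 ⟪ξ, y (T' η)⟫_ℂ) := by
      have := h2 (ContinuousLinearMap.adjoint y ξ) η
      simpa only [ContinuousLinearMap.adjoint_inner_left] using this
    refine tendsto_nhds_unique ha ((h2 ξ (y η)).congr' (hS.mono fun i hi => ?_))
    have : T i * y = y * T i := (VonNeumannAlgebra.mem_commutant_iff.1 hy) _ hi
    exact congrArg (fun z => ⟪ξ, z⟫_ℂ) (DFunLike.congr_fun this η)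

theorem le_sub_sum_norm_sq_of_weak {E ι κ : Type*} [NormedAddCommGroup E] [InnerProductSpace ℂ E]
    {F : Filter ι} [F.NeBot] (s : Finset κ) {u : κ → ι → E} {v : κ → E} {c k : ℝ}
    (hu : ∀ j ∈ s, Tendsto (fun i => ⟪v j, u j i⟫_ℂ) F (𝓝 ⟪v j, v j⟫_ℂ))
    (h : ∀ᶠ i in F, c ≤ k - ∑ j ∈ s, ‖u j i‖ ^ 2) : c ≤ k - ∑ j ∈ s, ‖v j‖ ^ 2 := by
  have h1 : Tendsto (fun i => k - ∑ j ∈ s, (2 * (⟪v j, u j i⟫_ℂ).re - ‖v j‖ ^ 2)) F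
      (𝓝 (k - ∑ j ∈ s, (2 * (⟪v j, v j⟫_ℂ).re - ‖v j‖ ^ 2))) :=
    tendsto_const_nhds.sub (tendsto_finsetSum _ fun j hj =>
      (((Complex.continuous_re.tendsto _).comp (hu j hj)).const_mul 2).sub_const _)
  have h2 : ∀ j, 2 * (⟪v j, v j⟫_ℂ).re - ‖v j‖ ^ 2 = ‖v j‖ ^ 2 := fun j => by
    have : (⟪v j, v j⟫_ℂ).re = ‖v j‖ ^ 2 := by
      rw [inner_self_eq_norm_sq_to_K]; norm_cast
    rw [this]; ring
  simp only [h2] at h1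
  refine ge_of_tendsto h1 (h.mono fun i hi => hi.trans ?_)
  gcongr with j hj
  have := norm_sub_sq (𝕜 := ℂ) (v j) (u j i)
  simp only [RCLike.re_eq_complex_re] at this
  nlinarith [sq_nonneg ‖v j - u j i‖]

section Positive

variable {S : VonNeumannAlgebra G} {f : S →ₗ[ℂ] ℂ}

theorem exists_sqrt {x : S} (hx : 0 ≤ (x : G →L[ℂ] G)) :
    ∃ y : S, 0 ≤ (y : G →L[ℂ] G) ∧ star y = y ∧ y * y = x := by
  refine ⟨⟨_, cfc_mem x.2 Real.sqrt⟩, cfc_nonneg fun t _ => Real.sqrt_nonneg t, ?_, ?_⟩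
  · exact Subtype.ext (cfc_predicate Real.sqrt (x : G →L[ℂ] G))
  · exact Subtype.ext (cfc_sqrt_mul_self hx)

theorem map_nonneg_of_state (hf : ∀ x : S, 0 ≤ f (star x * x)) {x : S}
    (hx : 0 ≤ (x : G →L[ℂ] G)) : 0 ≤ f x := by
  obtain ⟨y, -, h1, h2⟩ := exists_sqrt hx
  have := hf y
  rwa [h1, h2] at this

theorem map_mono_of_state (hf : ∀ x : S, 0 ≤ f (star x * x)) {x y : S}
    (h : (x : G →L[ℂ] G) ≤ (y : G →L[ℂ] G)) : f x ≤ f y := by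
  have h1 : 0 ≤ ((y - x : S) : G →L[ℂ] G) := sub_nonneg.2 h
  have := map_nonneg_of_state hf h1
  rw [map_sub] at this
  exact sub_nonneg.1 this

theorem star_mul_self_coe_nonneg (x : S) : 0 ≤ ((star x * x : S) : G →L[ℂ] G) :=
  star_mul_self_nonneg (x : G →L[ℂ] G)

theorem wv_coe_state (Ω : Amp G) (x : S) : 0 ≤ wv Ω ((star x * x : S) : G →L[ℂ] G) :=
  wv_nonneg Ω (star_mul_self_coe_nonneg x)

/-- The restriction of a normal functional to a von Neumann algebra. -/
def vf (S : VonNeumannAlgebra G) (Ω : Amp G) : S →ₗ[ℂ] ℂ where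
  toFun x := wv Ω x
  map_add' _ _ := map_add (wv Ω) _ _
  map_smul' c x := map_smul (wv Ω) c (x : G →L[ℂ] G)

theorem vf_apply (Ω : Amp G) (x : S) : vf S Ω x = wv Ω x := rfl

theorem isNormalOn_vf (Ω : Amp G) : IsNormalOn S (vf S Ω) := isNormalOn_iff.2 ⟨Ω, fun _ => rfl⟩

theorem coe_one_vn : ((1 : S) : G →L[ℂ] G) = 1 := rfl

theorem isStateOn_vf {Ω : Amp G} (h : ‖Ω‖ = 1) : IsStateOn S (vf S Ω) := by
  refine ⟨?_, fun x => wv_coe_state Ω x⟩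
  rw [vf_apply, coe_one_vn, wv_one, h]; simp

theorem linearMap_ext_of_nonneg {f g : S →ₗ[ℂ] ℂ}
    (h : ∀ x : S, 0 ≤ (x : G →L[ℂ] G) → f x = g x) : f = g := by
  have hsa : ∀ x : S, IsSelfAdjoint (x : G →L[ℂ] G) → f x = g x := fun x hx => by
    have h1 : f 1 = g 1 := h 1 (by rw [coe_one_vn]; exact zero_le_one)
    have h2 : 0 ≤ ((x + (‖(x : G →L[ℂ] G)‖ : ℂ) • 1 : S) : G →L[ℂ] G) := by
      have := hx.neg_algebraMap_norm_le_self
      rw [neg_le_iff_add_nonneg] at this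
      rw [Algebra.algebraMap_eq_smul_one, ← Complex.coe_smul] at this
      exact this
    have h3 := h _ h2
    rw [map_add, map_add, map_smul, map_smul, h1] at h3
    exact add_right_cancel h3
  refine LinearMap.ext fun x => ?_
  have h1 := hsa (x + star x) (IsSelfAdjoint.add_star_self (x : G →L[ℂ] G))
  have h2 := hsa (Complex.I • (star x - x)) (by
    change star (Complex.I • (star (x : G →L[ℂ] G) - (x : G →L[ℂ] G))) =
      Complex.I • (star (x : G →L[ℂ] G) - (x : G →L[ℂ] G))
    rw [star_smul, star_sub, star_star, Complex.star_def, Complex.conj_I, neg_smul,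
      ← smul_neg, neg_sub])
  rw [map_smul, map_smul, smul_right_inj Complex.I_ne_zero, map_sub, map_sub] at h2
  rw [map_add, map_add] at h1
  linear_combination (h1 - h2) / 2

end Positive

end VonNeumann

section InclusionLemmas

variable {H : Type} [NormedAddCommGroup H] [InnerProductSpace ℂ H] [CompleteSpace H]
  {K : Type} [NormedAddCommGroup K] [InnerProductSpace ℂ K] [CompleteSpace K]
  {M : VonNeumannAlgebra H} {A : VonNeumannAlgebra K}

theorem Inclusion.map_nonneg (inc : Inclusion M A) {x : M} (hx : 0 ≤ (x : H →L[ℂ] H)) :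
    0 ≤ (inc.π x : K →L[ℂ] K) := by
  obtain ⟨y, -, h1, h2⟩ := exists_sqrt hx
  rw [← h2, inc.map_mul]
  nth_rewrite 1 [← h1]
  rw [inc.map_star]
  exact star_mul_self_coe_nonneg _

theorem Inclusion.exists_wv (inc : Inclusion M A) (Ω : Amp K) :
    ∃ Ω' : Amp H, ∀ x : M, wv Ω (inc.π x : K →L[ℂ] K) = wv Ω' (x : H →L[ℂ] H) := by
  by_cases h : Ω = 0
  · refine ⟨0, fun x => ?_⟩
    subst h
    simp [wv_apply]
  have hn : ‖Ω‖ ≠ 0 := norm_ne_zero_iff.2 h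
  have h1 : ‖((‖Ω‖⁻¹ : ℝ) : ℂ) • Ω‖ = 1 := by
    rw [norm_smul]; simp [hn]
  obtain ⟨Ω', hΩ'⟩ := isNormalOn_iff.1
    (inc.normal _ (isStateOn_vf (S := A) h1) (isNormalOn_vf _))
  refine ⟨((‖Ω‖ : ℝ) : ℂ) • Ω', fun x => ?_⟩
  rw [wv_smul, ← hΩ', LinearMap.comp_apply, vf_apply, wv_smul, ← mul_assoc, ← Complex.ofReal_mul]
  have : ‖((‖Ω‖ : ℝ) : ℂ)‖ ^ 2 * ‖((‖Ω‖⁻¹ : ℝ) : ℂ)‖ ^ 2 = 1 := by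
    rw [← mul_pow, ← norm_mul, ← Complex.ofReal_mul, mul_inv_cancel₀ hn]; simp
  rw [this]; simp

end InclusionLemmas

/-! ### A minimax lemma -/

section Minimax

variable {V E : Type*} [AddCommGroup V] [Module ℝ V] [AddCommGroup E] [Module ℝ E]
  {J : Set V} {B : Set E} {f : V → E → ℝ}

theorem exists_forall_finset_neg_lt (hconc : ∀ j ∈ J, ConcaveOn ℝ B (f j))
    (hconv : ∀ T ∈ B, ConvexOn ℝ J (fun j => f j T)) (hJ : Convex ℝ J)
    (h : ∀ j ∈ J, ∀ δ > 0, ∃ T ∈ B, -δ < f j T) (hB : B.Nonempty)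
    (s : Finset V) (hs : ∀ j ∈ s, j ∈ J) {δ : ℝ} (hδ : 0 < δ) :
    ∃ T ∈ B, ∀ j ∈ s, -δ < f j T := by
  classical
  let C : Set (s → ℝ) := {r | ∃ T ∈ B, ∀ j, r j < f j T + δ}
  by_contra hcon
  have h0 : (0 : s → ℝ) ∉ C := by
    rintro ⟨T, hT, hr⟩
    refine hcon ⟨T, hT, fun j hj => ?_⟩
    have := hr ⟨j, hj⟩
    simp only [Pi.zero_apply] at this
    linarith
  have hCo : IsOpen C := by
    have : C = ⋃ T ∈ B, {r | ∀ j : s, r j < f j T + δ} := by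
      ext r; simp [C]
    rw [this]
    refine isOpen_biUnion fun T _ => ?_
    simp only [Set.ofPred_forall]
    exact isOpen_iInter_of_finite fun j => isOpen_lt (continuous_apply j) continuous_const
  have hCc : Convex ℝ C := by
    rintro r ⟨T, hT, hr⟩ r' ⟨T', hT', hr'⟩ p q hp hq hpq
    have hBc : Convex ℝ B := by
      by_cases hj : s.Nonempty
      · obtain ⟨j, hj⟩ := hj
        exact (hconc j (hs j hj)).1
      · refine absurd ?_ h0
        exact ⟨T, hT, fun j => (hj ⟨j, j.2⟩).elim⟩
    refine ⟨p • T + q • T', hBc hT hT' hp hq hpq, fun j => ?_⟩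
    have h1 := (hconc j (hs j j.2)).2 hT hT' hp hq hpq
    simp only [smul_eq_mul] at h1
    simp only [Pi.add_apply, Pi.smul_apply, smul_eq_mul]
    rcases hp.eq_or_lt with hp0 | hp0
    · have : q = 1 := by linarith
      subst this
      subst hp0
      have := hr' j
      linarith
    · have h2 := mul_lt_mul_of_pos_left (hr j) hp0
      have h3 := mul_le_mul_of_nonneg_left (hr' j).le hq
      nlinarith
  obtain ⟨φ, hφ⟩ := geometric_hahn_banach_open_point hCc hCo h0
  rw [map_zero] at hφ
  set w : s → ℝ := fun j => φ (Pi.single j 1) with hw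
  have hφr : ∀ r, φ r = ∑ j, r j * w j := fun r => by
    have := LinearMap.pi_apply_eq_sum_univ (φ : (s → ℝ) →ₗ[ℝ] ℝ) r
    simp only [smul_eq_mul] at this
    refine this.trans (Finset.sum_congr rfl fun j _ => ?_)
    congr 1
    change φ _ = φ _
    congr 1
    ext k
    simp [Pi.single_apply, eq_comm]
  obtain ⟨T₀, hT₀⟩ := hB
  have hne : ∀ T ∈ B, ∀ c : ℝ, c < δ → (fun j : s => f j T + c) ∈ C := fun T hT c hc =>
    ⟨T, hT, fun j => by linarith⟩
  have hw0 : ∀ j, 0 ≤ w j := fun j => by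
    by_contra hneg
    push Not at hneg
    let r : s → ℝ := fun j => f j T₀ + 0
    have hr : r ∈ C := hne T₀ hT₀ 0 hδ
    have hr2 : ∀ t : ℝ, 0 ≤ t → r - t • Pi.single j 1 ∈ C := fun t ht => by
      obtain ⟨T, hT, hr⟩ := hr
      refine ⟨T, hT, fun k => lt_of_le_of_lt ?_ (hr k)⟩
      simp only [Pi.sub_apply, Pi.smul_apply, smul_eq_mul, sub_le_self_iff]
      refine mul_nonneg ht ?_
      rw [Pi.single_apply]
      split_ifs <;> norm_num
    have h1 := hφ _ (hr2 (|φ r| / (-w j)) (div_nonneg (abs_nonneg _) (by linarith)))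
    rw [map_sub, map_smul, smul_eq_mul] at h1
    change φ r - |φ r| / (-w j) * w j < 0 at h1
    have h2 : |φ r| / (-w j) * w j = -|φ r| := by
      field_simp [hneg.ne]
    rw [h2] at h1
    linarith [neg_abs_le (φ r)]
  have hW : 0 < ∑ j, w j := by
    refine (Finset.sum_nonneg fun j _ => hw0 j).lt_of_ne fun h1 => ?_
    have h2 := (Finset.sum_eq_zero_iff_of_nonneg fun j _ => hw0 j).1 h1.symm
    have h3 := hφ _ (hne T₀ hT₀ 0 hδ)
    rw [hφr] at h3
    rw [Finset.sum_eq_zero fun j hj => by rw [h2 j hj, mul_zero]] at h3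
    exact lt_irrefl _ h3
  set W := ∑ j, w j with hWdef
  have hw1 : ∑ j, w j / W = 1 := by rw [← Finset.sum_div, ← hWdef, div_self hW.ne']
  have hmem : ∑ j : s, (w j / W) • (j : V) ∈ J :=
    hJ.sum_mem (fun j _ => div_nonneg (hw0 j) hW.le) hw1 fun j _ => hs j j.2
  obtain ⟨T, hT, hTj⟩ := h _ hmem (δ / 2) (by linarith)
  have h1 := (hconv T hT).map_sum_le (t := Finset.univ) (w := fun j : s => w j / W)
    (p := fun j : s => (j : V)) (fun j _ => div_nonneg (hw0 j) hW.le) hw1 fun j _ => hs j j.2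
  have h2 := hφ _ (hne T hT (δ / 2) (by linarith))
  rw [hφr] at h2
  have h3 : ∑ j : s, (f j T + δ / 2) * w j = W * (∑ j : s, (w j / W) • f j T + δ / 2) := by
    rw [mul_add, Finset.mul_sum, hWdef, Finset.sum_mul, ← Finset.sum_add_distrib, ← hWdef]
    refine Finset.sum_congr rfl fun j _ => ?_
    rw [smul_eq_mul]
    field_simp
  rw [h3] at h2
  have h4 : 0 < ∑ j : s, (w j / W) • f j T + δ / 2 := by linarith
  have := mul_pos hW h4
  linarith

theorem minimax (hconc : ∀ j ∈ J, ConcaveOn ℝ B (f j))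
    (hconv : ∀ T ∈ B, ConvexOn ℝ J (fun j => f j T)) (hJ : Convex ℝ J) (hB : B.Nonempty)
    (hcomp : ∀ 𝒰 : Ultrafilter E, B ∈ 𝒰 →
      ∃ T ∈ B, ∀ j ∈ J, ∀ c, (∀ᶠ x in 𝒰, c ≤ f j x) → c ≤ f j T)
    (h : ∀ j ∈ J, ∀ δ > 0, ∃ T ∈ B, -δ < f j T) : ∃ T ∈ B, ∀ j ∈ J, 0 ≤ f j T := by
  classical
  have key : ∀ p : Finset J × ℕ, ∃ T ∈ B, ∀ j ∈ p.1, -(1 / ((p.2 : ℝ) + 1)) < f j T := by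
    intro p
    obtain ⟨T, hT, h1⟩ := exists_forall_finset_neg_lt hconc hconv hJ h hB
      (p.1.map (Function.Embedding.subtype _)) (fun j hj => by
        obtain ⟨k, -, rfl⟩ := Finset.mem_map.1 hj; exact k.2)
      (δ := 1 / ((p.2 : ℝ) + 1)) (by positivity)
    exact ⟨T, hT, fun j hj => h1 j (Finset.mem_map_of_mem _ hj)⟩
  choose T hTB hT using key
  let 𝒰 : Ultrafilter E := (Ultrafilter.of (atTop : Filter (Finset J × ℕ))).map T
  obtain ⟨T', hT'B, hT'⟩ := hcomp 𝒰 (Filter.Eventually.of_forall (p := fun p => T p ∈ B) hTB)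
  refine ⟨T', hT'B, fun j hj => ?_⟩
  refine le_of_forall_pos_le_add fun δ hδ => ?_
  obtain ⟨N, hN⟩ := exists_nat_one_div_lt (hδ)
  have h1 : ∀ᶠ p in (atTop : Filter (Finset J × ℕ)), -δ ≤ f j (T p) := by
    filter_upwards [eventually_ge_atTop (({⟨j, hj⟩} : Finset J), N)] with p hp
    have h2 := hT p ⟨j, hj⟩ (hp.1 (by simp))
    have h3 : 1 / ((p.2 : ℝ) + 1) ≤ 1 / ((N : ℝ) + 1) := by
      have : (N : ℝ) ≤ p.2 := by exact_mod_cast hp.2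
      gcongr
    change -(1 / ((p.2 : ℝ) + 1)) < f j (T p) at h2
    linarith
  have h4 := hT' j hj (-δ) (Ultrafilter.of_le (atTop : Filter (Finset J × ℕ)) h1)
  linarith

end Minimax

/-! ### The positive part of the unit ball and Radon–Nikodym derivatives -/

section RadonNikodym

variable {G : Type} [NormedAddCommGroup G] [InnerProductSpace ℂ G] [CompleteSpace G]
  {S : VonNeumannAlgebra G}

/-- The operators `0 ≤ a ≤ 1` in a von Neumann algebra. -/
def unitInt (S : VonNeumannAlgebra G) : Set (G →L[ℂ] G) := {a | a ∈ S ∧ 0 ≤ a ∧ a ≤ 1}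

theorem smul_mem_vn {T : G →L[ℂ] G} (hT : T ∈ S) (c : ℂ) : c • T ∈ S :=
  S.toStarSubalgebra.smul_mem hT c

theorem real_smul_mem_vn {T : G →L[ℂ] G} (hT : T ∈ S) (c : ℝ) : c • T ∈ S := by
  rw [← Complex.coe_smul]; exact smul_mem_vn hT c

theorem zero_mem_unitInt : (0 : G →L[ℂ] G) ∈ unitInt S :=
  ⟨zero_mem S, le_rfl, zero_le_one⟩

theorem convex_unitInt : Convex ℝ (unitInt S) := by
  rintro x ⟨h1, h2, h3⟩ y ⟨h4, h5, h6⟩ a b ha hb hab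
  refine ⟨add_mem (real_smul_mem_vn h1 a) (real_smul_mem_vn h4 b),
    add_nonneg (smul_nonneg ha h2) (smul_nonneg hb h5), ?_⟩
  have h7 := add_nonneg (smul_nonneg ha (sub_nonneg.2 h3)) (smul_nonneg hb (sub_nonneg.2 h6))
  rw [← sub_nonneg]
  convert h7 using 1
  have : (1 : G →L[ℂ] G) = a • 1 + b • 1 := by rw [← add_smul, hab, one_smul]
  nth_rewrite 1 [this]
  rw [smul_sub, smul_sub]
  abel

theorem nonneg_of_wot_limit {ι : Type*} {F : Filter ι} [F.NeBot] {T : ι → G →L[ℂ] G}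
    {T' : G →L[ℂ] G}
    (h : ∀ Ω Ω' : Amp G, Tendsto (fun i => ⟪Ω, amp (T i) Ω'⟫_ℂ) F (𝓝 ⟪Ω, amp T' Ω'⟫_ℂ))
    (h0 : ∀ᶠ i in F, 0 ≤ T i) : 0 ≤ T' := by
  have h1 : ∀ ξ, 0 ≤ ⟪ξ, T' ξ⟫_ℂ := fun ξ => by
    obtain ⟨Ω, hΩ⟩ := exists_wv_vector ξ
    rw [← hΩ]
    exact ge_of_tendsto (h Ω Ω) (h0.mono fun i hi => wv_nonneg Ω hi)
  refine nonneg_of_inner_eq (q := fun ξ => (⟪ξ, T' ξ⟫_ℂ).re) (fun ξ => ?_)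
    fun ξ => (Complex.nonneg_iff.1 (h1 ξ)).1
  exact Complex.ext (by simp) (by simpa using (Complex.nonneg_iff.1 (h1 ξ)).2.symm)

theorem norm_le_one_of_mem_unitInt {a : G →L[ℂ] G} (h : a ∈ unitInt S) : ‖a‖ ≤ 1 :=
  (CStarAlgebra.norm_le_one_iff_of_nonneg a h.2.1).2 h.2.2

theorem unitInt_compact (𝒰 : Ultrafilter (G →L[ℂ] G)) (h : unitInt S ∈ 𝒰) :
    ∃ T' ∈ unitInt S, ∀ Ω Ω' : Amp G,
      Tendsto (fun T => ⟪Ω, amp T Ω'⟫_ℂ) 𝒰 (𝓝 ⟪Ω, amp T' Ω'⟫_ℂ) := by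
  obtain ⟨T', -, h1, h2⟩ := exists_wot_limit 𝒰 (T := fun T => T) (R := 1)
    (Filter.mem_of_superset h fun a ha => norm_le_one_of_mem_unitInt ha)
  refine ⟨T', ⟨h2 S (Filter.mem_of_superset h fun a ha => ha.1), nonneg_of_wot_limit h1
    (Filter.mem_of_superset h fun a ha => ha.2.1), ?_⟩, h1⟩
  rw [← sub_nonneg]
  refine nonneg_of_wot_limit (F := (𝒰 : Filter _)) (T := fun T => 1 - T) (fun Ω Ω' => ?_)
    (Filter.mem_of_superset h fun a ha => sub_nonneg.2 ha.2.2)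
  simp only [amp_sub, sub_apply, inner_sub_right]
  exact tendsto_const_nhds.sub (h1 Ω Ω')

/-- A continuous approximation of the indicator function of `(0, ∞)`. -/
def ramp (ε s : ℝ) : ℝ := min 1 (max 0 (s / ε))

theorem continuous_ramp (ε : ℝ) : Continuous (ramp ε) := by unfold ramp; fun_prop

theorem ramp_nonneg (ε s : ℝ) : 0 ≤ ramp ε s := by simp [ramp]

theorem ramp_le_one (ε s : ℝ) : ramp ε s ≤ 1 := by simp [ramp]

theorem ramp_mul_nonneg {ε : ℝ} (hε : 0 < ε) (s : ℝ) : 0 ≤ ramp ε s * s := by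
  rcases le_total 0 s with h | h
  · exact mul_nonneg (ramp_nonneg _ _) h
  · have : ramp ε s = 0 := by
      rw [ramp, max_eq_left (div_nonpos_of_nonpos_of_nonneg h hε.le)]; simp
    simp [this]

theorem sub_ramp_mul_le {ε : ℝ} (hε : 0 < ε) (s : ℝ) : s - ramp ε s * s ≤ ε := by
  rcases le_total s ε with h | h
  · linarith [ramp_mul_nonneg hε s]
  · have : ramp ε s = 1 := by
      rw [ramp, max_eq_right (div_nonneg (hε.le.trans h) hε.le), min_eq_left]
      rwa [one_le_div hε]
    rw [this]; linarith

theorem cfc_ramp_mem {x : G →L[ℂ] G} (hx : x ∈ S) (ε : ℝ) : cfc (ramp ε) x ∈ unitInt S :=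
  ⟨cfc_mem hx _, cfc_nonneg fun s _ => ramp_nonneg ε s, cfc_le_one _ _ fun s _ => ramp_le_one ε s⟩

theorem cfc_ramp_mul_self {x : G →L[ℂ] G} (hx : IsSelfAdjoint x) (ε : ℝ) :
    cfc (ramp ε) x * x = cfc (fun s => ramp ε s * s) x := by
  have h := cfc_mul (ramp ε) (fun s => s) x (continuous_ramp ε).continuousOn continuousOn_id
  rw [cfc_id' ℝ x] at h
  exact h.symm

theorem smul_one_coe (c : ℝ) :
    (((c : ℂ) • (1 : S) : S) : G →L[ℂ] G) = algebraMap ℝ (G →L[ℂ] G) c := by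
  rw [Algebra.algebraMap_eq_smul_one, ← Complex.coe_smul]
  rfl

theorem cfc_ramp_estimate {σ : S →ₗ[ℂ] ℂ} (hσ : ∀ x : S, 0 ≤ σ (star x * x))
    {x : S} (hx : IsSelfAdjoint (x : G →L[ℂ] G)) {ε : ℝ} (hε : 0 < ε) :
    ∃ y : S, (y : G →L[ℂ] G) = cfc (ramp ε) (x : G →L[ℂ] G) * x ∧ 0 ≤ (y : G →L[ℂ] G) ∧
      (σ x).re ≤ (σ y).re + ε * (σ 1).re := by
  refine ⟨⟨_, mul_mem (cfc_ramp_mem x.2 ε).1 x.2⟩, rfl, ?_, ?_⟩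
  · change 0 ≤ cfc (ramp ε) (x : G →L[ℂ] G) * x
    rw [cfc_ramp_mul_self hx]
    exact cfc_nonneg fun s _ => ramp_mul_nonneg hε s
  · set y : S := ⟨_, mul_mem (cfc_ramp_mem x.2 ε).1 x.2⟩ with hy
    have h1 : ((x - y : S) : G →L[ℂ] G) ≤ (((ε : ℂ) • (1 : S) : S) : G →L[ℂ] G) := by
      rw [smul_one_coe]
      change (x : G →L[ℂ] G) - cfc (ramp ε) (x : G →L[ℂ] G) * x ≤ _
      rw [cfc_ramp_mul_self hx]
      nth_rewrite 1 [← cfc_id' ℝ (x : G →L[ℂ] G)]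
      rw [← cfc_sub (fun s => s) (fun s => ramp ε s * s) (x : G →L[ℂ] G) continuousOn_id
        ((continuous_ramp ε).mul continuous_id).continuousOn]
      exact cfc_le_algebraMap _ _ _ (fun s _ => sub_ramp_mul_le hε s)
        (hf := (continuous_id.sub ((continuous_ramp ε).mul continuous_id)).continuousOn)
    have h2 := (Complex.le_def.1 (map_mono_of_state hσ h1)).1
    rw [map_sub, map_smul, Complex.sub_re, smul_eq_mul, Complex.re_ofReal_mul] at h2
    linarith

theorem exists_radonNikodym {τ σ : S →ₗ[ℂ] ℂ} (hτ : IsStateOn S τ) (hτn : IsNormalOn S τ)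
    (hτt : IsTracialOn S τ) (hσ : ∀ x : S, 0 ≤ σ (star x * x))
    (hle : ∀ x : S, 0 ≤ (x : G →L[ℂ] G) → σ x ≤ τ x) :
    ∃ h : S, (h : G →L[ℂ] G) ∈ unitInt S ∧ ∀ x : S, σ x = τ (h * x) := by
  obtain ⟨Ω, hΩ⟩ := isNormalOn_iff.1 hτn
  let J : Set S := {x | IsSelfAdjoint (x : G →L[ℂ] G)}
  let f : S → (G →L[ℂ] G) → ℝ := fun x h => (wv Ω (h * x)).re - (σ x).re
  have hlin : ∀ x : S, ∀ a b : ℝ, ∀ h h' : G →L[ℂ] G, (wv Ω ((a • h + b • h') * x)).re =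
      a * (wv Ω (h * x)).re + b * (wv Ω (h' * x)).re := fun x a b h h' => by
    rw [add_mul, smul_mul_assoc, smul_mul_assoc, map_add, ← Complex.coe_smul a,
      ← Complex.coe_smul b, map_smul, map_smul]
    simp
  have hlin' : ∀ h : G →L[ℂ] G, ∀ a b : ℝ, ∀ x y : S, f (a • x + b • y) h =
      a * f x h + b * f y h := fun h a b x y => by
    have h1 : ((a • x + b • y : S) : G →L[ℂ] G) = (a : ℂ) • x + (b : ℂ) • y := rfl
    have h2 : (a • x + b • y : S) = (a : ℂ) • x + (b : ℂ) • y := rfl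
    simp only [f]
    rw [h1, mul_add, mul_smul_comm, mul_smul_comm, map_add, map_smul, map_smul, h2, map_add,
      map_smul, map_smul]
    simp
    ring
  have hJ : Convex ℝ J := fun x hx y hy a b _ _ _ =>
    ((IsSelfAdjoint.all a).smul hx).add ((IsSelfAdjoint.all b).smul hy)
  obtain ⟨h, hh, hJh⟩ := minimax (J := J) (B := unitInt S) (f := f) (fun x hx => by
      refine ⟨convex_unitInt, fun h _ h' _ a b _ _ hab => le_of_eq ?_⟩
      simp only [f, hlin, smul_eq_mul]
      linear_combination -(σ x).re * hab) (fun h _ => by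
      refine ⟨hJ, fun x _ y _ a b _ _ hab => le_of_eq ?_⟩
      simp only [hlin', smul_eq_mul]) hJ ⟨0, zero_mem_unitInt⟩ (fun 𝒰 h𝒰 => by
      obtain ⟨T', hT', hlim⟩ := unitInt_compact 𝒰 h𝒰
      refine ⟨T', hT', fun x _ c hc => ge_of_tendsto (?_ : Tendsto (f x) 𝒰 _) hc⟩
      have h1 := hlim Ω (amp (x : G →L[ℂ] G) Ω)
      simp only [← amp_mul_apply] at h1
      exact ((Complex.continuous_re.tendsto _).comp h1).sub_const _) (fun x hx δ hδ => by
      have h1 : 0 ≤ (σ 1).re := (Complex.nonneg_iff.1 (map_nonneg_of_state hσ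
        (x := 1) (by rw [coe_one_vn]; exact zero_le_one))).1
      obtain ⟨y, hy1, hy2, hy3⟩ := cfc_ramp_estimate hσ hx (ε := δ / ((σ 1).re + 1))
        (by positivity)
      refine ⟨cfc (ramp (δ / ((σ 1).re + 1))) (x : G →L[ℂ] G), cfc_ramp_mem x.2 _, ?_⟩
      have h2 := (Complex.le_def.1 (hle y hy2)).1
      simp only [f]
      rw [← hy1, ← hΩ]
      have h3 : δ / ((σ 1).re + 1) * (σ 1).re < δ := by
        rw [div_mul_eq_mul_div, div_lt_iff₀ (by positivity)]
        nlinarith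
      linarith)
  refine ⟨⟨h, hh.1⟩, hh, fun x => ?_⟩
  have key : σ = τ ∘ₗ LinearMap.mulLeft ℂ (⟨h, hh.1⟩ : S) := by
    refine linearMap_ext_of_nonneg fun x hx => ?_
    have hxs : IsSelfAdjoint (x : G →L[ℂ] G) := IsSelfAdjoint.of_nonneg hx
    have h1 := hJh x hxs
    have h2 := hJh (-x) hxs.neg
    have h3 : τ (⟨h, hh.1⟩ * x) = wv Ω (h * x) := hΩ _
    have h4 : f (-x) h = -f x h := by
      have := hlin' h (-1) 0 x 0
      simpa using this
    have h5 : (σ x).re = (τ (⟨h, hh.1⟩ * x)).re := by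
      rw [h3]
      simp only [f] at h1
      have : (wv Ω (h * x)).re - (σ x).re = f x h := rfl
      linarith
    obtain ⟨y, hy0, hy1, hy2⟩ := exists_sqrt hx
    have h6 : 0 ≤ τ (⟨h, hh.1⟩ * x) := by
      rw [← hy2, ← mul_assoc, hτt, ← mul_assoc]
      refine map_nonneg_of_state hτ.2 ?_
      have := conjugate_nonneg_of_nonneg hh.2.1 hy0
      exact this
    have h7 := map_nonneg_of_state hσ hx
    change σ x = τ (⟨h, hh.1⟩ * x)
    exact Complex.ext h5 (by rw [← (Complex.nonneg_iff.1 h6).2, ← (Complex.nonneg_iff.1 h7).2])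
  exact DFunLike.congr_fun key x

end RadonNikodym

/-! ### Approximating a hyperstate by normal functionals -/

section Approximation

variable {H : Type} [NormedAddCommGroup H] [InnerProductSpace ℂ H] [CompleteSpace H]
  {K : Type} [NormedAddCommGroup K] [InnerProductSpace ℂ K] [CompleteSpace K]
  {M : VonNeumannAlgebra H} {A : VonNeumannAlgebra K} {τ : M →ₗ[ℂ] ℂ}

/-- The inclusion `M ⊆ 𝒜` as a map into bounded operators. -/
def Inclusion.hom (inc : Inclusion M A) : M →ₗ[ℂ] (K →L[ℂ] K) where
  toFun x := inc.π x
  map_add' x y := by rw [map_add]; rfl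
  map_smul' c x := by rw [map_smul]; rfl

namespace Inclusion

theorem coe_π (inc : Inclusion M A) (x : M) : (inc.π x : K →L[ℂ] K) = inc.hom x := rfl

theorem hom_mem (inc : Inclusion M A) (x : M) : inc.hom x ∈ A := (inc.π x).2

theorem hom_mul (inc : Inclusion M A) (x y : M) : inc.hom (x * y) = inc.hom x * inc.hom y :=
  congrArg Subtype.val (inc.map_mul x y)

theorem hom_one (inc : Inclusion M A) : inc.hom 1 = 1 := congrArg Subtype.val inc.map_one

theorem hom_star (inc : Inclusion M A) (x : M) : inc.hom (star x) = star (inc.hom x) :=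
  congrArg Subtype.val (inc.map_star x)

theorem hom_nonneg (inc : Inclusion M A) {x : M} (hx : 0 ≤ (x : H →L[ℂ] H)) : 0 ≤ inc.hom x :=
  inc.map_nonneg hx

theorem hom_mono (inc : Inclusion M A) {x y : M} (h : (x : H →L[ℂ] H) ≤ (y : H →L[ℂ] H)) :
    inc.hom x ≤ inc.hom y := by
  have h1 : 0 ≤ ((y - x : M) : H →L[ℂ] H) := sub_nonneg.2 h
  have := inc.hom_nonneg h1
  rw [map_sub] at this
  exact sub_nonneg.1 this

end Inclusion

/-- The elements `0 ≤ a ≤ 1` of a von Neumann algebra, as a subset of the algebra. -/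
def unitInt' (M : VonNeumannAlgebra H) : Set M := {a | (a : H →L[ℂ] H) ∈ unitInt M}

theorem convex_unitInt' : Convex ℝ (unitInt' M) := fun _ hx _ hy _ _ ha hb hab =>
  convex_unitInt hx hy ha hb hab

theorem zero_mem_unitInt' : (0 : M) ∈ unitInt' M := zero_mem_unitInt

theorem unitInt'_compact (𝒰 : Ultrafilter M) (h : unitInt' M ∈ 𝒰) :
    ∃ a ∈ unitInt' M, ∀ Ω : Amp H,
      Tendsto (fun x : M => wv Ω (x : H →L[ℂ] H)) 𝒰 (𝓝 (wv Ω (a : H →L[ℂ] H))) := by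
  obtain ⟨T, hT, hlim⟩ := unitInt_compact (S := M) (𝒰.map Subtype.val) h
  exact ⟨⟨T, hT.1⟩, hT, fun Ω => (hlim Ω Ω).comp tendsto_map⟩

theorem sub_mem_unitInt' {a : M} (ha : a ∈ unitInt' M) : 1 - a ∈ unitInt' M :=
  ⟨(1 - a).2, sub_nonneg.2 ha.2.2, by
    change (1 : H →L[ℂ] H) - a ≤ 1
    exact sub_le_self _ ha.2.1⟩

theorem exists_approx {ψ : A →ₗ[ℂ] ℂ} (hτn : IsNormalOn M τ)
    {inc : Inclusion M A} (hψ : IsHyperstate τ inc ψ) {Y : A}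
    (hY : 0 ≤ (Y : K →L[ℂ] K)) {ε R : ℝ} (hε : 0 < ε) :
    ∃ Ω : Amp K, ‖Ω‖ = 1 ∧ ∀ a ∈ unitInt' M,
      (ψ Y).re - ε ≤ (wv Ω (Y : K →L[ℂ] K)).re - R * ((wv Ω (inc.hom a)).re - (τ a).re) := by
  by_contra! hcon
  let J : Set ((K →L[ℂ] K) →ₗ[ℂ] ℂ) := Set.range wv
  let f : ((K →L[ℂ] K) →ₗ[ℂ] ℂ) → M → ℝ := fun j a =>
    R * ((j (inc.hom a)).re - (τ a).re * (j 1).re) - (j Y).re + ((ψ Y).re - ε) * (j 1).re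
  have hJ : Convex ℝ J := by
    rintro _ ⟨Ω₁, rfl⟩ _ ⟨Ω₂, rfl⟩ a b ha hb -
    obtain ⟨Ω₁', h1⟩ := exists_wv_smul Ω₁ ha
    obtain ⟨Ω₂', h2⟩ := exists_wv_smul Ω₂ hb
    obtain ⟨Ω, h3⟩ := exists_wv_add Ω₁' Ω₂'
    refine ⟨Ω, LinearMap.ext fun T => ?_⟩
    rw [h3, h1, h2]
    simp
  have hcoe : ∀ (c d : ℝ) (a b : M), c • a + d • b = (c : ℂ) • a + (d : ℂ) • b :=
    fun _ _ _ _ => rfl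
  obtain ⟨a, ha, haJ⟩ := minimax (J := J) (B := unitInt' M) (f := f) (fun j _ => by
      refine ⟨convex_unitInt', fun a _ b _ c d _ _ hcd => le_of_eq ?_⟩
      simp only [f, hcoe, map_add, map_smul, smul_eq_mul, Complex.add_re, Complex.re_ofReal_mul]
      linear_combination (- (j Y).re + ((ψ Y).re - ε) * (j 1).re) * hcd) (fun a _ => by
      refine ⟨hJ, fun j _ k _ c d _ _ hcd => le_of_eq ?_⟩
      simp only [f, LinearMap.add_apply, LinearMap.smul_apply, smul_eq_mul, Complex.add_re,
        Complex.real_smul, Complex.re_ofReal_mul]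
      ring) hJ ⟨0, zero_mem_unitInt'⟩ (fun 𝒰 h𝒰 => by
      obtain ⟨a, ha, hlim⟩ := unitInt'_compact 𝒰 h𝒰
      refine ⟨a, ha, ?_⟩
      rintro _ ⟨Ω, rfl⟩ c hc
      refine ge_of_tendsto (?_ : Tendsto (f (wv Ω)) 𝒰 _) hc
      obtain ⟨Ω', hΩ'⟩ := inc.exists_wv Ω
      obtain ⟨Ωτ, hΩτ⟩ := isNormalOn_iff.1 hτn
      have h1 := (Complex.continuous_re.tendsto _).comp (hlim Ω')
      have h2 := (Complex.continuous_re.tendsto _).comp (hlim Ωτ)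
      simp only [Function.comp_def, ← hΩ', ← hΩτ, inc.coe_π] at h1 h2
      exact ((((h1.sub (h2.mul_const _)).const_mul R).sub_const _).add_const _)) (by
      rintro _ ⟨Ω, rfl⟩ δ hδ
      by_cases h0 : Ω = 0
      · subst h0
        exact ⟨0, zero_mem_unitInt', by simpa [f, wv_apply] using hδ⟩
      have hn : 0 < ‖Ω‖ := norm_pos_iff.2 h0
      obtain ⟨a, ha, h1⟩ := hcon (((‖Ω‖⁻¹ : ℝ) : ℂ) • Ω) (by rw [norm_smul]; simp [hn.ne'])
      refine ⟨a, ha, ?_⟩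
      rw [wv_smul, wv_smul, Complex.norm_real, Complex.re_ofReal_mul, Complex.re_ofReal_mul,
        Real.norm_of_nonneg (by positivity)] at h1
      have h2 : (wv Ω 1).re = ‖Ω‖ ^ 2 := by rw [wv_one, Complex.ofReal_re]
      simp only [f, h2]
      have h3 : 0 < ‖Ω‖ ^ 2 := by positivity
      have h4 := mul_lt_mul_of_pos_left h1 h3
      have h5 : ‖Ω‖ ^ 2 * (‖Ω‖⁻¹) ^ 2 = 1 := by rw [← mul_pow, mul_inv_cancel₀ hn.ne', one_pow]
      have h6 : ‖Ω‖ ^ 2 * (‖Ω‖⁻¹ ^ 2 * (wv Ω (Y : K →L[ℂ] K)).re -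
          R * (‖Ω‖⁻¹ ^ 2 * (wv Ω (inc.hom a)).re - (τ a).re)) =
          (wv Ω (Y : K →L[ℂ] K)).re - R * ((wv Ω (inc.hom a)).re - (τ a).re * ‖Ω‖ ^ 2) := by
        linear_combination ((wv Ω (Y : K →L[ℂ] K)).re - R * (wv Ω (inc.hom a)).re) * h5
      rw [h6] at h4
      linarith)
  let c : ℝ := -(R * (τ a).re) + (ψ Y).re - ε
  let X : A := (R : ℂ) • inc.π a - Y + (c : ℂ) • (1 : A)
  have hXc : (X : K →L[ℂ] K) = (R : ℂ) • inc.hom a - Y + (c : ℂ) • 1 := rfl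
  have hYs : IsSelfAdjoint (Y : K →L[ℂ] K) := IsSelfAdjoint.of_nonneg hY
  have has : IsSelfAdjoint (inc.hom a) := IsSelfAdjoint.of_nonneg (inc.hom_nonneg ha.2.1)
  have hXs : IsSelfAdjoint (X : K →L[ℂ] K) := by
    rw [hXc, Complex.coe_smul, Complex.coe_smul]
    exact (((IsSelfAdjoint.all R).smul has).sub hYs).add
      ((IsSelfAdjoint.all c).smul (IsSelfAdjoint.one _))
  have hX : 0 ≤ (X : K →L[ℂ] K) := by
    refine nonneg_of_inner_eq (q := fun ξ => (⟪ξ, (X : K →L[ℂ] K) ξ⟫_ℂ).re)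
      (fun ξ => inner_clm_eq_re hXs ξ) fun ξ => ?_
    obtain ⟨Ω, hΩ⟩ := exists_wv_vector ξ
    rw [← hΩ, hXc]
    have h1 := haJ _ ⟨Ω, rfl⟩
    simp only [f] at h1
    simp only [map_add, map_sub, map_smul, smul_eq_mul, Complex.add_re, Complex.sub_re,
      Complex.re_ofReal_mul, c]
    linarith
  have h1 := (Complex.nonneg_iff.1 (map_nonneg_of_state hψ.1.2 hX)).1
  simp only [X, map_add, map_sub, map_smul, hψ.2, hψ.1.1, smul_eq_mul, Complex.add_re,
    Complex.sub_re, Complex.re_ofReal_mul, Complex.one_re, c] at h1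
  linarith

theorem exists_almost_hyperstate {ψ : A →ₗ[ℂ] ℂ} (hτn : IsNormalOn M τ)
    {inc : Inclusion M A} (hψ : IsHyperstate τ inc ψ) {Y : A}
    (hY : 0 ≤ (Y : K →L[ℂ] K)) {ε : ℝ} (hε : 0 < ε) :
    ∃ Ω : Amp K, ‖Ω‖ = 1 ∧ (ψ Y).re - ε ≤ (wv Ω (Y : K →L[ℂ] K)).re ∧
      ∀ a ∈ unitInt' M, (wv Ω (inc.hom a)).re ≤ (τ a).re + ε := by
  have hR : 0 < (‖(Y : K →L[ℂ] K)‖ + ε) / ε := by positivity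
  obtain ⟨Ω, h1, h2⟩ := exists_approx (R := (‖(Y : K →L[ℂ] K)‖ + ε) / ε) hτn hψ hY hε
  refine ⟨Ω, h1, by simpa using h2 0 zero_mem_unitInt', fun a ha => ?_⟩
  have h3 := h2 a ha
  have h4 := (Complex.nonneg_iff.1 (map_nonneg_of_state hψ.1.2 hY)).1
  have h5 : (wv Ω (Y : K →L[ℂ] K)).re ≤ ‖(Y : K →L[ℂ] K)‖ := by
    refine (Complex.re_le_norm _).trans ((norm_wv_le _ _).trans ?_)
    rw [h1]; simp
  have h6 : (‖(Y : K →L[ℂ] K)‖ + ε) / ε * ((wv Ω (inc.hom a)).re - (τ a).re) ≤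
      ‖(Y : K →L[ℂ] K)‖ + ε := by linarith
  have h7 : ‖(Y : K →L[ℂ] K)‖ + ε = (‖(Y : K →L[ℂ] K)‖ + ε) / ε * ε := by field_simp
  rw [h7] at h6
  nth_rewrite 1 [← h7] at h6
  have := le_of_mul_le_mul_left h6 hR
  linarith

end Approximation

/-! ### Cutting a normal functional down to one dominated by the trace -/

section Cut

variable {H : Type} [NormedAddCommGroup H] [InnerProductSpace ℂ H] [CompleteSpace H]
  {K : Type} [NormedAddCommGroup K] [InnerProductSpace ℂ K] [CompleteSpace K]
  {M : VonNeumannAlgebra H} {A : VonNeumannAlgebra K} {τ : M →ₗ[ℂ] ℂ}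

theorem le_of_re_le {z w : ℂ} (hz : 0 ≤ z) (hw : 0 ≤ w) (h : z.re ≤ w.re) : z ≤ w :=
  Complex.le_def.2 ⟨h, by rw [← (Complex.nonneg_iff.1 hz).2, ← (Complex.nonneg_iff.1 hw).2]⟩

theorem exists_eq_smul_unitInt' {x : M} (hx : 0 ≤ (x : H →L[ℂ] H)) :
    ∃ c : ℝ, 0 < c ∧ ∃ x' ∈ unitInt' M, x = (c : ℂ) • x' := by
  have hc : 0 < ‖(x : H →L[ℂ] H)‖ + 1 := by positivity
  refine ⟨_, hc, (((‖(x : H →L[ℂ] H)‖ + 1)⁻¹ : ℝ) : ℂ) • x, ⟨Subtype.property _, ?_, ?_⟩, ?_⟩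
  · change (0 : H →L[ℂ] H) ≤ (((‖(x : H →L[ℂ] H)‖ + 1)⁻¹ : ℝ) : ℂ) • (x : H →L[ℂ] H)
    rw [Complex.coe_smul]
    exact smul_nonneg (by positivity) hx
  · change (((‖(x : H →L[ℂ] H)‖ + 1)⁻¹ : ℝ) : ℂ) • (x : H →L[ℂ] H) ≤ 1
    rw [Complex.coe_smul]
    have h0 : 0 ≤ (‖(x : H →L[ℂ] H)‖ + 1)⁻¹ • (x : H →L[ℂ] H) := smul_nonneg (by positivity) hx
    refine (CStarAlgebra.norm_le_one_iff_of_nonneg _ h0).1 ?_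
    rw [norm_smul, Real.norm_of_nonneg (by positivity), inv_mul_le_iff₀ hc]
    linarith
  · rw [smul_smul, ← Complex.ofReal_mul, mul_inv_cancel₀ hc.ne', Complex.ofReal_one, one_smul]

theorem coe_mul_mul_nonneg {x : M} (hx : 0 ≤ (x : H →L[ℂ] H)) (s : M) :
    0 ≤ ((star s * x * s : M) : H →L[ℂ] H) :=
  star_left_conjugate_nonneg hx _

theorem coe_mul_mul_mono {x y : M} (h : (x : H →L[ℂ] H) ≤ (y : H →L[ℂ] H)) (s : M) :
    ((star s * x * s : M) : H →L[ℂ] H) ≤ ((star s * y * s : M) : H →L[ℂ] H) :=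
  star_left_conjugate_le_conjugate h _

theorem trace_mul_eq (hτt : IsTracialOn M τ) {x : M} (hx : 0 ≤ (x : H →L[ℂ] H)) :
    ∃ s : M, s * s = x ∧ star s = s ∧ ∀ h : M, τ (h * x) = τ (star s * h * s) := by
  obtain ⟨s, -, h1, h2⟩ := exists_sqrt hx
  refine ⟨s, h2, h1, fun h => ?_⟩
  rw [h1, ← h2, ← mul_assoc, hτt (h * s) s, mul_assoc]

theorem trace_mul_nonneg (hτ : IsStateOn M τ) (hτt : IsTracialOn M τ) {h x : M}
    (hh : 0 ≤ (h : H →L[ℂ] H)) (hx : 0 ≤ (x : H →L[ℂ] H)) : 0 ≤ τ (h * x) := by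
  obtain ⟨s, -, -, h2⟩ := trace_mul_eq hτt hx
  rw [h2]
  exact map_nonneg_of_state hτ.2 (coe_mul_mul_nonneg hh s)

theorem trace_mul_le (hτ : IsStateOn M τ) (hτt : IsTracialOn M τ) {h x : M}
    (hh : h ∈ unitInt' M) (hx : 0 ≤ (x : H →L[ℂ] H)) : τ (h * x) ≤ τ x := by
  have := trace_mul_nonneg hτ hτt (sub_mem_unitInt' hh).2.1 hx
  rwa [sub_mul, one_mul, map_sub, sub_nonneg] at this

theorem mem_unitInt'_of_sq {y : M} (h0 : 0 ≤ (y : H →L[ℂ] H)) (h : y * y ∈ unitInt' M) :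
    y ∈ unitInt' M := by
  refine ⟨y.2, h0, (CStarAlgebra.norm_le_one_iff_of_nonneg _ h0).1 ?_⟩
  have h1 : ‖(y : H →L[ℂ] H) * y‖ ≤ 1 := (CStarAlgebra.norm_le_one_iff_of_nonneg _ h.2.1).2 h.2.2
  have h2 : star (y : H →L[ℂ] H) = y := (IsSelfAdjoint.of_nonneg h0).star_eq
  nth_rewrite 1 [← h2] at h1
  rw [CStarRing.norm_star_mul_self] at h1
  nlinarith [norm_nonneg (y : H →L[ℂ] H)]

/-- `y² ≤ y` for `0 ≤ y ≤ 1`. -/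
theorem sq_le_self {y : M} (h : y ∈ unitInt' M) : ((y * y : M) : H →L[ℂ] H) ≤ y := by
  obtain ⟨s, -, h1, h2⟩ := exists_sqrt h.2.1
  have h3 := coe_mul_mul_mono (show (y : H →L[ℂ] H) ≤ ((1 : M) : H →L[ℂ] H) from h.2.2) s
  have h4 : star s * y * s = y * y := by rw [h1, ← h2]; simp only [mul_assoc]
  have h5 : star s * 1 * s = y := by rw [h1, mul_one, h2]
  rwa [h4, h5] at h3

theorem exists_cut (hτ : IsStateOn M τ) (hτn : IsNormalOn M τ) (hτt : IsTracialOn M τ)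
    (inc : Inclusion M A) (Ω : Amp K) {C : ℝ} (hC : 0 ≤ C) :
    ∃ a ∈ unitInt' M, ∃ y ∈ unitInt' M, y * y = 1 - a ∧
      (∀ x : M, 0 ≤ (x : H →L[ℂ] H) →
        wv (amp (inc.hom y) Ω) (inc.hom x) ≤ (C : ℂ) * τ x) ∧
      C * (τ a).re ≤ (wv Ω (inc.hom a)).re := by
  let g : M → ℝ := fun a => (wv Ω (inc.hom a)).re - C * (τ a).re
  have hcoe : ∀ (c d : ℝ) (a b : M), c • a + d • b = (c : ℂ) • a + (d : ℂ) • b :=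
    fun _ _ _ _ => rfl
  have hg : ∀ (c d : ℝ) (a b : M), g (c • a + d • b) = c * g a + d * g b := fun c d a b => by
    simp only [g, hcoe, map_add, map_smul, smul_eq_mul, Complex.add_re, Complex.re_ofReal_mul]
    ring
  obtain ⟨a, ha, hmax⟩ := minimax (J := unitInt' M) (B := unitInt' M) (f := fun b a => g a - g b)
    (fun b _ => ⟨convex_unitInt', fun x _ y _ c d _ _ hcd => le_of_eq (by
      simp only [hg, smul_eq_mul]; linear_combination (- g b) * hcd)⟩)
    (fun b _ => ⟨convex_unitInt', fun x _ y _ c d _ _ hcd => le_of_eq (by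
      simp only [hg, smul_eq_mul]; linear_combination (- g b) * hcd)⟩)
    convex_unitInt' ⟨0, zero_mem_unitInt'⟩ (fun 𝒰 h𝒰 => by
      obtain ⟨a, ha, hlim⟩ := unitInt'_compact 𝒰 h𝒰
      refine ⟨a, ha, fun b _ c hc => ?_⟩
      refine ge_of_tendsto (?_ : Tendsto (fun a => g a - g b) 𝒰 _) hc
      obtain ⟨Ω', hΩ'⟩ := inc.exists_wv Ω
      obtain ⟨Ωτ, hΩτ⟩ := isNormalOn_iff.1 hτn
      have h1 := (Complex.continuous_re.tendsto _).comp (hlim Ω')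
      have h2 := (Complex.continuous_re.tendsto _).comp (hlim Ωτ)
      simp only [Function.comp_def, ← hΩ', ← hΩτ, inc.coe_π] at h1 h2
      exact (h1.sub (h2.const_mul C)).sub_const _)
    (fun b hb δ hδ => ⟨b, hb, by simpa using hδ⟩)
  simp only [sub_nonneg] at hmax
  have ha' := sub_mem_unitInt' ha
  obtain ⟨y, hy0, hys, hyy⟩ := exists_sqrt ha'.2.1
  have hy : y ∈ unitInt' M := mem_unitInt'_of_sq hy0 (hyy ▸ ha')
  refine ⟨a, ha, y, hy, hyy, ?_, ?_⟩
  · have key : ∀ x ∈ unitInt' M, (wv (amp (inc.hom y) Ω) (inc.hom x)).re ≤ C * (τ x).re := by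
      intro x hx
      have h1 : a + star y * x * y ∈ unitInt' M := by
        refine ⟨Subtype.property _, add_nonneg ha.2.1 (coe_mul_mul_nonneg hx.2.1 y), ?_⟩
        have h2 := coe_mul_mul_mono
          (show (x : H →L[ℂ] H) ≤ ((1 : M) : H →L[ℂ] H) from hx.2.2) y
        rw [mul_one, hys, hyy] at h2
        rw [hys]
        calc (a : H →L[ℂ] H) + ((y * x * y : M) : H →L[ℂ] H)
            ≤ (a : H →L[ℂ] H) + ((1 - a : M) : H →L[ℂ] H) := add_le_add_right h2 _
          _ = 1 := add_sub_cancel _ _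
      have h2 := hmax _ h1
      simp only [g, map_add, Complex.add_re] at h2
      rw [wv_amp, ← inc.hom_star, ← inc.hom_mul, ← inc.hom_mul]
      have h3 : τ (star y * x * y) = τ ((1 - a) * x) := by
        rw [hys, hτt, ← mul_assoc, hyy]
      have h4 := (Complex.le_def.1 (trace_mul_le hτ hτt ha' hx.2.1)).1
      rw [← h3] at h4
      nlinarith
    intro x hx
    obtain ⟨c, hc, x', hx', rfl⟩ := exists_eq_smul_unitInt' hx
    refine le_of_re_le (wv_nonneg _ (inc.hom_nonneg hx))
      (mul_nonneg (by exact_mod_cast hC) (map_nonneg_of_state hτ.2 hx)) ?_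
    simp only [map_smul, smul_eq_mul, Complex.re_ofReal_mul]
    nlinarith [key x' hx']
  · have := hmax 0 zero_mem_unitInt'
    simp only [g, map_zero, Complex.zero_re, mul_zero, sub_zero] at this
    linarith

theorem norm_sub_cut_le (inc : Inclusion M A) (Ω : Amp K) {a y : M} (hy : y ∈ unitInt' M)
    (hyy : y * y = 1 - a) :
    ‖amp (inc.hom y) Ω - Ω‖ ^ 2 ≤ (wv Ω (inc.hom a)).re := by
  have h1 : amp (inc.hom y) Ω - Ω = amp (inc.hom (y - 1)) Ω := by
    rw [map_sub, inc.hom_one, amp_sub, amp_one]; rfl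
  have hys : star y = y := Subtype.ext (IsSelfAdjoint.of_nonneg hy.2.1).star_eq
  have h2 : ((‖amp (inc.hom (y - 1)) Ω‖ ^ 2 : ℝ) : ℂ) = wv Ω (inc.hom (1 - y - y + y * y)) := by
    rw [← wv_star_mul_self, ← inc.hom_star, ← inc.hom_mul]
    congr 2
    rw [star_sub, star_one, hys]
    noncomm_ring
  have h3 : ((1 - y - y + y * y : M) : H →L[ℂ] H) ≤ a := by
    have h4 : (a : H →L[ℂ] H) = ((1 - y * y : M) : H →L[ℂ] H) := by rw [hyy]; simp
    have h5 := sq_le_self hy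
    have h6 : ((1 - y * y : M) : H →L[ℂ] H) - ((1 - y - y + y * y : M) : H →L[ℂ] H) =
        ((y : H →L[ℂ] H) - ((y * y : M) : H →L[ℂ] H)) +
          ((y : H →L[ℂ] H) - ((y * y : M) : H →L[ℂ] H)) := by
      change ((1 : H →L[ℂ] H) - (y : H →L[ℂ] H) * y) - (1 - y - y + (y : H →L[ℂ] H) * y) =
        (y - (y : H →L[ℂ] H) * y) + (y - (y : H →L[ℂ] H) * y)
      abel
    rw [h4, ← sub_nonneg, h6]
    exact add_nonneg (sub_nonneg.2 h5) (sub_nonneg.2 h5)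
  have h4 := (Complex.le_def.1 (wv_mono Ω (inc.hom_mono h3))).1
  rwa [← h2, Complex.ofReal_re, ← h1] at h4

theorem abs_wv_sub_le (Ω v : Amp K) (Y : K →L[ℂ] K) :
    |(wv Ω Y).re - (wv v Y).re| ≤ ‖Y‖ * ‖Ω - v‖ * (‖Ω‖ + ‖v‖) := by
  have h1 : wv Ω Y - wv v Y = ⟪Ω, amp Y (Ω - v)⟫_ℂ + ⟪Ω - v, amp Y v⟫_ℂ := by
    rw [wv_apply, wv_apply, map_sub, inner_sub_right, inner_sub_left]; ring
  have h2 : ∀ w : Amp K, ‖amp Y w‖ ≤ ‖Y‖ * ‖w‖ := fun w =>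
    ((amp Y).le_opNorm w).trans (mul_le_mul_of_nonneg_right (norm_amp_le Y) (norm_nonneg _))
  rw [← Complex.sub_re, h1]
  refine (Complex.abs_re_le_norm _).trans ((norm_add_le _ _).trans ?_)
  have h3 := (norm_inner_le_norm (𝕜 := ℂ) Ω (amp Y (Ω - v))).trans
    (mul_le_mul_of_nonneg_left (h2 (Ω - v)) (norm_nonneg Ω))
  have h4 := (norm_inner_le_norm (𝕜 := ℂ) (Ω - v) (amp Y v)).trans
    (mul_le_mul_of_nonneg_left (h2 v) (norm_nonneg _))
  linarith

/-- The functional on `M` induced by `Ω` is dominated by the trace. -/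
def DomTau (τ : M →ₗ[ℂ] ℂ) (inc : Inclusion M A) (Ω : Amp K) : Prop :=
  ∀ x : M, 0 ≤ (x : H →L[ℂ] H) → wv Ω (inc.hom x) ≤ τ x

end Cut

/-! ### Completing a functional dominated by the trace to a hyperstate -/

section Completion

variable {H : Type} [NormedAddCommGroup H] [InnerProductSpace ℂ H] [CompleteSpace H]
  {K : Type} [NormedAddCommGroup K] [InnerProductSpace ℂ K] [CompleteSpace K]
  {M : VonNeumannAlgebra H} {A : VonNeumannAlgebra K} {τ : M →ₗ[ℂ] ℂ}

theorem norm_eq_re_of_nonneg {z : ℂ} (h : 0 ≤ z) : ‖z‖ = z.re := by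
  have := congrArg Complex.re (Complex.norm_of_nonneg' h)
  rwa [Complex.ofReal_re] at this

theorem exists_domTau (hτ : IsStateOn M τ) (hτn : IsNormalOn M τ) (hτt : IsTracialOn M τ)
    {inc : Inclusion M A} {ψ : A →ₗ[ℂ] ℂ} (hψ : IsHyperstate τ inc ψ) {Y : A}
    (hY : 0 ≤ (Y : K →L[ℂ] K)) {ε : ℝ} (hε : 0 < ε) :
    ∃ Ω : Amp K, DomTau τ inc Ω ∧ (ψ Y).re - ε ≤ (wv Ω (Y : K →L[ℂ] K)).re := by
  let N : ℝ := ‖(Y : K →L[ℂ] K)‖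
  let G : ℝ → ℝ := fun t => t ^ 2 + N * √(t + t ^ 2) * (2 + √(t + t ^ 2)) +
    t * (N * (1 + √(t + t ^ 2)) ^ 2)
  have hG : Continuous G := by fun_prop
  have hG0 : G 0 = 0 := by simp [G]
  have h0 : ∀ᶠ t in 𝓝[>] (0 : ℝ), G t < ε :=
    nhdsWithin_le_nhds ((hG.tendsto 0).eventually_lt_const (by rwa [hG0]))
  obtain ⟨t, hGt, ht : 0 < t⟩ := (h0.and self_mem_nhdsWithin).exists
  obtain ⟨Ω, hΩ1, hΩY, hΩ⟩ := exists_almost_hyperstate hτn hψ hY (pow_pos ht 2)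
  obtain ⟨a, ha, y, hy, hyy, hdom, hCa⟩ := exists_cut hτ hτn hτt inc Ω (C := 1 + t) (by positivity)
  have h1 := hΩ a ha
  have h2 : (τ a).re ≤ t := by nlinarith
  have h3 : ‖amp (inc.hom y) Ω - Ω‖ ≤ √(t + t ^ 2) := Real.le_sqrt_of_sq_le
    ((norm_sub_cut_le inc Ω hy hyy).trans (by linarith))
  set v := amp (inc.hom y) Ω with hv
  set δ := √(t + t ^ 2) with hδ
  have hδ0 : 0 ≤ δ := Real.sqrt_nonneg _
  have h4 : ‖v‖ ≤ 1 + δ := by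
    have := norm_add_le Ω (v - Ω)
    rw [add_sub_cancel, hΩ1] at this
    linarith
  have h5 : (wv Ω (Y : K →L[ℂ] K)).re - (wv v (Y : K →L[ℂ] K)).re ≤ N * δ * (2 + δ) := by
    refine (le_abs_self _).trans ((abs_wv_sub_le Ω v _).trans ?_)
    rw [norm_sub_rev, hΩ1]
    have : 0 ≤ N := norm_nonneg _
    have h7 : 1 + ‖v‖ ≤ 2 + δ := by linarith
    change N * ‖v - Ω‖ * (1 + ‖v‖) ≤ _
    gcongr
  have h6 : (wv v (Y : K →L[ℂ] K)).re ≤ N * (1 + δ) ^ 2 := by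
    refine (Complex.re_le_norm _).trans ((norm_wv_le _ _).trans ?_)
    change N * ‖v‖ ^ 2 ≤ _
    have : 0 ≤ N := norm_nonneg _
    gcongr
  obtain ⟨Ω', hΩ'⟩ := exists_wv_smul v (c := (1 + t)⁻¹) (by positivity)
  refine ⟨Ω', fun x hx => ?_, ?_⟩
  · rw [hΩ']
    have h7 := mul_le_mul_of_nonneg_left (hdom x hx)
      (show (0 : ℂ) ≤ (((1 + t)⁻¹ : ℝ) : ℂ) by exact_mod_cast (by positivity : 0 ≤ (1 + t)⁻¹))
    refine h7.trans (le_of_eq ?_)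
    rw [← mul_assoc, ← Complex.ofReal_mul, inv_mul_cancel₀ (by positivity), Complex.ofReal_one,
      one_mul]
  · rw [hΩ', Complex.re_ofReal_mul]
    have h7 : (1 : ℝ) - t ≤ (1 + t)⁻¹ := by
      rw [← one_div, le_div_iff₀ (by positivity)]
      nlinarith
    have h8 := (Complex.nonneg_iff.1 (wv_nonneg v hY)).1
    have h9 : t * (wv v (Y : K →L[ℂ] K)).re ≤ t * (N * (1 + δ) ^ 2) :=
      mul_le_mul_of_nonneg_left h6 ht.le
    have h10 : G t = t ^ 2 + N * δ * (2 + δ) + t * (N * (1 + δ) ^ 2) := rfl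
    nlinarith [mul_le_mul_of_nonneg_right h7 h8]

theorem wv_hom_star_mul_self_nonneg (inc : Inclusion M A) (Ω : Amp K) (x : M) :
    0 ≤ ((wv Ω).comp inc.hom) (star x * x) := by
  rw [LinearMap.comp_apply, inc.hom_mul, inc.hom_star, wv_star_mul_self]
  exact Complex.zero_le_real.2 (sq_nonneg _)

theorem exists_completion_step (hτ : IsStateOn M τ) (hτn : IsNormalOn M τ)
    (hτt : IsTracialOn M τ) {inc : Inclusion M A} {ψ : A →ₗ[ℂ] ℂ} (hψ : IsHyperstate τ inc ψ)
    {h : M} (hh : h ∈ unitInt' M) {δ : ℝ} (hδ : 0 < δ) :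
    ∃ θ : Amp K, ∃ h' ∈ unitInt' M, (∀ x, τ (h * x) = wv θ (inc.hom x) + τ (h' * x)) ∧
      (τ h').re ≤ δ := by
  obtain ⟨Ω, hΩ, hΩ1⟩ := exists_domTau hτ hτn hτt hψ (Y := 1)
    (by rw [coe_one_vn]; exact zero_le_one) hδ
  obtain ⟨k, hk, hkτ⟩ := exists_radonNikodym hτ hτn hτt
    (σ := (wv Ω).comp inc.hom) (wv_hom_star_mul_self_nonneg inc Ω) hΩ
  simp only [LinearMap.comp_apply] at hkτ
  have hk' : k ∈ unitInt' M := hk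
  obtain ⟨s, hs0, hs, hss⟩ := exists_sqrt hh.2.1
  refine ⟨amp (inc.hom s) Ω, star s * (1 - k) * s, ⟨Subtype.property _,
    coe_mul_mul_nonneg (sub_mem_unitInt' hk').2.1 s, ?_⟩, fun x => ?_, ?_⟩
  · have h1 := coe_mul_mul_mono (show ((1 - k : M) : H →L[ℂ] H) ≤ ((1 : M) : H →L[ℂ] H) from
      (sub_mem_unitInt' hk').2.2) s
    rw [mul_one, hs, hss] at h1
    rw [hs]
    exact h1.trans hh.2.2
  · rw [wv_amp, ← inc.hom_star, ← inc.hom_mul, ← inc.hom_mul, hkτ, hs,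
      show k * (s * x * s) = (k * (s * x)) * s by simp only [mul_assoc], hτt (k * (s * x)) s,
      ← map_add]
    congr 1
    rw [← hss]
    noncomm_ring
  · have h1 : τ (star s * (1 - k) * s) = τ ((1 - k) * h) := by
      rw [hs, hτt, ← mul_assoc, hss, hτt]
    have h2 : τ ((1 - k) * h) ≤ τ (1 - k) := by
      rw [hτt]
      exact trace_mul_le hτ hτt hh (sub_mem_unitInt' hk').2.1
    have h3 : τ (1 - k) = 1 - wv Ω 1 := by
      rw [map_sub, hτ.1, ← inc.hom_one, hkτ, mul_one]
    rw [h1]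
    refine (Complex.le_def.1 h2).1.trans ?_
    rw [h3, Complex.sub_re, Complex.one_re]
    rw [hψ.1.1, coe_one_vn, Complex.one_re] at hΩ1
    linarith

theorem exists_completion (hτ : IsStateOn M τ) (hτn : IsNormalOn M τ)
    (hτt : IsTracialOn M τ) {inc : Inclusion M A} {ψ : A →ₗ[ℂ] ℂ} (hψ : IsHyperstate τ inc ψ)
    {Ω : Amp K} (hΩ : DomTau τ inc Ω) :
    ∃ Ω' : Amp K, (∀ x, wv Ω' (inc.hom x) = τ x) ∧ ∀ X : K →L[ℂ] K, 0 ≤ X →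
      wv Ω X ≤ wv Ω' X := by
  obtain ⟨k, hk, hkτ⟩ := exists_radonNikodym hτ hτn hτt
    (σ := (wv Ω).comp inc.hom) (wv_hom_star_mul_self_nonneg inc Ω) hΩ
  simp only [LinearMap.comp_apply] at hkτ
  have hk' : k ∈ unitInt' M := hk
  choose θ h' hh' hrec hsmall using fun (h : unitInt' M) (n : ℕ) =>
    exists_completion_step hτ hτn hτt hψ h.2 (δ := (1 / 2 : ℝ) ^ n) (by positivity)
  let u : ℕ → unitInt' M := fun n =>
    Nat.rec ⟨1 - k, sub_mem_unitInt' hk'⟩ (fun n h => ⟨h' h n, hh' h n⟩) n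
  have hu : ∀ n x, τ ((u n).1 * x) = wv (θ (u n) n) (inc.hom x) + τ ((u (n + 1)).1 * x) :=
    fun n x => hrec (u n) n x
  have hsum : ∀ n x, ∑ j ∈ Finset.range n, wv (θ (u j) j) (inc.hom x) =
      τ ((1 - k) * x) - τ ((u n).1 * x) := fun n x => by
    induction n with
    | zero => simp [u]
    | succ n ih => rw [Finset.sum_range_succ, ih, hu n x]; ring
  have htr : ∀ n, 0 ≤ τ (u n).1 := fun n => map_nonneg_of_state hτ.2 (u n).2.2.1
  have hlim : Tendsto (fun n => (τ (u n).1).re) atTop (𝓝 0) := by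
    rw [← tendsto_add_atTop_iff_nat 1]
    exact squeeze_zero (fun n => (Complex.nonneg_iff.1 (htr (n + 1))).1) (fun n => hsmall (u n) n)
      (tendsto_pow_atTop_nhds_zero_of_lt_one (by norm_num) (by norm_num))
  have hlim' : ∀ x : M, 0 ≤ (x : H →L[ℂ] H) →
      Tendsto (fun n => τ ((u n).1 * x)) atTop (𝓝 0) := fun x hx => by
    obtain ⟨c, hc, x', hx', rfl⟩ := exists_eq_smul_unitInt' hx
    refine squeeze_zero_norm (a := fun n => c * (τ (u n).1).re) (fun n => ?_)
      (by simpa using hlim.const_mul c)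
    rw [mul_smul_comm, map_smul, norm_smul, Complex.norm_real, Real.norm_of_nonneg hc.le]
    refine mul_le_mul_of_nonneg_left ?_ hc.le
    have h1 := trace_mul_nonneg hτ hτt (u n).2.2.1 hx'.2.1
    have h2 : τ ((u n).1 * x') ≤ τ (u n).1 := by
      rw [hτt]
      exact trace_mul_le hτ hτt hx' (u n).2.2.1
    rw [norm_eq_re_of_nonneg h1]
    exact (Complex.le_def.1 h2).1
  have hsm : Summable fun j => ‖θ (u j) j‖ ^ 2 := by
    refine summable_of_sum_range_le (c := (τ (1 - k)).re) (fun _ => sq_nonneg _) fun n => ?_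
    have h1 := congrArg Complex.re (hsum n 1)
    simp only [inc.hom_one, wv_one, mul_one, ← Complex.ofReal_sum, Complex.ofReal_re,
      Complex.sub_re] at h1
    rw [h1]
    linarith [(Complex.nonneg_iff.1 (htr n)).1]
  obtain ⟨Ω₁, hΩ₁⟩ := exists_wv_hasSum _ hsm
  obtain ⟨Ω₂, hΩ₂⟩ := exists_wv_add Ω Ω₁
  refine ⟨Ω₂, fun x => ?_, fun X hX => ?_⟩
  · have : (wv Ω₂).comp inc.hom = τ := by
      refine linearMap_ext_of_nonneg fun x hx => ?_
      have h1 := (hΩ₁ (inc.hom x)).tendsto_sum_nat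
      simp only [hsum] at h1
      have h2 := tendsto_nhds_unique h1 ((hlim' x hx).const_sub _)
      rw [LinearMap.comp_apply, hΩ₂, h2, hkτ, sub_zero, ← map_add]
      congr 1
      noncomm_ring
    exact LinearMap.congr_fun this x
  · rw [hΩ₂]
    exact le_add_of_nonneg_right (wv_nonneg _ hX)

end Completion

/-! ### Faithful normal hyperstates -/

section Faithful

variable {H : Type} [NormedAddCommGroup H] [InnerProductSpace ℂ H] [CompleteSpace H]
  {K : Type} [NormedAddCommGroup K] [InnerProductSpace ℂ K] [CompleteSpace K]
  {M : VonNeumannAlgebra H} {A : VonNeumannAlgebra K} {τ : M →ₗ[ℂ] ℂ}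

/-- The functional on `𝒜` induced by `Ω` restricts to `τ`. -/
def HypVec (τ : M →ₗ[ℂ] ℂ) (inc : Inclusion M A) (Ω : Amp K) : Prop :=
  ∀ x : M, wv Ω (inc.hom x) = τ x

/-- The vector `Ω` is separating for `𝒜`. -/
def SepVec (A : VonNeumannAlgebra K) (Ω : Amp K) : Prop := ∀ X ∈ A, amp X Ω = 0 → X = 0

theorem exists_separating (K : Type) [NormedAddCommGroup K] [InnerProductSpace ℂ K]
    [CompleteSpace K] [TopologicalSpace.SeparableSpace K] :
    ∃ Ω : Amp K, ∀ X : K →L[ℂ] K, amp X Ω = 0 → X = 0 := by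
  let d := TopologicalSpace.denseSeq K
  let c : ℕ → ℝ := fun k => (1 / 2 : ℝ) ^ k / (1 + ‖d k‖)
  have hc : ∀ k, 0 < c k := fun k => by positivity
  obtain ⟨Ω, hΩ⟩ := exists_amp_of_summable (ξ := fun k => (c k : ℂ) • d k) (by
    refine Summable.of_nonneg_of_le (fun _ => sq_nonneg _) (fun k => ?_)
      (summable_geometric_of_lt_one (r := 1 / 2) (by norm_num) (by norm_num))
    have h1 : ‖(c k : ℂ) • d k‖ ≤ (1 / 2 : ℝ) ^ k := by
      rw [norm_smul, Complex.norm_real, Real.norm_of_nonneg (hc k).le, div_mul_eq_mul_div,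
        div_le_iff₀ (by positivity)]
      have : (0 : ℝ) < (1 / 2) ^ k := by positivity
      nlinarith
    have h2 : (1 / 2 : ℝ) ^ k ≤ 1 := pow_le_one₀ (by norm_num) (by norm_num)
    nlinarith [norm_nonneg ((c k : ℂ) • d k)])
  refine ⟨Ω, fun X hX => ?_⟩
  have h1 : ∀ k, X (d k) = 0 := fun k => by
    have := congrArg (fun v : Amp K => v k) hX
    simp only [amp_apply, hΩ, map_smul] at this
    exact (smul_eq_zero.1 this).resolve_left (by exact_mod_cast (hc k).ne')
  exact ContinuousLinearMap.coeFn_injective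
    ((TopologicalSpace.denseRange_denseSeq K).equalizer X.continuous continuous_const
      (funext h1))

theorem amp_eq_zero_iff (Ω : Amp K) (X : K →L[ℂ] K) : amp X Ω = 0 ↔ wv Ω (star X * X) = 0 := by
  rw [wv_star_mul_self]
  simp

theorem eq_zero_of_mul_hom_eq (hτn : IsNormalOn M τ) (hτf : IsFaithfulOn M τ)
    {inc : Inclusion M A} {a : ℕ → M} (ha : ∀ n, a n ∈ unitInt' M)
    (hτa : Tendsto (fun n => τ (a n)) atTop (𝓝 0)) {X : K →L[ℂ] K}
    (h5 : ∀ n, X = X * inc.hom (a n)) : X = 0 := by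
  obtain ⟨b, hb, hlim⟩ := unitInt'_compact ((hyperfilter ℕ : Ultrafilter ℕ).map a)
    (Filter.univ_mem' ha : ∀ᶠ n in (hyperfilter ℕ : Filter ℕ), a n ∈ unitInt' M)
  have hτb : τ b = 0 := by
    obtain ⟨Ωτ, hΩτ⟩ := isNormalOn_iff.1 hτn
    have h8 := (hlim Ωτ).comp tendsto_map
    simp only [Function.comp_def, ← hΩτ] at h8
    exact tendsto_nhds_unique h8 (hτa.mono_left (Nat.hyperfilter_le_atTop))
  have hb0 : b = 0 := by
    obtain ⟨s, -, hs, hss⟩ := exists_sqrt hb.2.1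
    have : s = 0 := hτf s (by rw [hs, hss, hτb])
    rw [← hss, this, zero_mul]
  ext ξ
  obtain ⟨v, hv⟩ := exists_wv_vector ξ
  obtain ⟨v', hv'⟩ := inc.exists_wv v
  have h8 := (hlim v').comp tendsto_map
  rw [← hv', hb0, inc.coe_π, map_zero, map_zero] at h8
  simp only [Function.comp_def, ← hv', inc.coe_π] at h8
  have h9 : Tendsto (fun n => ‖X‖ ^ 2 * (wv v (inc.hom (a n))).re)
      (hyperfilter ℕ : Filter ℕ) (𝓝 (‖X‖ ^ 2 * 0)) :=
    ((Complex.continuous_re.tendsto _).comp h8).const_mul _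
  have h10 : ∀ n, ‖X ξ‖ ^ 2 ≤ ‖X‖ ^ 2 * (wv v (inc.hom (a n))).re := fun n => by
    have h11 : ‖X ξ‖ ≤ ‖X‖ * ‖inc.hom (a n) ξ‖ := by
      conv_lhs => rw [h5 n]
      exact X.le_opNorm _
    have h12 := (Complex.le_def.1 (wv_mono v (inc.hom_mono (sq_le_self (ha n))))).1
    have h13 : star (a n) = a n :=
      Subtype.ext (IsSelfAdjoint.of_nonneg (ha n).2.1).star_eq
    have h14 : (wv v (inc.hom (a n * a n))).re = ‖inc.hom (a n) ξ‖ ^ 2 := by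
      nth_rewrite 1 [← h13]
      rw [hv, inc.hom_mul, inc.hom_star, ContinuousLinearMap.star_eq_adjoint,
        mul_apply_eq_comp, ContinuousLinearMap.adjoint_inner_right,
        inner_self_eq_norm_sq_to_K]
      norm_cast
    rw [h14] at h12
    calc ‖X ξ‖ ^ 2 ≤ (‖X‖ * ‖inc.hom (a n) ξ‖) ^ 2 := by gcongr
      _ ≤ _ := by rw [mul_pow]; gcongr
  have h11 := ge_of_tendsto' h9 h10
  rw [mul_zero] at h11
  have : ‖X ξ‖ = 0 := by nlinarith [norm_nonneg (X ξ)]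
  simpa using this

theorem exists_faithful_hypVec [TopologicalSpace.SeparableSpace K] (hτ : IsStateOn M τ)
    (hτn : IsNormalOn M τ) (hτt : IsTracialOn M τ) (hτf : IsFaithfulOn M τ)
    {inc : Inclusion M A} {ψ : A →ₗ[ℂ] ℂ} (hψ : IsHyperstate τ inc ψ) :
    ∃ Ω : Amp K, HypVec τ inc Ω ∧ SepVec A Ω := by
  obtain ⟨Ω, hΩ⟩ := exists_separating K
  choose a ha y hy hyy hdom hsmall using fun n : ℕ =>
    exists_cut hτ hτn hτt inc Ω (C := (n : ℝ) + 1) (by positivity)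
  choose θ hθ using fun n : ℕ => exists_wv_smul (amp (inc.hom (y n)) Ω)
    (c := (1 / 2 : ℝ) ^ (n + 1) / (n + 1)) (by positivity)
  have hθdom : ∀ n (x : M), 0 ≤ (x : H →L[ℂ] H) →
      wv (θ n) (inc.hom x) ≤ (((1 / 2 : ℝ) ^ (n + 1) : ℝ) : ℂ) * τ x := fun n x hx => by
    rw [hθ]
    refine (mul_le_mul_of_nonneg_left (hdom n x hx)
      (Complex.zero_le_real.2 (by positivity))).trans (le_of_eq ?_)
    rw [← mul_assoc, ← Complex.ofReal_mul]
    congr 2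
    field_simp
  have hgeo : HasSum (fun n : ℕ => (1 / 2 : ℝ) ^ (n + 1)) 1 := by
    simpa [pow_succ] using (hasSum_geometric_two).mul_right (1 / 2 : ℝ)
  have hsm : Summable fun n => ‖θ n‖ ^ 2 := by
    refine Summable.of_nonneg_of_le (fun _ => sq_nonneg _) (fun n => ?_) hgeo.summable
    have h1 := (Complex.le_def.1 (hθdom n 1 (by rw [coe_one_vn]; exact zero_le_one))).1
    rwa [inc.hom_one, wv_one, hτ.1, mul_one, Complex.ofReal_re, Complex.ofReal_re] at h1
  obtain ⟨Ω₁, hΩ₁⟩ := exists_wv_hasSum θ hsm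
  obtain ⟨Ω₂, h2, h3⟩ := exists_completion hτ hτn hτt hψ (Ω := Ω₁) fun x hx => by
    have h1 : HasSum (fun n : ℕ => (((1 / 2 : ℝ) ^ (n + 1) : ℝ) : ℂ) * τ x) (τ x) := by
      simpa only [Function.comp_def, one_mul, Complex.ofReal_one] using
        (Complex.hasSum_ofReal.2 hgeo).mul_right (τ x)
    exact hasSum_le (fun n => hθdom n x hx) (hΩ₁ (inc.hom x)) h1
  refine ⟨Ω₂, h2, fun X hX hX0 => ?_⟩
  have hXX : 0 ≤ star X * X := star_mul_self_nonneg X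
  have h4 : ∀ n, X * inc.hom (y n) = 0 := fun n => by
    apply hΩ
    rw [amp_mul_apply, amp_eq_zero_iff]
    have h5 : wv (θ n) (star X * X) ≤ wv Ω₁ (star X * X) :=
      le_hasSum (hΩ₁ _) n fun j _ => wv_nonneg _ hXX
    have h6 := h5.trans (h3 _ hXX)
    rw [(amp_eq_zero_iff _ _).1 hX0] at h6
    have h7 := le_antisymm h6 (wv_nonneg _ hXX)
    rw [hθ] at h7
    exact (mul_eq_zero.1 h7).resolve_left
      (by exact_mod_cast (by positivity : (0 : ℝ) < (1 / 2) ^ (n + 1) / (n + 1)).ne')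
  have h5 : ∀ n, X = X * inc.hom (a n) := fun n => by
    have : X * inc.hom (y n * y n) = 0 := by rw [inc.hom_mul, ← mul_assoc, h4, zero_mul]
    rw [hyy, map_sub, inc.hom_one, mul_sub, mul_one, sub_eq_zero] at this
    exact this
  have hτa : Tendsto (fun n => τ (a n)) atTop (𝓝 0) := by
    have h8 : Tendsto (fun n : ℕ => ‖Ω‖ ^ 2 * (1 / ((n : ℝ) + 1))) atTop (𝓝 0) := by
      simpa using tendsto_one_div_add_atTop_nhds_zero_nat.const_mul (‖Ω‖ ^ 2)
    refine squeeze_zero_norm (fun n => ?_) h8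
    rw [norm_eq_re_of_nonneg (map_nonneg_of_state hτ.2 (ha n).2.1), mul_one_div,
      le_div_iff₀ (by positivity), mul_comm]
    refine (hsmall n).trans ?_
    have h9 := (Complex.le_def.1 (wv_mono Ω (inc.hom_mono
      (show (a n : H →L[ℂ] H) ≤ ((1 : M) : H →L[ℂ] H) from (ha n).2.2)))).1
    rwa [inc.hom_one, wv_one, Complex.ofReal_re] at h9
  exact eq_zero_of_mul_hom_eq hτn hτf ha hτa h5

end Faithful

/-! ### Quasi-invariant hyperstates -/

section Domination

variable {H : Type} [NormedAddCommGroup H] [InnerProductSpace ℂ H] [CompleteSpace H]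
  {K : Type} [NormedAddCommGroup K] [InnerProductSpace ℂ K] [CompleteSpace K]
  {M : VonNeumannAlgebra H} {A : VonNeumannAlgebra K} {τ : M →ₗ[ℂ] ℂ}

theorem hasSum_norm_amp_sq {z : ℕ → M} (hz : SumsToOne z) (v : Amp H) :
    HasSum (fun n => ‖amp (z n : H →L[ℂ] H) v‖ ^ 2) (‖v‖ ^ 2) := by
  let f : ℕ × ℕ → ℝ := fun p => ‖(z p.2 : H →L[ℂ] H) (v p.1)‖ ^ 2
  have h1 : ∀ k, HasSum (fun n => f (k, n)) (‖v k‖ ^ 2) := fun k => by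
    have := hz (v k)
    simp only [inner_self_eq_norm_sq_to_K] at this
    exact_mod_cast this
  have h2 : Summable f := (summable_prod_of_nonneg fun _ => sq_nonneg _).2
    ⟨fun k => (h1 k).summable, by
      rw [show (fun k => ∑' n, f (k, n)) = fun k => ‖v k‖ ^ 2 from
        funext fun k => (h1 k).tsum_eq]
      exact (hasSum_norm_sq v).summable⟩
  have h3 : ∑' p, f p = ‖v‖ ^ 2 :=
    (h2.hasSum.prod_fiberwise h1).unique (hasSum_norm_sq v)
  have h4 : HasSum (f ∘ (Equiv.prodComm ℕ ℕ)) (‖v‖ ^ 2) :=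
    (Equiv.hasSum_iff _).2 (h3 ▸ h2.hasSum)
  exact h4.prod_fiberwise fun n => hasSum_norm_sq (amp (z n : H →L[ℂ] H) v)

theorem hasSum_trace_conj (hτn : IsNormalOn M τ) (hτt : IsTracialOn M τ) {z : ℕ → M}
    (hz : SumsToOne z) {x : M} (hx : 0 ≤ (x : H →L[ℂ] H)) :
    HasSum (fun n => τ (z n * x * star (z n))) (τ x) := by
  obtain ⟨Ωτ, hΩτ⟩ := isNormalOn_iff.1 hτn
  obtain ⟨s, -, hs, hss⟩ := exists_sqrt hx
  have h1 : ∀ y : M, τ (star y * y) = ((‖amp (y : H →L[ℂ] H) Ωτ‖ ^ 2 : ℝ) : ℂ) := fun y =>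
    (hΩτ _).trans (wv_star_mul_self Ωτ (y : H →L[ℂ] H))
  have h2 : ∀ n, τ (z n * x * star (z n)) =
      ((‖amp (z n : H →L[ℂ] H) (amp (s : H →L[ℂ] H) Ωτ)‖ ^ 2 : ℝ) : ℂ) := fun n => by
    rw [← amp_mul_apply]
    refine Eq.trans ?_ (h1 (z n * s))
    rw [star_mul, ← mul_assoc, hτt, ← hss, hs]
    calc τ (star (z n) * (z n * (s * s))) = τ ((star (z n) * z n * s) * s) := by
          simp only [mul_assoc]
      _ = τ (s * star (z n) * z n * s) := by rw [hτt]; simp only [mul_assoc]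
      _ = _ := by simp only [mul_assoc]
  simp only [h2]
  have h3 : τ x = ((‖amp (s : H →L[ℂ] H) Ωτ‖ ^ 2 : ℝ) : ℂ) := by
    rw [← h1, hs, hss]
  rw [h3]
  exact Complex.hasSum_ofReal.2 (hasSum_norm_amp_sq hz _)

/-- The completely positive map `X ↦ ∑_{n < N} zₙ X zₙ*`. -/
def conjSum (inc : Inclusion M A) (z : ℕ → M) (N : ℕ) (X : K →L[ℂ] K) : K →L[ℂ] K :=
  ∑ n ∈ Finset.range N, inc.hom (z n) * X * inc.hom (star (z n))

theorem conjSum_nonneg (inc : Inclusion M A) (z : ℕ → M) (N : ℕ) {X : K →L[ℂ] K} (hX : 0 ≤ X) :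
    0 ≤ conjSum inc z N X :=
  Finset.sum_nonneg fun _ _ => by
    rw [inc.hom_star]
    exact star_right_conjugate_nonneg hX _

theorem wv_conj (inc : Inclusion M A) (Ω : Amp K) (x : M) (X : K →L[ℂ] K) :
    wv (amp (inc.hom (star x)) Ω) X = wv Ω (inc.hom x * X * inc.hom (star x)) := by
  rw [wv_amp, ← inc.hom_star, star_star]

theorem exists_push (hτ : IsStateOn M τ) (hτn : IsNormalOn M τ) (hτt : IsTracialOn M τ)
    {inc : Inclusion M A} {z : ℕ → M} (hz : SumsToOne z) {Ω : Amp K} (hΩ : HypVec τ inc Ω) :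
    ∃ Ω' : Amp K, HypVec τ inc Ω' ∧ ∀ N, ∀ X : K →L[ℂ] K, 0 ≤ X →
      (wv Ω (conjSum inc z N X)).re ≤ (wv Ω' X).re := by
  have h1 : ∀ n x, wv (amp (inc.hom (star (z n))) Ω) (inc.hom x) = τ (z n * x * star (z n)) :=
    fun n x => by rw [wv_conj, ← inc.hom_mul, ← inc.hom_mul, hΩ]
  have h2 := hasSum_trace_conj hτn hτt hz (x := 1) (by rw [coe_one_vn]; exact zero_le_one)
  simp only [← h1, inc.hom_one, wv_one, hτ.1] at h2
  have h0 : HasSum (fun n => ‖amp (inc.hom (star (z n))) Ω‖ ^ 2) 1 :=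
    Complex.hasSum_ofReal.1 (by rwa [Complex.ofReal_one])
  obtain ⟨Ω', hΩ'⟩ := exists_wv_hasSum _ h0.summable
  refine ⟨Ω', fun x => ?_, fun N X hX => ?_⟩
  · have : (wv Ω').comp inc.hom = τ := by
      refine linearMap_ext_of_nonneg fun x hx => ?_
      have h3 := hΩ' (inc.hom x)
      simp only [h1] at h3
      exact h3.unique (hasSum_trace_conj hτn hτt hz hx)
    exact LinearMap.congr_fun this x
  · have h3 : ∑ n ∈ Finset.range N, wv (amp (inc.hom (star (z n))) Ω) X ≤ wv Ω' X :=
      sum_le_hasSum _ (fun _ _ => wv_nonneg _ hX) (hΩ' X)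
    simp only [wv_conj] at h3
    rw [conjSum, map_sum]
    exact (Complex.le_def.1 h3).1

theorem exists_dominated (hτ : IsStateOn M τ) (hτn : IsNormalOn M τ) (hτt : IsTracialOn M τ)
    {inc : Inclusion M A} {z : ℕ → M} (hz : SumsToOne z) {Ω : Amp K} (hΩ : HypVec τ inc Ω) :
    ∃ Ω' : Amp K, HypVec τ inc Ω' ∧
      (∀ N, ∀ X : K →L[ℂ] K, 0 ≤ X → (wv Ω' (conjSum inc z N X)).re ≤ 2 * (wv Ω' X).re) ∧
      ∀ J N, ∀ X : K →L[ℂ] K, 0 ≤ X →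
        ∑ j ∈ Finset.range J, (1 / 2 : ℝ) ^ (j + 1) * (wv Ω ((conjSum inc z N)^[j] X)).re ≤
          (wv Ω' X).re := by
  choose p hp hpdom using fun v : {v : Amp K // HypVec τ inc v} =>
    exists_push hτ hτn hτt hz v.2
  let w : ℕ → {v : Amp K // HypVec τ inc v} := fun n =>
    Nat.rec ⟨Ω, hΩ⟩ (fun _ v => ⟨p v, hp v⟩) n
  have hw : ∀ j N (X : K →L[ℂ] K), 0 ≤ X →
      (wv (w j).1 (conjSum inc z N X)).re ≤ (wv (w (j + 1)).1 X).re :=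
    fun j N X hX => hpdom (w j) N X hX
  have hit : ∀ j N (X : K →L[ℂ] K), 0 ≤ X →
      (wv Ω ((conjSum inc z N)^[j] X)).re ≤ (wv (w j).1 X).re := fun j => by
    induction j with
    | zero => exact fun N X hX => le_rfl
    | succ j ih => exact fun N X hX => (ih N _ (conjSum_nonneg inc z N hX)).trans (hw j N X hX)
  have hgeo : HasSum (fun n : ℕ => (1 / 2 : ℝ) ^ (n + 1)) 1 := by
    simpa [pow_succ] using (hasSum_geometric_two).mul_right (1 / 2 : ℝ)
  choose θ hθ using fun j : ℕ => exists_wv_smul (w j).1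
    (c := (1 / 2 : ℝ) ^ (j + 1)) (by positivity)
  have hn : ∀ j, ‖θ j‖ ^ 2 = (1 / 2 : ℝ) ^ (j + 1) := fun j => by
    have := hθ j (inc.hom 1)
    rw [(w j).2, hτ.1, inc.hom_one, wv_one, mul_one] at this
    exact_mod_cast this
  obtain ⟨Ω', hΩ'⟩ := exists_wv_hasSum θ (by simp only [hn]; exact hgeo.summable)
  have hre : ∀ X, HasSum (fun j : ℕ => (1 / 2 : ℝ) ^ (j + 1) * (wv (w j).1 X).re) (wv Ω' X).re :=
    fun X => by
      have := Complex.reCLM.hasSum (hΩ' X)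
      simpa only [Function.comp_def, Complex.reCLM_apply, hθ, Complex.re_ofReal_mul] using this
  have hpos : ∀ j (X : K →L[ℂ] K), 0 ≤ X → 0 ≤ (wv (w j).1 X).re := fun j X hX =>
    (Complex.nonneg_iff.1 (wv_nonneg _ hX)).1
  refine ⟨Ω', fun x => ?_, fun N X hX => ?_, fun J N X hX => ?_⟩
  · have h3 := hΩ' (inc.hom x)
    simp only [hθ, (w _).2 x] at h3
    refine h3.unique ?_
    simpa only [Function.comp_def, one_mul, Complex.ofReal_one] using
      (Complex.hasSum_ofReal.2 hgeo).mul_right (τ x)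
  · have h1 := (hasSum_nat_add_iff' 1).2 (hre X)
    have h2 := hasSum_le (fun j => ?_) (hre (conjSum inc z N X)) (h1.mul_left 2)
    · rw [Finset.sum_range_one] at h2
      have := hpos 0 X hX
      have h3 : (0 : ℝ) ≤ (1 / 2) ^ (0 + 1) * (wv (w 0).1 X).re := by positivity
      linarith
    · have h3 := hw j N X hX
      have h4 : 2 * ((1 / 2 : ℝ) ^ (j + 1 + 1) * (wv (w (j + 1)).1 X).re) =
          (1 / 2 : ℝ) ^ (j + 1) * (wv (w (j + 1)).1 X).re := by ring
      rw [h4]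
      gcongr
  · refine le_trans (Finset.sum_le_sum fun j _ => ?_) (sum_le_hasSum (Finset.range J)
      (fun j _ => mul_nonneg (by positivity) (hpos j X hX)) (hre X))
    have := hit j N X hX
    gcongr

end Domination

section GoodVectors

variable {H : Type} [NormedAddCommGroup H] [InnerProductSpace ℂ H] [CompleteSpace H]
  {K : Type} [NormedAddCommGroup K] [InnerProductSpace ℂ K] [CompleteSpace K]
  {M : VonNeumannAlgebra H} {A : VonNeumannAlgebra K} {τ : M →ₗ[ℂ] ℂ}

/-- `Ω` implements a faithful normal hyperstate which is quasi-invariant under the maps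
`X ↦ ∑_{n < N} zₙ X zₙ*`, with constant `2`. -/
structure GoodVec (τ : M →ₗ[ℂ] ℂ) (inc : Inclusion M A) (z : ℕ → M) (Ω : Amp K) : Prop where
  hyp : HypVec τ inc Ω
  sep : SepVec A Ω
  dom : ∀ N, ∀ X : K →L[ℂ] K, 0 ≤ X → (wv Ω (conjSum inc z N X)).re ≤ 2 * (wv Ω X).re

theorem exists_wv_convex (Ω₁ Ω₂ : Amp K) {a b : ℝ} (ha : 0 ≤ a) (hb : 0 ≤ b) :
    ∃ Ω : Amp K, ∀ T, wv Ω T = a * wv Ω₁ T + b * wv Ω₂ T := by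
  obtain ⟨Ω₁', h1⟩ := exists_wv_smul Ω₁ ha
  obtain ⟨Ω₂', h2⟩ := exists_wv_smul Ω₂ hb
  obtain ⟨Ω, h3⟩ := exists_wv_add Ω₁' Ω₂'
  exact ⟨Ω, fun T => by rw [h3, h1, h2]⟩

theorem HypVec.convex {inc : Inclusion M A} {Ω₁ Ω₂ Ω : Amp K} {a b : ℝ} (hab : a + b = 1)
    (h : ∀ T, wv Ω T = a * wv Ω₁ T + b * wv Ω₂ T) (h1 : HypVec τ inc Ω₁)
    (h2 : HypVec τ inc Ω₂) : HypVec τ inc Ω := fun x => by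
  rw [h, h1, h2, ← add_mul, ← Complex.ofReal_add, hab, Complex.ofReal_one, one_mul]

theorem SepVec.of_le {Ω Ω' : Amp K} (h : SepVec A Ω) {c : ℝ} (hc : 0 < c)
    (hle : ∀ X : K →L[ℂ] K, 0 ≤ X → c * (wv Ω X).re ≤ (wv Ω' X).re) : SepVec A Ω' :=
  fun X hX h0 => h X hX <| by
    have h1 := hle _ (star_mul_self_nonneg X)
    rw [(amp_eq_zero_iff _ _).1 h0, wv_star_mul_self, Complex.ofReal_re, Complex.zero_re] at h1
    have h2 : ‖amp X Ω‖ ^ 2 ≤ 0 := nonpos_of_mul_nonpos_right h1 hc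
    exact norm_eq_zero.1 (by nlinarith [norm_nonneg (amp X Ω)])

theorem re_wv_nonneg (Ω : Amp K) {X : K →L[ℂ] K} (hX : 0 ≤ X) : 0 ≤ (wv Ω X).re :=
  (Complex.nonneg_iff.1 (wv_nonneg _ hX)).1

theorem GoodVec.convex {inc : Inclusion M A} {z : ℕ → M} {Ω₁ Ω₂ Ω : Amp K} {a b : ℝ}
    (ha : 0 ≤ a) (hb : 0 ≤ b) (hab : a + b = 1)
    (h : ∀ T, wv Ω T = a * wv Ω₁ T + b * wv Ω₂ T) (h1 : GoodVec τ inc z Ω₁)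
    (h2 : GoodVec τ inc z Ω₂) : GoodVec τ inc z Ω where
  hyp := HypVec.convex hab h h1.hyp h2.hyp
  sep := by
    have hre : ∀ X, (wv Ω X).re = a * (wv Ω₁ X).re + b * (wv Ω₂ X).re := fun X => by
      rw [h, Complex.add_re, Complex.re_ofReal_mul, Complex.re_ofReal_mul]
    rcases ha.eq_or_lt with rfl | ha
    · refine h2.sep.of_le one_pos fun X _ => ?_
      rw [hre, ← hab]; simp
    · refine h1.sep.of_le ha fun X hX => ?_
      rw [hre]
      have := mul_nonneg hb (re_wv_nonneg Ω₂ hX)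
      linarith
  dom N X hX := by
    rw [h, h, Complex.add_re, Complex.re_ofReal_mul, Complex.re_ofReal_mul, Complex.add_re,
      Complex.re_ofReal_mul, Complex.re_ofReal_mul]
    nlinarith [mul_le_mul_of_nonneg_left (h1.dom N X hX) ha,
      mul_le_mul_of_nonneg_left (h2.dom N X hX) hb]

theorem sum_star_mul_le_one {z : ℕ → M} (hz : SumsToOne z) (N : ℕ) :
    0 ≤ ((1 - ∑ n ∈ Finset.range N, star (z n) * z n : M) : H →L[ℂ] H) := by
  have hcoe : ((1 - ∑ n ∈ Finset.range N, star (z n) * z n : M) : H →L[ℂ] H) =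
      1 - ∑ n ∈ Finset.range N, star (z n : H →L[ℂ] H) * (z n : H →L[ℂ] H) := by
    change (1 : H →L[ℂ] H) - ((∑ n ∈ Finset.range N, star (z n) * z n : M) : H →L[ℂ] H) = _
    rw [AddSubmonoidClass.coe_finsetSum]
    rfl
  rw [hcoe]
  refine nonneg_of_inner_eq
    (q := fun v => ‖v‖ ^ 2 - ∑ n ∈ Finset.range N, ‖(z n : H →L[ℂ] H) v‖ ^ 2)
    (fun v => ?_) fun v => ?_
  · rw [sub_apply, sum_apply, inner_sub_right, inner_sum, one_apply_eq_self,
      inner_self_eq_norm_sq_to_K]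
    push_cast
    refine congrArg₂ _ rfl (Finset.sum_congr rfl fun n _ => ?_)
    change ⟪v, ContinuousLinearMap.adjoint (z n : H →L[ℂ] H) ((z n : H →L[ℂ] H) v)⟫_ℂ = _
    rw [ContinuousLinearMap.adjoint_inner_right, inner_self_eq_norm_sq_to_K]
    rfl
  · have h1 := hz v
    simp only [inner_self_eq_norm_sq_to_K] at h1
    have h2 : HasSum (fun n => ‖(z n : H →L[ℂ] H) v‖ ^ 2) (‖v‖ ^ 2) := by exact_mod_cast h1
    exact sub_nonneg.2 (sum_le_hasSum _ (fun _ _ => sq_nonneg _) h2)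

/-- The map `X ↦ ∑_{n < N} zₙ X zₙ*` on `𝒜`. -/
def conjSumA (inc : Inclusion M A) (z : ℕ → M) (N : ℕ) (X : A) : A :=
  ∑ n ∈ Finset.range N, inc.π (z n) * X * inc.π (star (z n))

theorem coe_conjSumA (inc : Inclusion M A) (z : ℕ → M) (N : ℕ) (X : A) :
    (conjSumA inc z N X : K →L[ℂ] K) = conjSum inc z N X := by
  rw [conjSumA, AddSubmonoidClass.coe_finsetSum]
  rfl

theorem conjSumA_mem_unitInt' {inc : Inclusion M A} {z : ℕ → M}
    (hz : SumsToOne fun n => star (z n)) (N : ℕ) {X : A} (hX : X ∈ unitInt' A) :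
    conjSumA inc z N X ∈ unitInt' A := by
  refine ⟨Subtype.property _, ?_, ?_⟩
  · rw [coe_conjSumA]
    exact conjSum_nonneg inc z N hX.2.1
  · have h1 := conjSum_nonneg inc z N (sub_nonneg.2 hX.2.2)
    have h2 : conjSum inc z N (1 - X) =
        inc.hom (∑ n ∈ Finset.range N, star (star (z n)) * star (z n)) - conjSum inc z N X := by
      simp only [conjSum, map_sum, mul_sub, sub_mul, Finset.sum_sub_distrib, star_star,
        inc.hom_mul, mul_one]
    have h3 := inc.hom_nonneg (sum_star_mul_le_one hz N)
    rw [map_sub, inc.hom_one] at h3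
    rw [h2] at h1
    rw [coe_conjSumA]
    exact (sub_nonneg.1 h1).trans (sub_nonneg.1 h3)

theorem hypertrace_conjSumA {inc : Inclusion M A} {ψ : A →ₗ[ℂ] ℂ} (hψ : IsHypertrace τ inc ψ)
    {z : ℕ → M} (hz : SumsToOne z) (N : ℕ) {X : A} (hX : X ∈ unitInt' A) :
    (ψ X).re - (τ (1 - ∑ n ∈ Finset.range N, star (z n) * z n)).re ≤
      (ψ (conjSumA inc z N X)).re := by
  obtain ⟨s, -, hs, hss⟩ := exists_sqrt (sum_star_mul_le_one hz N)
  have h1 : ψ (conjSumA inc z N X) =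
      ψ (X * inc.π (∑ n ∈ Finset.range N, star (z n) * z n)) := by
    rw [conjSumA, map_sum, map_sum, Finset.mul_sum, map_sum]
    refine Finset.sum_congr rfl fun n _ => ?_
    rw [mul_assoc, hψ.2, mul_assoc, inc.map_mul]
  have h2 : X * inc.π (∑ n ∈ Finset.range N, star (z n) * z n) =
      X - X * inc.π s * inc.π s := by
    rw [mul_assoc, ← inc.map_mul, hss, map_sub, inc.map_one, mul_sub, mul_one, sub_sub_cancel]
  have h3 : star (inc.π s) * X * inc.π s = inc.π s * (X * inc.π s) := by
    rw [← inc.map_star, hs, mul_assoc]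
  have h4 := coe_mul_mul_mono
    (show (X : K →L[ℂ] K) ≤ ((1 : A) : K →L[ℂ] K) from hX.2.2) (inc.π s)
  rw [h3, mul_one, ← inc.map_star, hs, ← inc.map_mul, hss] at h4
  have h5 := (Complex.le_def.1 (map_mono_of_state hψ.1.1.2 h4)).1
  rw [hψ.2, hψ.1.2] at h5
  rw [h1, h2, map_sub ψ, Complex.sub_re]
  linarith

theorem sum_half_pow (J : ℕ) :
    ∑ j ∈ Finset.range J, (1 / 2 : ℝ) ^ (j + 1) = 1 - (1 / 2 : ℝ) ^ J := by
  induction J with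
  | zero => simp
  | succ J ih => rw [Finset.sum_range_succ, ih]; ring

theorem exists_hypVec_near [TopologicalSpace.SeparableSpace K] (hM : IsII1Factor M τ)
    {inc : Inclusion M A} {ψ : A →ₗ[ℂ] ℂ} (hψ : IsHyperstate τ inc ψ) {Y : A}
    (hY : 0 ≤ (Y : K →L[ℂ] K)) {ε : ℝ} (hε : 0 < ε) :
    ∃ Ω : Amp K, HypVec τ inc Ω ∧ SepVec A Ω ∧ (ψ Y).re - ε ≤ (wv Ω (Y : K →L[ℂ] K)).re := by
  obtain ⟨Ω₀, h0, h0s⟩ :=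
    exists_faithful_hypVec hM.state hM.normal hM.tracial hM.faithful hψ
  obtain ⟨Ω₁, h1, h1Y⟩ := exists_domTau hM.state hM.normal hM.tracial hψ hY (half_pos hε)
  obtain ⟨Ω₂, h2, h2Y⟩ := exists_completion hM.state hM.normal hM.tracial hψ h1
  have h3 := h1Y.trans (Complex.le_def.1 (h2Y _ hY)).1
  have hn : ‖Ω₂‖ ^ 2 = 1 := by
    have := h2 1
    rw [inc.hom_one, wv_one, hM.state.1] at this
    exact_mod_cast this
  have h4 : (wv Ω₂ (Y : K →L[ℂ] K)).re ≤ ‖(Y : K →L[ℂ] K)‖ := by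
    have := (Complex.re_le_norm _).trans (norm_wv_le Ω₂ (Y : K →L[ℂ] K))
    rwa [hn, mul_one] at this
  have hY0 := norm_nonneg (Y : K →L[ℂ] K)
  set δ : ℝ := ε / 2 / (‖(Y : K →L[ℂ] K)‖ + ε / 2) with hδ
  have hδ0 : 0 < δ := by positivity
  have hδ1 : δ ≤ 1 := by rw [hδ, div_le_one (by positivity)]; linarith
  have hδY : δ * ‖(Y : K →L[ℂ] K)‖ ≤ ε / 2 := by
    rw [hδ, div_mul_eq_mul_div, div_le_iff₀ (by positivity)]
    nlinarith
  obtain ⟨Ω, hΩ⟩ := exists_wv_convex Ω₀ Ω₂ hδ0.le (sub_nonneg.2 hδ1)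
  have hre : ∀ X, (wv Ω X).re = δ * (wv Ω₀ X).re + (1 - δ) * (wv Ω₂ X).re := fun X => by
    rw [hΩ, Complex.add_re, Complex.re_ofReal_mul, Complex.re_ofReal_mul]
  refine ⟨Ω, HypVec.convex (by ring) hΩ h0 h2, h0s.of_le hδ0 fun X hX => ?_, ?_⟩
  · rw [hre]
    have := mul_nonneg (sub_nonneg.2 hδ1) (re_wv_nonneg Ω₂ hX)
    linarith
  · rw [hre]
    have := mul_nonneg hδ0.le (re_wv_nonneg Ω₀ hY)
    nlinarith [mul_le_mul_of_nonneg_left h4 hδ0.le]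

theorem tendsto_trace_sub {z : ℕ → M} (hM : IsII1Factor M τ) (hz : SumsToOne z) :
    Tendsto (fun N => (τ (1 - ∑ n ∈ Finset.range N, star (z n) * z n)).re) atTop (𝓝 0) := by
  have h1 := hasSum_trace_conj hM.normal hM.tracial hz (x := 1)
    (by rw [coe_one_vn]; exact zero_le_one)
  have h2 : ∀ n, τ (z n * 1 * star (z n)) = τ (star (z n) * z n) := fun n => by
    rw [mul_one, hM.tracial]
  simp only [h2, hM.state.1] at h1
  have h3 := ((Complex.continuous_re.tendsto _).comp h1.tendsto_sum_nat).const_sub 1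
  simpa only [Function.comp_def, map_sub, map_sum, Complex.sub_re, Complex.one_re, sub_self,
    hM.state.1] using h3

theorem exists_goodVec_near [TopologicalSpace.SeparableSpace K] (hM : IsII1Factor M τ)
    {inc : Inclusion M A} {ψ : A →ₗ[ℂ] ℂ} (hψ : IsHypertrace τ inc ψ) {z : ℕ → M}
    (hz : IsRegularSeq z) {X : A} (hX : 0 ≤ (X : K →L[ℂ] K)) {ε : ℝ} (hε : 0 < ε) :
    ∃ Ω : Amp K, GoodVec τ inc z Ω ∧ (ψ X).re - ε ≤ (wv Ω (X : K →L[ℂ] K)).re := by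
  suffices key : ∀ X ∈ unitInt' A, ∀ ε : ℝ, 0 < ε →
      ∃ Ω : Amp K, GoodVec τ inc z Ω ∧ (ψ X).re - ε ≤ (wv Ω (X : K →L[ℂ] K)).re by
    obtain ⟨c, hc, X', hX', rfl⟩ := exists_eq_smul_unitInt' hX
    obtain ⟨Ω, h1, h2⟩ := key X' hX' (ε / c) (by positivity)
    refine ⟨Ω, h1, ?_⟩
    change _ ≤ (wv Ω ((c : ℂ) • (X' : K →L[ℂ] K))).re
    rw [map_smul, map_smul, smul_eq_mul, smul_eq_mul, Complex.re_ofReal_mul,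
      Complex.re_ofReal_mul]
    have h3 := mul_le_mul_of_nonneg_left h2 hc.le
    rwa [mul_sub, mul_div_cancel₀ _ hc.ne'] at h3
  intro X hX ε hε
  obtain ⟨J, hJ⟩ := exists_pow_lt_of_lt_one (show 0 < ε / 3 by positivity)
    (show (1 / 2 : ℝ) < 1 by norm_num)
  obtain ⟨N, hN⟩ := (((tendsto_trace_sub hM hz.1).const_mul (J : ℝ)).eventually_lt_const
    (show (J : ℝ) * 0 < ε / 3 by rw [mul_zero]; positivity)).exists
  set d := (τ (1 - ∑ n ∈ Finset.range N, star (z n) * z n)).re with hd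
  have hd0 : 0 ≤ d :=
    (Complex.nonneg_iff.1 (map_nonneg_of_state hM.state.2 (sum_star_mul_le_one hz.1 N))).1
  let Φ := conjSumA inc z N
  have hmem : ∀ j, Φ^[j] X ∈ unitInt' A := fun j => by
    induction j with
    | zero => exact hX
    | succ j ih =>
      rw [Function.iterate_succ_apply']
      exact conjSumA_mem_unitInt' hz.2 N ih
  have hcoe : ∀ j, ((Φ^[j] X : A) : K →L[ℂ] K) = (conjSum inc z N)^[j] X := fun j => by
    induction j with
    | zero => rfl
    | succ j ih =>
      rw [Function.iterate_succ_apply', Function.iterate_succ_apply', ← ih]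
      exact coe_conjSumA _ _ _ _
  have hψj : ∀ j : ℕ, (ψ X).re - j * d ≤ (ψ (Φ^[j] X)).re := fun j => by
    induction j with
    | zero => simp
    | succ j ih =>
      rw [Function.iterate_succ_apply']
      have := hypertrace_conjSumA hψ hz.1 N (hmem j)
      push_cast
      linarith
  let Y : A := ∑ j ∈ Finset.range J, (((1 / 2 : ℝ) ^ (j + 1) : ℝ) : ℂ) • Φ^[j] X
  have hYc : (Y : K →L[ℂ] K) = ∑ j ∈ Finset.range J,
      (((1 / 2 : ℝ) ^ (j + 1) : ℝ) : ℂ) • (conjSum inc z N)^[j] X := by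
    rw [AddSubmonoidClass.coe_finsetSum]
    exact Finset.sum_congr rfl fun j _ => by rw [← hcoe]; rfl
  have hY : 0 ≤ (Y : K →L[ℂ] K) := by
    rw [hYc]
    refine Finset.sum_nonneg fun j _ => ?_
    rw [Complex.coe_smul, ← hcoe]
    exact smul_nonneg (by positivity) (hmem j).2.1
  have hψX : (ψ X).re ≤ 1 := by
    have := (Complex.le_def.1 (map_mono_of_state hψ.1.1.2
      (show (X : K →L[ℂ] K) ≤ ((1 : A) : K →L[ℂ] K) from hX.2.2))).1
    rwa [hψ.1.1.1, Complex.one_re] at this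
  have hψY : (ψ X).re - (1 / 2) ^ J - J * d ≤ (ψ Y).re := by
    have h1 : (ψ Y).re = ∑ j ∈ Finset.range J, (1 / 2 : ℝ) ^ (j + 1) * (ψ (Φ^[j] X)).re := by
      rw [map_sum, Complex.re_sum]
      exact Finset.sum_congr rfl fun j _ => by
        rw [map_smul, smul_eq_mul, Complex.re_ofReal_mul]
    have h2 : ∑ j ∈ Finset.range J, (1 / 2 : ℝ) ^ (j + 1) * ((ψ X).re - J * d) ≤ (ψ Y).re := by
      rw [h1]
      refine Finset.sum_le_sum fun j hj => mul_le_mul_of_nonneg_left ?_ (by positivity)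
      have h3 : (j : ℝ) ≤ J := by exact_mod_cast (Finset.mem_range.1 hj).le
      have := hψj j
      nlinarith
    rw [← Finset.sum_mul, sum_half_pow] at h2
    have h3 : (0 : ℝ) < (1 / 2) ^ J := by positivity
    have h4 : (0 : ℝ) ≤ J * d := by positivity
    nlinarith
  obtain ⟨Ω, h1, h2, h3⟩ := exists_hypVec_near hM hψ.1 hY (show 0 < ε / 3 by positivity)
  obtain ⟨Ω', h4, h5, h6⟩ := exists_dominated hM.state hM.normal hM.tracial hz.1 h1
  refine ⟨Ω', ⟨h4, h2.of_le (c := 1 / 2) (by norm_num) fun Z hZ => ?_, h5⟩, ?_⟩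
  · simpa using h6 1 N Z hZ
  · refine le_trans ?_ (h6 J N X hX.2.1)
    have h7 : (wv Ω (Y : K →L[ℂ] K)).re = ∑ j ∈ Finset.range J,
        (1 / 2 : ℝ) ^ (j + 1) * (wv Ω ((conjSum inc z N)^[j] X)).re := by
      rw [hYc, map_sum, Complex.re_sum]
      exact Finset.sum_congr rfl fun j _ => by
        rw [map_smul, smul_eq_mul, Complex.re_ofReal_mul]
    rw [← h7]
    linarith

end GoodVectors

section Defect

variable {K : Type} [NormedAddCommGroup K] [InnerProductSpace ℂ K] [CompleteSpace K]

/-- `(a - T)*(a - T) + T T*`. -/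
def defect (a T : K →L[ℂ] K) : K →L[ℂ] K := star (a - T) * (a - T) + T * star T

theorem wv_defect (Ω : Amp K) (a T : K →L[ℂ] K) :
    wv Ω (defect a T) = ((‖amp (a - T) Ω‖ ^ 2 + ‖amp (star T) Ω‖ ^ 2 : ℝ) : ℂ) := by
  have h1 := wv_star_mul_self Ω (star T)
  rw [star_star] at h1
  rw [defect, map_add, wv_star_mul_self, h1, Complex.ofReal_add]

theorem norm_sq_convex {E : Type*} [NormedAddCommGroup E] [InnerProductSpace ℂ E] (u v : E)
    {a b : ℝ} (ha : 0 ≤ a) (hb : 0 ≤ b) (hab : a + b = 1) :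
    ‖(a : ℂ) • u + (b : ℂ) • v‖ ^ 2 ≤ a * ‖u‖ ^ 2 + b * ‖v‖ ^ 2 := by
  have h1 : ‖(a : ℂ) • u + (b : ℂ) • v‖ ≤ a * ‖u‖ + b * ‖v‖ := by
    refine (norm_add_le _ _).trans_eq ?_
    rw [norm_smul, norm_smul, Complex.norm_real, Complex.norm_real, Real.norm_of_nonneg ha,
      Real.norm_of_nonneg hb]
  have h2 : b = 1 - a := by linarith
  subst h2
  nlinarith [norm_nonneg ((a : ℂ) • u + ((1 - a : ℝ) : ℂ) • v),
    mul_nonneg (mul_nonneg ha hb) (sq_nonneg (‖u‖ - ‖v‖))]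

theorem wv_defect_convex (Ω : Amp K) (a T S : K →L[ℂ] K) {c d : ℝ} (hc : 0 ≤ c) (hd : 0 ≤ d)
    (hcd : c + d = 1) : (wv Ω (defect a (c • T + d • S))).re ≤
      c * (wv Ω (defect a T)).re + d * (wv Ω (defect a S)).re := by
  simp only [wv_defect, Complex.ofReal_re]
  have h1 : a - (c • T + d • S) = (c : ℂ) • (a - T) + (d : ℂ) • (a - S) := by
    have : a = (c : ℂ) • a + (d : ℂ) • a := by
      rw [← add_smul, ← Complex.ofReal_add, hcd, Complex.ofReal_one, one_smul]
    nth_rewrite 1 [this]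
    rw [Complex.coe_smul, Complex.coe_smul, Complex.coe_smul, Complex.coe_smul, smul_sub, smul_sub]
    abel
  have h2 : star (c • T + d • S) = (c : ℂ) • star T + (d : ℂ) • star S := by
    rw [star_add, star_smul, star_smul, Complex.coe_smul, Complex.coe_smul]; simp
  rw [h1, h2]
  have e : ∀ X Y : K →L[ℂ] K, amp ((c : ℂ) • X + (d : ℂ) • Y) Ω =
      (c : ℂ) • amp X Ω + (d : ℂ) • amp Y Ω := fun X Y => by
    rw [amp_add, amp_smul, amp_smul]; rfl
  rw [e, e]
  have h3 := norm_sq_convex (amp (a - T) Ω) (amp (a - S) Ω) hc hd hcd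
  have h4 := norm_sq_convex (amp (star T) Ω) (amp (star S) Ω) hc hd hcd
  linarith

theorem tendsto_inner_defect {ι : Type*} {F : Filter ι} {T : ι → K →L[ℂ] K} {T' : K →L[ℂ] K}
    (h : ∀ Ω Ω' : Amp K, Tendsto (fun i => ⟪Ω, amp (T i) Ω'⟫_ℂ) F (𝓝 ⟪Ω, amp T' Ω'⟫_ℂ))
    (a : K →L[ℂ] K) (Ω Ω' : Amp K) :
    Tendsto (fun i => ⟪Ω, amp (a - T i) Ω'⟫_ℂ) F (𝓝 ⟪Ω, amp (a - T') Ω'⟫_ℂ) ∧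
      Tendsto (fun i => ⟪Ω, amp (star (T i)) Ω'⟫_ℂ) F (𝓝 ⟪Ω, amp (star T') Ω'⟫_ℂ) := by
  constructor
  · simp only [amp_sub, sub_apply, inner_sub_right]
    exact (h Ω Ω').const_sub _
  · simp only [inner_amp_star_right]
    have h1 := (Complex.continuous_conj.tendsto _).comp (h Ω' Ω)
    simpa only [Function.comp_def, inner_conj_symm] using h1

/-- Upper semicontinuity of the defect functional in the weak operator topology. -/
theorem le_sub_sum_wv_defect {ι : Type*} {F : Filter ι} [F.NeBot] {T : ι → ℕ → K →L[ℂ] K}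
    {T' : ℕ → K →L[ℂ] K}
    (h : ∀ n, ∀ Ω Ω' : Amp K, Tendsto (fun i => ⟪Ω, amp (T i n) Ω'⟫_ℂ) F (𝓝 ⟪Ω, amp (T' n) Ω'⟫_ℂ))
    (a : ℕ → K →L[ℂ] K) (Ω : Amp K) (N : ℕ) {c k : ℝ}
    (hc : ∀ᶠ i in F, c ≤ k - ∑ n ∈ Finset.range N, (wv Ω (defect (a n) (T i n))).re) :
    c ≤ k - ∑ n ∈ Finset.range N, (wv Ω (defect (a n) (T' n))).re := by
  let w : (ℕ → K →L[ℂ] K) → ℕ ⊕ ℕ → Amp K := fun S =>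
    Sum.elim (fun n => amp (a n - S n) Ω) (fun n => amp (star (S n)) Ω)
  have e : ∀ S : ℕ → K →L[ℂ] K, ∑ n ∈ Finset.range N, (wv Ω (defect (a n) (S n))).re =
      ∑ j ∈ (Finset.range N).disjSum (Finset.range N), ‖w S j‖ ^ 2 := fun S => by
    rw [Finset.sum_disjSum, ← Finset.sum_add_distrib]
    exact Finset.sum_congr rfl fun n _ => by rw [wv_defect, Complex.ofReal_re]; rfl
  simp only [e] at hc ⊢
  refine le_sub_sum_norm_sq_of_weak (u := fun j i => w (T i) j) _ (fun j _ => ?_) hc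
  rcases j with n | n
  · exact (tendsto_inner_defect (h n) (a n) _ Ω).1
  · exact (tendsto_inner_defect (h n) (a n) _ Ω).2

end Defect

section DefectBound

variable {H : Type} [NormedAddCommGroup H] [InnerProductSpace ℂ H] [CompleteSpace H]
  {K : Type} [NormedAddCommGroup K] [InnerProductSpace ℂ K] [CompleteSpace K]
  {M : VonNeumannAlgebra H} {A : VonNeumannAlgebra K} {τ : M →ₗ[ℂ] ℂ}

/-- The element `(x - T)*(x - T) + T T*` of `𝒜`. -/
def defectA (inc : Inclusion M A) (x : M) (T : A) : A :=
  star (inc.π x - T) * (inc.π x - T) + T * star T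

theorem star_smul_vn (c : ℂ) (S : A) : star (c • S) = star c • star S :=
  Subtype.ext (star_smul c (S : K →L[ℂ] K))

theorem map_star_of_state {σ : A →ₗ[ℂ] ℂ} (hσ : ∀ x : A, 0 ≤ σ (star x * x)) (x : A) :
    σ (star x) = (starRingEnd ℂ) (σ x) := by
  have h0 := (Complex.nonneg_iff.1 (hσ 1)).2
  have h1 := (Complex.nonneg_iff.1 (hσ x)).2
  have h2 := (Complex.nonneg_iff.1 (hσ (1 + x))).2
  have h3 := (Complex.nonneg_iff.1 (hσ (1 + Complex.I • x))).2
  have e2 : star (1 + x) * (1 + x) = star 1 * 1 + x + star x + star x * x := by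
    rw [star_add, star_one]; noncomm_ring
  have e3 : star (1 + Complex.I • x) * (1 + Complex.I • x) =
      star 1 * 1 + Complex.I • x - Complex.I • star x + star x * x := by
    have : star (Complex.I • x) = -(Complex.I • star x) := by
      rw [star_smul_vn]; simp
    rw [star_add, star_one, this, add_mul, mul_add, mul_add, neg_mul, neg_mul, smul_mul_smul_comm,
      Complex.I_mul_I, mul_one, one_mul, mul_one, neg_smul, one_smul, neg_neg]
    abel
  rw [e2] at h2
  rw [e3] at h3
  simp only [map_add, map_sub, map_smul, smul_eq_mul, Complex.add_im, Complex.sub_im,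
    Complex.mul_im, Complex.I_re, Complex.I_im, zero_mul, one_mul, zero_add] at h2 h3
  apply Complex.ext
  · rw [Complex.conj_re]; linarith
  · rw [Complex.conj_im]; linarith

theorem hypertrace_defectA {inc : Inclusion M A} {ψ : A →ₗ[ℂ] ℂ} (hψ : IsHypertrace τ inc ψ)
    (hτt : IsTracialOn M τ) (x : M) (T : A) :
    (τ (star x * x)).re / 2 ≤ (ψ (defectA inc x T)).re := by
  have hpos := hψ.1.1.2
  have p1 := (Complex.nonneg_iff.1 (hpos (inc.π x - (2 : ℂ) • T))).1
  have p2 := (Complex.nonneg_iff.1 (hpos (star (inc.π x) - (2 : ℂ) • star T))).1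
  have s2 : ∀ S : A, star ((2 : ℂ) • S) = (2 : ℂ) • star S := fun S => by
    rw [star_smul_vn]; simp
  have q1 : ψ (star (inc.π x) * inc.π x) = τ (star x * x) := by
    rw [← inc.map_star, ← inc.map_mul, hψ.1.2]
  have q2 : ψ (inc.π x * star (inc.π x)) = τ (star x * x) := by
    rw [← inc.map_star, ← inc.map_mul, hψ.1.2, hτt]
  have q3 : ψ (star T * inc.π x) = ψ (inc.π x * star T) := (hψ.2 _ _).symm
  have q4 : ψ (star (inc.π x) * T) = (starRingEnd ℂ) (ψ (inc.π x * star T)) := by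
    rw [← q3, ← map_star_of_state hpos, star_mul, star_star]
  have q5 : ψ (T * star (inc.π x)) = (starRingEnd ℂ) (ψ (inc.π x * star T)) := by
    rw [← map_star_of_state hpos, star_mul, star_star]
  simp only [star_sub, star_star, s2, sub_mul, mul_sub, smul_mul_assoc, mul_smul_comm, map_sub,
    map_smul, smul_eq_mul, q1, q2, q3, q4, q5] at p1 p2
  simp only [Complex.sub_re, Complex.mul_re, Complex.re_ofNat, Complex.im_ofNat, zero_mul,
    sub_zero, Complex.mul_im, Complex.conj_re] at p1 p2
  have e : ψ (defectA inc x T) = τ (star x * x) - (starRingEnd ℂ) (ψ (inc.π x * star T)) -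
      ψ (inc.π x * star T) + ψ (star T * T) + ψ (T * star T) := by
    simp only [defectA, star_sub, sub_mul, mul_sub, map_add, map_sub, q1, q3, q4]
    ring
  rw [e]
  simp only [Complex.sub_re, Complex.add_re, Complex.conj_re]
  linarith

theorem exists_goodVec_defect [TopologicalSpace.SeparableSpace K] (hM : IsII1Factor M τ)
    {inc : Inclusion M A} {ψ : A →ₗ[ℂ] ℂ} (hψ : IsHypertrace τ inc ψ) {z : ℕ → M}
    (hz : IsRegularSeq z) (N : ℕ) (R : ℕ → ℝ) (hR : ∀ n, 0 ≤ R n) {ε : ℝ} (hε : 0 < ε) :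
    ∃ Ω : Amp K, GoodVec τ inc z Ω ∧ ∀ T : ℕ → K →L[ℂ] K, (∀ n, T n ∈ A ∧ ‖T n‖ ≤ R n) →
      ∑ n ∈ Finset.range N, (τ (star (star (z n)) * star (z n))).re / 2 - ε ≤
        ∑ n ∈ Finset.range N, (wv Ω (defect (inc.hom (star (z n))) (T n))).re := by
  by_contra! hcon
  let S : ℝ := ∑ n ∈ Finset.range N, (τ (star (star (z n)) * star (z n))).re / 2
  let X : (ℕ → K →L[ℂ] K) → K →L[ℂ] K := fun T =>
    ∑ n ∈ Finset.range N, defect (inc.hom (star (z n))) (T n)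
  let B : Set (ℕ → K →L[ℂ] K) := {T | ∀ n, T n ∈ A ∧ ‖T n‖ ≤ R n}
  let J : Set ((K →L[ℂ] K) →ₗ[ℂ] ℂ) := {j | ∃ Ω, GoodVec τ inc z Ω ∧ j = wv Ω}
  let f : ((K →L[ℂ] K) →ₗ[ℂ] ℂ) → (ℕ → K →L[ℂ] K) → ℝ := fun j T => S - ε - (j (X T)).re
  have hX : ∀ Ω T, (wv Ω (X T)).re =
      ∑ n ∈ Finset.range N, (wv Ω (defect (inc.hom (star (z n))) (T n))).re := fun Ω T => by
    rw [map_sum, Complex.re_sum]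
  have hBc : Convex ℝ B := fun T hT T' hT' c d hc hd hcd n => by
    refine ⟨add_mem (real_smul_mem_vn (hT n).1 c) (real_smul_mem_vn (hT' n).1 d), ?_⟩
    refine (norm_add_le _ _).trans ?_
    change ‖c • T n‖ + ‖d • T' n‖ ≤ R n
    rw [norm_smul, norm_smul, Real.norm_of_nonneg hc, Real.norm_of_nonneg hd]
    have h1 := mul_le_mul_of_nonneg_left (hT n).2 hc
    have h2 := mul_le_mul_of_nonneg_left (hT' n).2 hd
    have h3 : R n = c * R n + d * R n := by rw [← add_mul, hcd, one_mul]
    linarith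
  obtain ⟨T, hT, h0⟩ := minimax (J := J) (B := B) (f := f)
    (by
      rintro _ ⟨Ω, -, rfl⟩
      refine ⟨hBc, fun T hT T' hT' c d hc hd hcd => ?_⟩
      simp only [f, hX, smul_eq_mul]
      have h1 : ∑ n ∈ Finset.range N,
          (wv Ω (defect (inc.hom (star (z n))) ((c • T + d • T') n))).re ≤
          c * ∑ n ∈ Finset.range N, (wv Ω (defect (inc.hom (star (z n))) (T n))).re +
          d * ∑ n ∈ Finset.range N, (wv Ω (defect (inc.hom (star (z n))) (T' n))).re := by
        rw [Finset.mul_sum, Finset.mul_sum, ← Finset.sum_add_distrib]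
        exact Finset.sum_le_sum fun n _ => wv_defect_convex Ω _ _ _ hc hd hcd
      have h2 : S - ε = c * (S - ε) + d * (S - ε) := by rw [← add_mul, hcd, one_mul]
      linarith)
    (by
      refine fun T _ => ⟨?_, fun j _ j' _ c d _ _ hcd => ?_⟩
      · rintro _ ⟨Ω, hΩ, rfl⟩ _ ⟨Ω', hΩ', rfl⟩ c d hc hd hcd
        obtain ⟨Ω₁, h1⟩ := exists_wv_convex Ω Ω' hc hd
        exact ⟨Ω₁, GoodVec.convex hc hd hcd h1 hΩ hΩ', LinearMap.ext fun Y => (h1 Y).symm⟩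
      · simp only [f, smul_eq_mul, LinearMap.add_apply, LinearMap.smul_apply, Complex.add_re,
          Complex.real_smul, Complex.re_ofReal_mul]
        have h2 : S - ε = c * (S - ε) + d * (S - ε) := by rw [← add_mul, hcd, one_mul]
        linarith)
    (by
      rintro _ ⟨Ω, hΩ, rfl⟩ _ ⟨Ω', hΩ', rfl⟩ c d hc hd hcd
      obtain ⟨Ω₁, h1⟩ := exists_wv_convex Ω Ω' hc hd
      exact ⟨Ω₁, GoodVec.convex hc hd hcd h1 hΩ hΩ', LinearMap.ext fun Y => (h1 Y).symm⟩)
    ⟨0, fun n => ⟨zero_mem A, by simpa using hR n⟩⟩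
    (fun 𝒰 hB => by
      have h1 : ∀ n, ∃ T' : K →L[ℂ] K, ‖T'‖ ≤ R n ∧
          (∀ Ω Ω' : Amp K, Tendsto (fun T : ℕ → K →L[ℂ] K => ⟪Ω, amp (T n) Ω'⟫_ℂ) 𝒰
            (𝓝 ⟪Ω, amp T' Ω'⟫_ℂ)) ∧ T' ∈ A := fun n => by
        obtain ⟨T', h2, h3, h4⟩ := exists_wot_limit 𝒰 (T := fun T : ℕ → K →L[ℂ] K => T n)
          (R := R n) (mem_of_superset hB fun T hT => (hT n).2)
        exact ⟨T', h2, h3, h4 A (mem_of_superset hB fun T hT => (hT n).1)⟩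
      choose T' hT'n hT'l hT'A using h1
      refine ⟨T', fun n => ⟨hT'A n, hT'n n⟩, ?_⟩
      rintro _ ⟨Ω, -, rfl⟩ c hc
      simp only [f, hX] at hc ⊢
      exact le_sub_sum_wv_defect (T := fun T : ℕ → K →L[ℂ] K => T) hT'l _ Ω N hc)
    (by
      rintro _ ⟨Ω, hΩ, rfl⟩ δ hδ
      obtain ⟨T, hT, h1⟩ := hcon Ω hΩ
      refine ⟨T, hT, ?_⟩
      simp only [f, hX]
      simp only [S]
      linarith)
  let Y : A := ∑ n ∈ Finset.range N, defectA inc (star (z n)) ⟨T n, (hT n).1⟩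
  have hYc : (Y : K →L[ℂ] K) = X T := by
    rw [AddSubmonoidClass.coe_finsetSum]
    rfl
  have hY : 0 ≤ (Y : K →L[ℂ] K) := by
    rw [hYc]
    refine Finset.sum_nonneg fun n _ => add_nonneg (star_mul_self_nonneg _) ?_
    exact mul_star_self_nonneg _
  obtain ⟨Ω, hΩ, h1⟩ := exists_goodVec_near hM hψ hz hY (half_pos hε)
  have h2 := h0 _ ⟨Ω, hΩ, rfl⟩
  have h3 : S ≤ (ψ Y).re := by
    rw [map_sum, Complex.re_sum]
    exact Finset.sum_le_sum fun n _ => hypertrace_defectA hψ hM.tracial _ _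
  rw [hYc] at h1
  simp only [f] at h2
  linarith

end DefectBound

section BoundRemoval

variable {K : Type} [NormedAddCommGroup K] [InnerProductSpace ℂ K] [CompleteSpace K]

theorem continuous_cut : Continuous (fun s : ℝ => max √s 2) ∧
    Continuous (fun s : ℝ => 2 / max √s 2) ∧
    Continuous (fun s : ℝ => √((1 - 2 / max √s 2) / max √s 2)) ∧
    Continuous (fun s : ℝ => √((1 - 2 / max √s 2) * max √s 2)) := by
  have h0 : Continuous (fun s : ℝ => max √s 2) := Real.continuous_sqrt.max continuous_const
  have hne : ∀ s : ℝ, max √s 2 ≠ 0 := fun s => (lt_max_of_lt_right two_pos).ne'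
  have h1 : Continuous (fun s : ℝ => 2 / max √s 2) := continuous_const.div h0 hne
  exact ⟨h0, h1, Real.continuous_sqrt.comp ((continuous_const.sub h1).div h0 hne),
    Real.continuous_sqrt.comp ((continuous_const.sub h1).mul h0)⟩

theorem exists_cut_operators {A : VonNeumannAlgebra K} {h : K →L[ℂ] K} (hA : h ∈ A)
    (h0 : 0 ≤ h) : ∃ g p q : K →L[ℂ] K, g ∈ A ∧ p ∈ A ∧ star g = g ∧ star p = p ∧ star q = q ∧
      p * q = 1 - g ∧ (2 : ℝ) • (q * q) ≤ h - g * h * g ∧ (2 : ℝ) • (p * p) ≤ 1 - g * g ∧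
      ‖g * h * g‖ ≤ 4 := by
  have hsa : IsSelfAdjoint h := IsSelfAdjoint.of_nonneg h0
  obtain ⟨c0, c1, c2, c3⟩ := continuous_cut
  have hw : ∀ s : ℝ, 0 < max √s 2 := fun s => lt_max_of_lt_right two_pos
  have hg1 : ∀ s : ℝ, 2 / max √s 2 ≤ 1 := fun s => (div_le_one (hw s)).2 (le_max_right _ _)
  have hp2 : ∀ s : ℝ, √((1 - 2 / max √s 2) / max √s 2) * √((1 - 2 / max √s 2) / max √s 2) =
      (1 - 2 / max √s 2) / max √s 2 := fun s =>
    Real.mul_self_sqrt (div_nonneg (sub_nonneg.2 (hg1 s)) (hw s).le)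
  have hq2 : ∀ s : ℝ, √((1 - 2 / max √s 2) * max √s 2) * √((1 - 2 / max √s 2) * max √s 2) =
      (1 - 2 / max √s 2) * max √s 2 := fun s =>
    Real.mul_self_sqrt (mul_nonneg (sub_nonneg.2 (hg1 s)) (hw s).le)
  have hspec : ∀ s ∈ spectrum ℝ h, 0 ≤ s := fun s hs => spectrum_nonneg_of_nonneg h0 hs
  have egh : cfc (fun s : ℝ => 2 / max √s 2) h * h * cfc (fun s : ℝ => 2 / max √s 2) h =
      cfc (fun s : ℝ => 2 / max √s 2 * s * (2 / max √s 2)) h := by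
    rw [cfc_mul (fun s : ℝ => 2 / max √s 2 * s) _ h (c1.mul continuous_id).continuousOn
      c1.continuousOn, cfc_mul _ (fun s : ℝ => s) h c1.continuousOn continuousOn_id,
      cfc_id' ℝ h]
  have hstar : ∀ f : ℝ → ℝ, star (cfc f h) = cfc f h := fun f =>
    IsSelfAdjoint.star_eq (cfc_predicate f h)
  have eone : (1 : K →L[ℂ] K) = cfc (fun _ : ℝ => (1 : ℝ)) h := (cfc_const_one ℝ h).symm
  refine ⟨cfc (fun s : ℝ => 2 / max √s 2) h,
    cfc (fun s : ℝ => √((1 - 2 / max √s 2) / max √s 2)) h,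
    cfc (fun s : ℝ => √((1 - 2 / max √s 2) * max √s 2)) h, cfc_mem hA _, cfc_mem hA _,
    hstar _, hstar _, hstar _,
    ?_, ?_, ?_, ?_⟩
  · rw [← cfc_mul _ _ h c2.continuousOn c3.continuousOn, eone,
      ← cfc_sub _ _ h continuousOn_const c1.continuousOn]
    refine cfc_congr fun s _ => ?_
    change √((1 - 2 / max √s 2) / max √s 2) * √((1 - 2 / max √s 2) * max √s 2) = 1 - 2 / max √s 2
    rw [← Real.sqrt_mul (div_nonneg (sub_nonneg.2 (hg1 s)) (hw s).le),
      div_mul_eq_mul_div, ← mul_assoc, mul_div_assoc, div_self (hw s).ne', mul_one,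
      Real.sqrt_mul_self (sub_nonneg.2 (hg1 s))]
  · have ed : h - cfc (fun s : ℝ => 2 / max √s 2 * s * (2 / max √s 2)) h =
        cfc (fun s : ℝ => s - 2 / max √s 2 * s * (2 / max √s 2)) h := by
      rw [cfc_sub (fun s : ℝ => s) (fun s : ℝ => 2 / max √s 2 * s * (2 / max √s 2)) h
        continuousOn_id ((c1.mul continuous_id).mul c1).continuousOn, cfc_id' ℝ h]
    rw [egh, ed, ← cfc_mul _ _ h c3.continuousOn c3.continuousOn,
      
      ← cfc_smul (2 : ℝ) (fun s : ℝ => √((1 - 2 / max √s 2) * max √s 2) * √((1 - 2 / max √s 2) * max √s 2)) h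
        (c3.mul c3).continuousOn]
    refine cfc_mono (fun s hs => ?_) ((c3.mul c3).const_smul (2 : ℝ)).continuousOn
      (continuous_id.sub ((c1.mul continuous_id).mul c1)).continuousOn
    rw [hq2, smul_eq_mul]
    have hs0 := hspec s hs
    rcases le_total √s 2 with h1 | h1
    · rw [max_eq_right h1]; norm_num
    · rw [max_eq_left h1]
      have h2 := Real.mul_self_sqrt hs0
      have h3 : √s ≠ 0 := by positivity
      have e : 2 / √s * s * (2 / √s) = 4 := by
        nth_rewrite 2 [← h2]; field_simp; norm_num
      have e' : (1 - 2 / √s) * √s = √s - 2 := by field_simp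
      rw [e, e']
      nlinarith
  · rw [← cfc_mul _ _ h c1.continuousOn c1.continuousOn, eone,
      ← cfc_sub _ (fun s : ℝ => 2 / max √s 2 * (2 / max √s 2)) h continuousOn_const
        (c1.mul c1).continuousOn,
      ← cfc_mul _ _ h c2.continuousOn c2.continuousOn, 
      ← cfc_smul (2 : ℝ) (fun s : ℝ => √((1 - 2 / max √s 2) / max √s 2) * √((1 - 2 / max √s 2) / max √s 2)) h
        (c2.mul c2).continuousOn]
    refine cfc_mono (fun s hs => ?_) ((c2.mul c2).const_smul (2 : ℝ)).continuousOn
      (continuous_const.sub (c1.mul c1)).continuousOn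
    rw [hp2, smul_eq_mul]
    change 2 * ((1 - 2 / max √s 2) / max √s 2) ≤ 1 - 2 / max √s 2 * (2 / max √s 2)
    have e : 2 * ((1 - 2 / max √s 2) / max √s 2) =
      2 / max √s 2 - 2 / max √s 2 * (2 / max √s 2) := by ring
    rw [e]
    linarith [hg1 s]
  · rw [egh]
    refine norm_cfc_le (by norm_num) fun s hs => ?_
    have hs0 := hspec s hs
    have h2 := Real.mul_self_sqrt hs0
    rw [Real.norm_of_nonneg (mul_nonneg (mul_nonneg (by positivity) hs0) (by positivity)),
      div_mul_eq_mul_div, div_mul_div_comm, div_le_iff₀ (mul_pos (hw s) (hw s))]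
    have h3 := mul_self_le_mul_self (Real.sqrt_nonneg s) (le_max_left √s 2)
    nlinarith

/-- Truncating `T` does not increase the defect functional of a quasi-invariant state. -/
theorem exists_bounded_defect_le {A : VonNeumannAlgebra K} {a T : K →L[ℂ] K} {Ω : Amp K}
    (hdom : ∀ X : K →L[ℂ] K, 0 ≤ X → (wv Ω (star a * X * a)).re ≤ 2 * (wv Ω X).re)
    (hT : T ∈ A) : ∃ T' ∈ A, ‖T'‖ ≤ 2 ∧ (wv Ω (defect a T')).re ≤ (wv Ω (defect a T)).re := by
  obtain ⟨g, p, q, hg, hp, sg, sp, sq, hpq, h1, h2, h3⟩ :=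
    exists_cut_operators (mul_mem (star_mem hT) hT) (star_mul_self_nonneg T)
  refine ⟨T * g, mul_mem hT hg, ?_, ?_⟩
  · have h4 : ‖T * g‖ * ‖T * g‖ ≤ 4 := by
      rw [← CStarRing.norm_star_mul_self, star_mul, sg]
      simpa only [mul_assoc] using h3
    nlinarith [norm_nonneg (T * g)]
  · have hq0 : 0 ≤ q * q := by simpa only [sq] using star_mul_self_nonneg q
    have hB0 : 0 ≤ T * p * p * star T := by
      have := mul_star_self_nonneg (T * p)
      rwa [star_mul, sp, ← mul_assoc] at this
    have hA' : 2 * (wv Ω (q * q)).re ≤ (wv Ω (star T * T - g * (star T * T) * g)).re := by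
      have := (Complex.le_def.1 (wv_mono Ω h1)).1
      rwa [← Complex.coe_smul, map_smul, smul_eq_mul, Complex.re_ofReal_mul] at this
    have hB' : 2 * (wv Ω (T * p * p * star T)).re ≤
        (wv Ω (T * star T - T * g * g * star T)).re := by
      have h5 := star_right_conjugate_le_conjugate h2 T
      have e1 : T * ((2 : ℝ) • (p * p)) * star T = (2 : ℝ) • (T * p * p * star T) := by
        rw [mul_smul_comm, smul_mul_assoc]; simp only [mul_assoc]
      have e2 : T * (1 - g * g) * star T = T * star T - T * g * g * star T := by noncomm_ring
      rw [e1, e2] at h5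
      have := (Complex.le_def.1 (wv_mono Ω h5)).1
      rwa [← Complex.coe_smul, map_smul, smul_eq_mul, Complex.re_ofReal_mul] at this
    have hC : (wv Ω (star a * (T * p * p * star T) * a)).re ≤
        2 * (wv Ω (T * p * p * star T)).re := hdom _ hB0
    have hx : ‖wv Ω (star a * T * (1 - g))‖ ^ 2 ≤
        2 * (wv Ω (T * p * p * star T)).re * (wv Ω (q * q)).re := by
      have e1 : star a * T * (1 - g) = star (p * star T * a) * q := by
        rw [← hpq]; simp only [star_mul, star_star, sp, mul_assoc]
      have e2 : star (p * star T * a) * (p * star T * a) = star a * (T * p * p * star T) * a := by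
        simp only [star_mul, star_star, sp, mul_assoc]
      have n1 : ‖amp (p * star T * a) Ω‖ ^ 2 = (wv Ω (star a * (T * p * p * star T) * a)).re := by
        rw [← e2, wv_star_mul_self, Complex.ofReal_re]
      have n2 : ‖amp q Ω‖ ^ 2 = (wv Ω (q * q)).re := by
        have := wv_star_mul_self Ω q
        rw [sq] at this
        rw [this, Complex.ofReal_re]
      rw [e1, wv_star_mul]
      refine (pow_le_pow_left₀ (norm_nonneg _) (norm_inner_le_norm _ _) 2).trans ?_
      rw [mul_pow, n1, n2]
      exact mul_le_mul_of_nonneg_right hC (re_wv_nonneg Ω hq0)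
    have hx' : (wv Ω (star a * T * (1 - g))).re ≤
        (wv Ω (T * p * p * star T)).re + (wv Ω (q * q)).re := by
      have hb := re_wv_nonneg Ω hB0
      have hq := re_wv_nonneg Ω hq0
      refine (Complex.re_le_norm _).trans (abs_le_of_sq_le_sq' ?_ (add_nonneg hb hq)).2
      nlinarith [sq_nonneg ((wv Ω (T * p * p * star T)).re - (wv Ω (q * q)).re), sq_nonneg
        ((wv Ω (T * p * p * star T)).re), sq_nonneg ((wv Ω (q * q)).re)]
    have hstar : (wv Ω ((1 - g) * star T * a)).re = (wv Ω (star a * T * (1 - g))).re := by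
      have e : (1 - g) * star T * a = star (star a * T * (1 - g)) := by
        simp only [star_mul, star_star, star_sub, star_one, sg, mul_assoc]
      rw [e, wv_apply, inner_amp_star_right, ← inner_conj_symm, Complex.conj_re, wv_apply]
    have e3 : defect a T = defect a (T * g) - star a * T * (1 - g) - (1 - g) * star T * a +
        (star T * T - g * (star T * T) * g) + (T * star T - T * g * g * star T) := by
      simp only [defect, star_sub, star_mul, sg]
      noncomm_ring
    rw [e3]
    simp only [map_add, Complex.add_re]
    simp only [map_sub, Complex.sub_re] at hA' hB' ⊢
    linarith

end BoundRemoval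

section GoodVecDefect

variable {H : Type} [NormedAddCommGroup H] [InnerProductSpace ℂ H] [CompleteSpace H]
  {K : Type} [NormedAddCommGroup K] [InnerProductSpace ℂ K] [CompleteSpace K]
  {M : VonNeumannAlgebra H} {A : VonNeumannAlgebra K} {τ : M →ₗ[ℂ] ℂ}

theorem GoodVec.sum_le {inc : Inclusion M A} {z : ℕ → M} {Ω : Amp K} (h : GoodVec τ inc z Ω)
    (N : ℕ) {X : K →L[ℂ] K} (hX : 0 ≤ X) :
    ∑ n ∈ Finset.range N, (wv (amp (inc.hom (star (z n))) Ω) X).re ≤ 2 * (wv Ω X).re := by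
  have := h.dom N X hX
  rw [conjSum, map_sum, Complex.re_sum] at this
  simpa only [wv_conj] using this

theorem GoodVec.single_le {inc : Inclusion M A} {z : ℕ → M} {Ω : Amp K} (h : GoodVec τ inc z Ω)
    (n : ℕ) {X : K →L[ℂ] K} (hX : 0 ≤ X) :
    (wv (amp (inc.hom (star (z n))) Ω) X).re ≤ 2 * (wv Ω X).re :=
  (Finset.single_le_sum (f := fun n => (wv (amp (inc.hom (star (z n))) Ω) X).re)
    (fun _ _ => re_wv_nonneg _ hX) (Finset.self_mem_range_succ n)).trans (h.sum_le (n + 1) hX)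

/-- There are quasi-invariant faithful normal hyperstates for which the defect functional is
almost bounded below by its value for a hypertrace. -/
theorem exists_goodVec_le_defect [TopologicalSpace.SeparableSpace K] (hM : IsII1Factor M τ)
    {inc : Inclusion M A} {ψ : A →ₗ[ℂ] ℂ} (hψ : IsHypertrace τ inc ψ) {z : ℕ → M}
    (hz : IsRegularSeq z) (N : ℕ) {ε : ℝ} (hε : 0 < ε) :
    ∃ Ω : Amp K, GoodVec τ inc z Ω ∧ ∀ n < N, ∀ T ∈ A,
      (τ (z n * star (z n))).re / 2 - ε ≤ (wv Ω (defect (inc.hom (star (z n))) T)).re := by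
  classical
  obtain ⟨Ω, hΩ, h⟩ := exists_goodVec_defect hM hψ hz N
    (fun n => 2 + ‖(1 / 2 : ℝ) • inc.hom (star (z n))‖) (fun n => by positivity) hε
  refine ⟨Ω, hΩ, fun n hn T hT => ?_⟩
  obtain ⟨T', hT', hb, hle⟩ := exists_bounded_defect_le (a := inc.hom (star (z n))) (Ω := Ω)
    (fun X hX => by
      have := hΩ.single_le n hX
      rwa [wv_amp] at this) hT
  refine le_trans ?_ hle
  let S : ℕ → K →L[ℂ] K := fun m => if m = n then T' else (1 / 2 : ℝ) • inc.hom (star (z m))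
  have h1 := h S fun m => by
    by_cases hm : m = n
    · simp only [S, hm, if_true]
      exact ⟨hT', hb.trans (by linarith [norm_nonneg ((1 / 2 : ℝ) • inc.hom (star (z n)))])⟩
    · simp only [S, hm, if_false]
      exact ⟨real_smul_mem_vn (inc.hom_mem _) _, by linarith⟩
  have h2 : ∀ m, (wv Ω (defect (inc.hom (star (z m))) ((1 / 2 : ℝ) • inc.hom (star (z m))))).re =
      (τ (star (star (z m)) * star (z m))).re / 2 := fun m => by
    have e : defect (inc.hom (star (z m))) ((1 / 2 : ℝ) • inc.hom (star (z m))) =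
        ((1 / 4 : ℝ) : ℂ) • inc.hom (star (star (z m)) * star (z m)) +
          ((1 / 4 : ℝ) : ℂ) • inc.hom (star (z m) * star (star (z m))) := by
      have e1 : inc.hom (star (z m)) - (1 / 2 : ℝ) • inc.hom (star (z m)) =
          (1 / 2 : ℝ) • inc.hom (star (z m)) := by
        nth_rewrite 1 [← one_smul ℝ (inc.hom (star (z m)))]
        rw [← sub_smul]; norm_num
      rw [defect, e1, star_smul, smul_mul_smul_comm, smul_mul_smul_comm, inc.hom_mul, inc.hom_mul,
        inc.hom_star (star (z m)), Complex.coe_smul,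
        Complex.coe_smul]
      norm_num
    rw [e, map_add, map_smul, map_smul, hΩ.hyp, hΩ.hyp, hM.tracial (star (z m)), smul_eq_mul,
      Complex.add_re, Complex.re_ofReal_mul]
    ring
  have hnm : n ∈ Finset.range N := Finset.mem_range.2 hn
  rw [← Finset.add_sum_erase _ _ hnm, ← Finset.add_sum_erase _ _ hnm] at h1
  have h3 : ∑ m ∈ (Finset.range N).erase n, (wv Ω (defect (inc.hom (star (z m))) (S m))).re =
      ∑ m ∈ (Finset.range N).erase n, (τ (star (star (z m)) * star (z m))).re / 2 :=
    Finset.sum_congr rfl fun m hm => by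
      simp only [S, Finset.ne_of_mem_erase hm, if_false]
      exact h2 m
  have h4 : S n = T' := if_pos rfl
  rw [h3, h4, star_star] at h1
  linarith

end GoodVecDefect

section RealSubspace

attribute [local instance] InnerProductSpace.complexToReal

variable {L : Type} [NormedAddCommGroup L] [InnerProductSpace ℂ L] [CompleteSpace L]

theorem real_inner_eq_re (x y : L) : ⟪x, y⟫_ℝ = (⟪x, y⟫_ℂ).re := rfl

theorem real_inner_I_smul (x y : L) : ⟪x, Complex.I • y⟫_ℝ = -⟪Complex.I • x, y⟫_ℝ := by
  rw [real_inner_eq_re, real_inner_eq_re, inner_smul_left, inner_smul_right, Complex.conj_I,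
    neg_mul, Complex.neg_re, neg_neg]

theorem inner_eq_of_real (x y : L) :
    ⟪x, y⟫_ℂ = (⟪x, y⟫_ℝ : ℂ) + (⟪Complex.I • x, y⟫_ℝ : ℂ) * Complex.I := by
  apply Complex.ext
  · simp [real_inner_eq_re]
  · simp [real_inner_eq_re]

variable (𝒦 : Submodule ℝ L) [CompleteSpace 𝒦]

theorem real_inner_starProjection_left {k : L} (hk : k ∈ 𝒦) (ξ : L) :
    ⟪𝒦.starProjection ξ, k⟫_ℝ = ⟪ξ, k⟫_ℝ := by
  rw [Submodule.inner_starProjection_left_eq_right, Submodule.starProjection_eq_self_iff.2 hk]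

/-- The operator `η ↦ (P η - i P (i η)) / 2` attached to the real orthogonal projection `P` onto
a closed real subspace. For the closure of `{h Ω : h = h*}` this is `(1 + Δ)⁻¹`. -/
def halfProj : L →L[ℂ] L where
  toFun η := (1 / 2 : ℂ) • (𝒦.starProjection η - Complex.I • 𝒦.starProjection (Complex.I • η))
  map_add' x y := by
    simp only [smul_add, map_add, smul_sub]; abel
  map_smul' c x := by
    have e : ∀ y : L, 𝒦.starProjection (c • y) =
        c.re • 𝒦.starProjection y + c.im • 𝒦.starProjection (Complex.I • y) := fun y => by
      rw [← map_smul, ← map_smul, ← map_add]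
      congr 1
      nth_rewrite 1 [← Complex.re_add_im c]
      rw [add_smul, mul_smul, Complex.coe_smul, Complex.coe_smul]
    have h2 : 𝒦.starProjection (Complex.I • Complex.I • x) = -𝒦.starProjection x := by
      rw [smul_smul, Complex.I_mul_I, neg_one_smul, map_neg]
    rw [RingHom.id_apply, smul_comm Complex.I c x, e, e, h2]
    simp only [← Complex.coe_smul, smul_sub, smul_add, smul_neg, smul_smul]
    have hI := Complex.I_mul_I
    generalize 𝒦.starProjection x = u
    generalize 𝒦.starProjection (Complex.I • x) = w
    have hc := Complex.re_add_im c
    generalize (c.re : ℂ) = a at *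
    generalize (c.im : ℂ) = b at *
    subst hc
    match_scalars
    · ring
    · linear_combination (1 / 2 * b) * hI
  cont := by fun_prop

theorem halfProj_apply (η : L) : halfProj 𝒦 η =
    (1 / 2 : ℂ) • (𝒦.starProjection η - Complex.I • 𝒦.starProjection (Complex.I • η)) := rfl

theorem real_inner_halfProj (ξ η : L) : ⟪ξ, halfProj 𝒦 η⟫_ℝ =
    (⟪𝒦.starProjection ξ, 𝒦.starProjection η⟫_ℝ +
      ⟪𝒦.starProjection (Complex.I • ξ), 𝒦.starProjection (Complex.I • η)⟫_ℝ) / 2 := by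
  have e : ∀ v : L, (1 / 2 : ℂ) • v = (1 / 2 : ℝ) • v := fun v => by
    rw [← Complex.coe_smul]; norm_num
  have h : ∀ x y : L, ⟪𝒦.starProjection x, 𝒦.starProjection y⟫_ℝ = ⟪x, 𝒦.starProjection y⟫_ℝ :=
    fun x y => real_inner_starProjection_left 𝒦 (Submodule.starProjection_apply_mem _ _) _
  rw [halfProj_apply, e, real_inner_smul_right, inner_sub_right, real_inner_I_smul, h, h]
  ring

theorem halfProj_isSelfAdjoint : IsSelfAdjoint (halfProj 𝒦) := by
  rw [ContinuousLinearMap.isSelfAdjoint_iff_isSymmetric]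
  have key : ∀ x y : L, ⟪halfProj 𝒦 x, y⟫_ℝ = ⟪x, halfProj 𝒦 y⟫_ℝ := fun x y => by
    rw [real_inner_comm, real_inner_halfProj, real_inner_halfProj,
      real_inner_comm (𝒦.starProjection x),
      real_inner_comm (𝒦.starProjection (Complex.I • x))]
  intro x y
  change ⟪halfProj 𝒦 x, y⟫_ℂ = ⟪x, halfProj 𝒦 y⟫_ℂ
  rw [inner_eq_of_real, inner_eq_of_real x, ← map_smul, key, key]

theorem inner_halfProj_self (η : L) : ⟪η, halfProj 𝒦 η⟫_ℂ =
    (((‖𝒦.starProjection η‖ ^ 2 + ‖𝒦.starProjection (Complex.I • η)‖ ^ 2) / 2 : ℝ) : ℂ) := by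
  rw [inner_clm_eq_re (halfProj_isSelfAdjoint 𝒦), ← real_inner_eq_re, real_inner_halfProj,
    real_inner_self_eq_norm_sq, real_inner_self_eq_norm_sq]

theorem norm_I_smul (η : L) : ‖Complex.I • η‖ = ‖η‖ := by
  rw [norm_smul, Complex.norm_I, one_mul]

theorem halfProj_nonneg : 0 ≤ halfProj 𝒦 :=
  nonneg_of_inner_eq (inner_halfProj_self 𝒦) fun _ => by positivity

theorem halfProj_le_one : halfProj 𝒦 ≤ 1 := by
  rw [← sub_nonneg]
  refine nonneg_of_inner_eq (q := fun η => ‖η‖ ^ 2 -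
    (‖𝒦.starProjection η‖ ^ 2 + ‖𝒦.starProjection (Complex.I • η)‖ ^ 2) / 2) (fun η => ?_) fun η => ?_
  · rw [sub_apply, inner_sub_right, inner_halfProj_self, one_apply_eq_self,
      inner_self_eq_norm_sq_to_K]
    push_cast; rfl
  · have h1 := 𝒦.norm_starProjection_apply_le η
    have h2 := 𝒦.norm_starProjection_apply_le (Complex.I • η)
    rw [norm_I_smul] at h2
    nlinarith [norm_nonneg (𝒦.starProjection η), norm_nonneg (𝒦.starProjection (Complex.I • η))]

theorem norm_add_sub_I_smul (h k : L) :
    ‖h + Complex.I • k‖ ^ 2 + ‖h - Complex.I • k‖ ^ 2 = 2 * ‖h‖ ^ 2 + 2 * ‖k‖ ^ 2 := by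
  have := parallelogram_law_with_norm ℝ h (Complex.I • k)
  rw [norm_I_smul] at this
  nlinarith

/-- `B η` decomposed along `𝒦 + i 𝒦`. -/
theorem exists_halfProj_decomp (η : L) : ∃ h ∈ 𝒦, ∃ k ∈ 𝒦, halfProj 𝒦 η = h + Complex.I • k ∧
    ‖h - Complex.I • k‖ ^ 2 = (⟪η, halfProj 𝒦 η⟫_ℂ).re - ‖halfProj 𝒦 η‖ ^ 2 := by
  refine ⟨(1 / 2 : ℝ) • 𝒦.starProjection η,
    𝒦.smul_mem _ (Submodule.starProjection_apply_mem _ _),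
    (-(1 / 2) : ℝ) • 𝒦.starProjection (Complex.I • η),
    𝒦.smul_mem _ (Submodule.starProjection_apply_mem _ _), ?_, ?_⟩
  · rw [halfProj_apply, ← Complex.coe_smul, ← Complex.coe_smul]
    push_cast
    module
  · set h := (1 / 2 : ℝ) • 𝒦.starProjection η with hh
    set k := (-(1 / 2) : ℝ) • 𝒦.starProjection (Complex.I • η) with hk
    have e : halfProj 𝒦 η = h + Complex.I • k := by
      rw [halfProj_apply, hh, hk, ← Complex.coe_smul, ← Complex.coe_smul]
      push_cast
      module
    have h1 := norm_add_sub_I_smul h k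
    have h2 : ‖h‖ = 1 / 2 * ‖𝒦.starProjection η‖ := by rw [hh, norm_smul]; norm_num
    have h3 : ‖k‖ = 1 / 2 * ‖𝒦.starProjection (Complex.I • η)‖ := by rw [hk, norm_smul]; norm_num
    rw [h2, h3] at h1
    rw [inner_halfProj_self, Complex.ofReal_re, e]
    linarith

theorem eq_zero_of_inner_halfProj (hd : ∀ η : L, (∀ k ∈ 𝒦, ⟪η, k⟫_ℂ = 0) → η = 0) {η : L}
    (h : (⟪η, halfProj 𝒦 η⟫_ℂ).re = 0) : η = 0 := by
  rw [inner_halfProj_self, Complex.ofReal_re] at h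
  have h1 : 𝒦.starProjection η = 0 := norm_eq_zero.1 (by
    nlinarith [sq_nonneg ‖𝒦.starProjection η‖, sq_nonneg ‖𝒦.starProjection (Complex.I • η)‖])
  have h2 : 𝒦.starProjection (Complex.I • η) = 0 := norm_eq_zero.1 (by
    nlinarith [sq_nonneg ‖𝒦.starProjection η‖, sq_nonneg ‖𝒦.starProjection (Complex.I • η)‖])
  refine hd η fun k hk => ?_
  rw [inner_eq_of_real, ← real_inner_starProjection_left 𝒦 hk,
    ← real_inner_starProjection_left 𝒦 hk (Complex.I • η), h1, h2]
  simp

theorem mem_of_norm_le_starProjection {η : L} (h : ‖η‖ ^ 2 ≤ ‖𝒦.starProjection η‖ ^ 2) :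
    η ∈ 𝒦 := by
  rw [← Submodule.starProjection_eq_self_iff]
  have h1 : ⟪𝒦.starProjection η, η⟫_ℝ = ‖𝒦.starProjection η‖ ^ 2 := by
    rw [← real_inner_self_eq_norm_sq, real_inner_comm,
      ← real_inner_starProjection_left 𝒦 (Submodule.starProjection_apply_mem 𝒦 η)]
  have h2 := norm_sub_sq_real (𝒦.starProjection η) η
  rw [h1] at h2
  refine sub_eq_zero.1 (norm_eq_zero.1 ?_)
  nlinarith [norm_nonneg (𝒦.starProjection η - η)]

theorem eq_zero_of_inner_one_sub_halfProj (hi : ∀ k ∈ 𝒦, Complex.I • k ∈ 𝒦 → k = 0) {η : L}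
    (h : ‖η‖ ^ 2 ≤ (⟪η, halfProj 𝒦 η⟫_ℂ).re) : η = 0 := by
  rw [inner_halfProj_self, Complex.ofReal_re] at h
  have h1 := pow_le_pow_left₀ (norm_nonneg _) (𝒦.norm_starProjection_apply_le η) 2
  have h2 := pow_le_pow_left₀ (norm_nonneg _) (𝒦.norm_starProjection_apply_le (Complex.I • η)) 2
  rw [norm_I_smul] at h2
  refine hi η (mem_of_norm_le_starProjection 𝒦 (by linarith))
    (mem_of_norm_le_starProjection 𝒦 ?_)
  rw [norm_I_smul]
  linarith

/-- `ξ ↦ 2 Re ⟨ξ, η⟩ - ⟨ξ, B ξ⟩` is bounded by `‖h + ik‖² + ‖h - ik‖²` for `η = h + ik`. -/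
theorem variational_le {h k : L} (hh : h ∈ 𝒦) (hk : k ∈ 𝒦) (ξ : L) :
    2 * ⟪ξ, h + Complex.I • k⟫_ℝ - (⟪ξ, halfProj 𝒦 ξ⟫_ℂ).re =
      2 * ‖h‖ ^ 2 + 2 * ‖k‖ ^ 2 - (‖𝒦.starProjection ξ - (2 : ℝ) • h‖ ^ 2 +
        ‖𝒦.starProjection (Complex.I • ξ) - (-2 : ℝ) • k‖ ^ 2) / 2 := by
  rw [inner_halfProj_self, Complex.ofReal_re, inner_add_right, real_inner_I_smul,
    ← real_inner_starProjection_left 𝒦 hh, ← real_inner_starProjection_left 𝒦 hk,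
    norm_sub_sq_real, norm_sub_sq_real, real_inner_smul_right, real_inner_smul_right, norm_smul,
    norm_smul]
  norm_num
  ring

theorem exists_starProjection_near (hi : ∀ k ∈ 𝒦, Complex.I • k ∈ 𝒦 → k = 0) {h k : L}
    (hh : h ∈ 𝒦) (hk : k ∈ 𝒦) {ε : ℝ} (hε : 0 < ε) :
    ∃ ξ : L, ‖𝒦.starProjection ξ - h‖ ^ 2 + ‖𝒦.starProjection (Complex.I • ξ) - k‖ ^ 2 < ε := by
  let Θ : L →ₗ[ℝ] WithLp 2 (𝒦 × 𝒦) :=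
    { toFun := fun ξ => WithLp.toLp 2
        (𝒦.orthogonalProjectionOnto ξ, 𝒦.orthogonalProjectionOnto (Complex.I • ξ))
      map_add' := fun x y => by rw [smul_add, map_add, map_add]; rfl
      map_smul' := fun c x => by rw [smul_comm, map_smul, map_smul]; rfl }
  have hd : (LinearMap.range Θ).topologicalClosure = ⊤ := by
    rw [Submodule.topologicalClosure_eq_top_iff, Submodule.eq_bot_iff]
    intro p hp
    rw [Submodule.mem_orthogonal'] at hp
    have h1 : ∀ ξ : L, ⟪ξ, (p.fst : L) - Complex.I • (p.snd : L)⟫_ℝ = 0 := fun ξ => by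
      have := hp (Θ ξ) ⟨ξ, rfl⟩
      rw [WithLp.prod_inner_apply] at this
      change ⟪(p.fst : L), 𝒦.starProjection ξ⟫_ℝ +
        ⟪(p.snd : L), 𝒦.starProjection (Complex.I • ξ)⟫_ℝ = 0 at this
      rw [real_inner_comm, real_inner_starProjection_left 𝒦 p.fst.2, real_inner_comm _ (p.snd : L),
        real_inner_starProjection_left 𝒦 p.snd.2] at this
      rw [inner_sub_right, real_inner_I_smul, sub_neg_eq_add, this]
    have h2 : (p.fst : L) = Complex.I • (p.snd : L) := by
      have := h1 ((p.fst : L) - Complex.I • (p.snd : L))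
      exact sub_eq_zero.1 (inner_self_eq_zero.1 this)
    have h3 : (p.snd : L) = 0 := hi _ p.snd.2 (h2 ▸ p.fst.2)
    have h4 : (p.fst : L) = 0 := by rw [h2, h3, smul_zero]
    have h5 : p = WithLp.toLp 2 (p.fst, p.snd) := rfl
    have h6 : p.fst = 0 := Subtype.ext h4
    have h7 : p.snd = 0 := Subtype.ext h3
    rw [h5, h6, h7]
    rfl
  have hmem : (WithLp.toLp 2 ((⟨h, hh⟩ : 𝒦), (⟨k, hk⟩ : 𝒦)) : WithLp 2 (𝒦 × 𝒦)) ∈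
      closure (LinearMap.range Θ : Set (WithLp 2 (𝒦 × 𝒦))) := by
    rw [← Submodule.topologicalClosure_coe, hd]
    trivial
  obtain ⟨_, ⟨ξ, rfl⟩, h1⟩ := Metric.mem_closure_iff.1 hmem (√ε) (Real.sqrt_pos.2 hε)
  refine ⟨ξ, ?_⟩
  rw [dist_comm, dist_eq_norm] at h1
  have h2 := pow_lt_pow_left₀ h1 (norm_nonneg _) two_ne_zero
  rw [Real.sq_sqrt hε.le, WithLp.prod_norm_sq_eq_of_L2] at h2
  exact h2

end RealSubspace

section SpectralData

open MeasureTheory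

variable {L : Type} [NormedAddCommGroup L] [InnerProductSpace ℂ L] [CompleteSpace L]

/-- The spectral resolution of a self-adjoint operator, with its scalar spectral measures. -/
structure SpectralData (B : L →L[ℂ] L) where
  sa : IsSelfAdjoint B
  ν : L → Measure ℝ
  E : Set ℝ → L →L[ℂ] L
  finite : ∀ ξ, IsFiniteMeasure (ν ξ)
  supp : ∀ ξ, ν ξ (spectrum ℝ B)ᶜ = 0
  integrable : ∀ ξ (f : ℝ → ℝ), Continuous f → Integrable f (ν ξ)
  inner_cfc : ∀ ξ (f : ℝ → ℝ), Continuous f → ⟪ξ, cfc f B ξ⟫_ℂ = ((∫ l, f l ∂ν ξ : ℝ) : ℂ)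
  inner_E : ∀ ξ S, MeasurableSet S → ⟪ξ, E S ξ⟫_ℂ = ((ν ξ).real S : ℂ)
  E_sa : ∀ S, IsSelfAdjoint (E S)
  E_idem : ∀ S, E S * E S = E S
  E_inter : ∀ S T, MeasurableSet S → MeasurableSet T → E (S ∩ T) = E S * E T
  E_univ : E Set.univ = 1
  E_sigma : ∀ S : ℕ → Set ℝ, (∀ n, MeasurableSet (S n)) →
    Pairwise (Function.onFun Disjoint S) → ∀ ξ, HasSum (fun n => E (S n) ξ) (E (⋃ n, S n) ξ)

attribute [instance] SpectralData.finite

theorem nonempty_spectralData {B : L →L[ℂ] L} (hB : IsSelfAdjoint B) :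
    Nonempty (SpectralData B) := by
  obtain ⟨ν, E, h1, h2, h3, h4, h5, h6, h7, h8, h9⟩ := exists_pvm hB
  exact ⟨⟨hB, ν, E, h1, h2, fun ξ f hf => (h3 ξ f hf).1, fun ξ f hf => (h3 ξ f hf).2, h4, h5, h6,
    h7, h8, h9⟩⟩

namespace SpectralData

variable {B : L →L[ℂ] L} (D : SpectralData B)

theorem cfc_sa (f : ℝ → ℝ) : star (cfc f B) = cfc f B :=
  IsSelfAdjoint.star_eq (cfc_predicate f B)

theorem inner_cfc_cfc (η : L) {f g : ℝ → ℝ} (hf : Continuous f) (hg : Continuous g) :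
    ⟪cfc f B η, cfc g B η⟫_ℂ = ((∫ l, f l * g l ∂D.ν η : ℝ) : ℂ) := by
  rw [← D.inner_cfc η (fun l => f l * g l) (hf.mul hg), cfc_mul f g B hf.continuousOn hg.continuousOn]
  have h := ContinuousLinearMap.adjoint_inner_left (cfc f B) (cfc g B η) η
  rw [← ContinuousLinearMap.star_eq_adjoint, cfc_sa] at h
  exact h

theorem norm_cfc_sq (η : L) {f : ℝ → ℝ} (hf : Continuous f) :
    ‖cfc f B η‖ ^ 2 = ∫ l, f l * f l ∂D.ν η := by
  have h := D.inner_cfc_cfc η hf hf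
  rw [inner_self_eq_norm_sq_to_K] at h
  exact Complex.ofReal_injective (by rw [← h]; push_cast; rfl)

theorem cfc_id_eq (D : SpectralData B) : cfc (fun l : ℝ => l) B = B := cfc_id' ℝ B D.sa

theorem apply_cfc (D : SpectralData B) (η : L) {f : ℝ → ℝ} (hf : Continuous f) :
    B (cfc f B η) = cfc (fun l => l * f l) B η := by
  rw [cfc_mul (fun l => l) f B (by fun_prop) hf.continuousOn, D.cfc_id_eq]
  rfl

theorem inner_self (η : L) : (⟪η, B η⟫_ℂ).re = ∫ l, l ∂D.ν η := by
  have h := D.inner_cfc η (fun l => l) continuous_id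
  rw [D.cfc_id_eq] at h
  rw [h, Complex.ofReal_re]

theorem real_univ (η : L) : (D.ν η).real Set.univ = ‖η‖ ^ 2 := by
  have h := D.inner_E η Set.univ MeasurableSet.univ
  rw [D.E_univ, one_apply_eq_self, inner_self_eq_norm_sq_to_K] at h
  exact Complex.ofReal_injective (by rw [← h]; push_cast; rfl)

theorem E_eq_zero {S : Set ℝ} (hS : MeasurableSet S) (h : ∀ ξ, D.ν ξ S = 0) : D.E S = 0 := by
  refine clm_ext_inner fun ξ => ?_
  rw [D.inner_E ξ S hS, Measure.real, h, zero_apply, inner_zero_right]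
  simp

theorem measure_E_apply {S : Set ℝ} (hS : MeasurableSet S) (ξ : L) :
    D.ν (D.E S ξ) = (D.ν ξ).restrict S := by
  refine Measure.ext fun T hT => ?_
  rw [Measure.restrict_apply hT]
  have h1 := D.inner_E (D.E S ξ) T hT
  have h2 := D.inner_E ξ (T ∩ S) (hT.inter hS)
  have h3 : ⟪D.E S ξ, D.E T (D.E S ξ)⟫_ℂ = ⟪ξ, D.E (T ∩ S) ξ⟫_ℂ := by
    rw [show ⟪D.E S ξ, D.E T (D.E S ξ)⟫_ℂ = ⟪ξ, D.E S (D.E T (D.E S ξ))⟫_ℂ from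
      (D.E_sa S).isSymmetric ξ _]
    congr 1
    change (D.E S * (D.E T * D.E S)) ξ = _
    rw [← D.E_inter T S hT hS, ← D.E_inter S _ hS (hT.inter hS)]
    congr 2
    ext x
    simp only [Set.mem_inter_iff]
    tauto
  rw [h1, h2] at h3
  exact (measureReal_eq_measureReal_iff).1 (by exact_mod_cast h3)

theorem ae_mem_Icc (h0 : 0 ≤ B) (h1 : B ≤ 1) (ξ : L) : ∀ᵐ b ∂D.ν ξ, b ∈ Set.Icc (0 : ℝ) 1 := by
  have h : ∀ᵐ b ∂D.ν ξ, b ∈ spectrum ℝ B := by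
    rw [ae_iff]
    exact D.supp ξ
  filter_upwards [h] with b hb
  refine ⟨spectrum_nonneg_of_nonneg h0 hb, ?_⟩
  have h2 : (1 - b : ℝ) ∈ spectrum ℝ (1 - B) := by
    have h3 := spectrum.singleton_sub_eq (R := ℝ) B 1
    rw [map_one] at h3
    exact h3 ▸ Set.sub_mem_sub rfl hb
  linarith [spectrum_nonneg_of_nonneg (sub_nonneg.2 h1) h2]

theorem measure_zero_singleton (hB : ∀ η, (⟪η, B η⟫_ℂ).re = 0 → η = 0) (ξ : L) :
    D.ν ξ {0} = 0 := by
  have hm : MeasurableSet ({0} : Set ℝ) := measurableSet_singleton 0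
  have h : D.E {0} ξ = 0 := hB _ (by
    rw [D.inner_self, D.measure_E_apply hm, Measure.restrict_singleton]
    simp)
  have h2 := D.inner_E ξ {0} hm
  rw [h, inner_zero_right, eq_comm, Complex.ofReal_eq_zero, measureReal_eq_zero_iff] at h2
  exact h2

theorem measure_one_singleton (hB : ∀ η, ‖η‖ ^ 2 ≤ (⟪η, B η⟫_ℂ).re → η = 0) (ξ : L) :
    D.ν ξ {1} = 0 := by
  have hm : MeasurableSet ({1} : Set ℝ) := measurableSet_singleton 1
  have h : D.E {1} ξ = 0 := hB _ (by
    rw [← D.real_univ, D.inner_self, D.measure_E_apply hm, Measure.restrict_singleton]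
    simp [Measure.real])
  have h2 := D.inner_E ξ {1} hm
  rw [h, inner_zero_right, eq_comm, Complex.ofReal_eq_zero, measureReal_eq_zero_iff] at h2
  exact h2

theorem ae_mem_Ioo (h0 : 0 ≤ B) (h1 : B ≤ 1) (hB0 : ∀ η, (⟪η, B η⟫_ℂ).re = 0 → η = 0)
    (hB1 : ∀ η, ‖η‖ ^ 2 ≤ (⟪η, B η⟫_ℂ).re → η = 0) (ξ : L) :
    ∀ᵐ b ∂D.ν ξ, b ∈ Set.Ioo (0 : ℝ) 1 := by
  have e0 : ∀ᵐ b ∂D.ν ξ, b ≠ 0 := by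
    rw [ae_iff]; simpa using D.measure_zero_singleton hB0 ξ
  have e1 : ∀ᵐ b ∂D.ν ξ, b ≠ 1 := by
    rw [ae_iff]; simpa using D.measure_one_singleton hB1 ξ
  filter_upwards [D.ae_mem_Icc h0 h1 ξ, e0, e1] with b hb h0 h1
  exact ⟨lt_of_le_of_ne hb.1 (Ne.symm h0), lt_of_le_of_ne hb.2 h1⟩

end SpectralData

theorem lintegral_le_of_integral_le {ν : Measure ℝ} {g : ℕ → ℝ → ℝ} {f : ℝ → ℝ} {C : ℝ}
    (hg : ∀ n, Integrable (g n) ν) (h0 : ∀ n, 0 ≤ᵐ[ν] g n) (hC : ∀ n, ∫ l, g n l ∂ν ≤ C)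
    (hlim : ∀ᵐ l ∂ν, Tendsto (fun n => g n l) atTop (𝓝 (f l))) :
    ∫⁻ l, ENNReal.ofReal (f l) ∂ν ≤ ENNReal.ofReal C := by
  calc ∫⁻ l, ENNReal.ofReal (f l) ∂ν
      = ∫⁻ l, liminf (fun n => ENNReal.ofReal (g n l)) atTop ∂ν := by
        refine lintegral_congr_ae ?_
        filter_upwards [hlim] with l hl
        exact ((ENNReal.tendsto_ofReal hl).liminf_eq).symm
    _ ≤ liminf (fun n => ∫⁻ l, ENNReal.ofReal (g n l) ∂ν) atTop :=
        lintegral_liminf_le' fun n => (hg n).aestronglyMeasurable.aemeasurable.ennreal_ofReal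
    _ ≤ ENNReal.ofReal C := by
        refine liminf_le_of_le (by isBoundedDefault) fun b hb => ?_
        obtain ⟨n, hn⟩ := hb.exists
        refine hn.trans ?_
        rw [← ofReal_integral_eq_lintegral_ofReal (hg n) (h0 n)]
        exact ENNReal.ofReal_le_ofReal (hC n)

end SpectralData

section ModularSpectrum

open MeasureTheory

attribute [local instance] InnerProductSpace.complexToReal

variable {L : Type} [NormedAddCommGroup L] [InnerProductSpace ℂ L] [CompleteSpace L]
  {𝒦 : Submodule ℝ L} [CompleteSpace 𝒦] (D : SpectralData (halfProj 𝒦))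

/-- A bounded continuous approximation of `b ↦ b⁻¹` on `(0, 1)`. -/
def invApprox (n : ℕ) (b : ℝ) : ℝ := (max b 0 + 1 / ((n : ℝ) + 1))⁻¹

theorem invApprox_den_pos (n : ℕ) (b : ℝ) : 0 < max b 0 + 1 / ((n : ℝ) + 1) :=
  add_pos_of_nonneg_of_pos (le_max_right _ _) (by positivity)

theorem continuous_invApprox (n : ℕ) : Continuous (invApprox n) := by
  unfold invApprox
  exact Continuous.inv₀ (by fun_prop) fun b => (invApprox_den_pos n b).ne'

theorem invApprox_nonneg (n : ℕ) (b : ℝ) : 0 ≤ invApprox n b :=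
  (inv_pos.2 (invApprox_den_pos n b)).le

theorem mul_invApprox_le_one (n : ℕ) {b : ℝ} (hb : 0 < b) : b * invApprox n b ≤ 1 := by
  unfold invApprox
  rw [← div_eq_mul_inv, div_le_one (invApprox_den_pos n b), max_eq_left hb.le]
  have : (0 : ℝ) < 1 / ((n : ℝ) + 1) := by positivity
  linarith

theorem invApprox_le_inv (n : ℕ) {b : ℝ} (hb : 0 < b) : invApprox n b ≤ b⁻¹ := by
  rw [← one_div, le_div_iff₀ hb, mul_comm]
  exact mul_invApprox_le_one n hb

theorem tendsto_invApprox {b : ℝ} (hb : 0 < b) :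
    Tendsto (fun n => invApprox n b) atTop (𝓝 b⁻¹) := by
  unfold invApprox
  rw [max_eq_left hb.le]
  refine Tendsto.inv₀ ?_ hb.ne'
  simpa using tendsto_const_nhds.add (tendsto_one_div_add_atTop_nhds_zero_nat (𝕜 := ℝ))

theorem integral_invApprox_le (D : SpectralData (halfProj 𝒦))
    (hD : ∀ ξ, ∀ᵐ b ∂D.ν ξ, b ∈ Set.Ioo (0 : ℝ) 1) {h k : L} (hh : h ∈ 𝒦) (hk : k ∈ 𝒦) (n : ℕ) :
    ∫ b, invApprox n b ∂D.ν (h + Complex.I • k) ≤ 2 * ‖h‖ ^ 2 + 2 * ‖k‖ ^ 2 := by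
  set η := h + Complex.I • k
  have hc := continuous_invApprox n
  have h1 := variational_le 𝒦 hh hk (cfc (invApprox n) (halfProj 𝒦) η)
  have h2 : ⟪cfc (invApprox n) (halfProj 𝒦) η, η⟫_ℝ = ∫ b, invApprox n b ∂D.ν η := by
    rw [real_inner_comm, real_inner_eq_re, D.inner_cfc η _ hc, Complex.ofReal_re]
  rw [D.apply_cfc η hc, D.inner_cfc_cfc η hc (by fun_prop), Complex.ofReal_re, h2] at h1
  have h3 : ∫ b, invApprox n b * (b * invApprox n b) ∂D.ν η ≤ ∫ b, invApprox n b ∂D.ν η := by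
    refine integral_mono_ae (D.integrable η _ (by fun_prop)) (D.integrable η _ hc) ?_
    filter_upwards [hD η] with b hb
    exact mul_le_of_le_one_right (invApprox_nonneg n b) (mul_invApprox_le_one n hb.1)
  nlinarith [sq_nonneg ‖𝒦.starProjection (cfc (invApprox n) (halfProj 𝒦) η) - (2 : ℝ) • h‖,
    sq_nonneg ‖𝒦.starProjection (Complex.I • cfc (invApprox n) (halfProj 𝒦) η) - (-2 : ℝ) • k‖]

theorem lintegral_inv_le (D : SpectralData (halfProj 𝒦))
    (hD : ∀ ξ, ∀ᵐ b ∂D.ν ξ, b ∈ Set.Ioo (0 : ℝ) 1) {h k : L} (hh : h ∈ 𝒦) (hk : k ∈ 𝒦) :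
    ∫⁻ b, ENNReal.ofReal b⁻¹ ∂D.ν (h + Complex.I • k) ≤
      ENNReal.ofReal (2 * ‖h‖ ^ 2 + 2 * ‖k‖ ^ 2) := by
  refine lintegral_le_of_integral_le (fun n => D.integrable _ _ (continuous_invApprox n))
    (fun n => ae_of_all _ (invApprox_nonneg n)) (integral_invApprox_le D hD hh hk) ?_
  filter_upwards [hD _] with b hb
  exact tendsto_invApprox hb.1

theorem integrable_inv (D : SpectralData (halfProj 𝒦))
    (hD : ∀ ξ, ∀ᵐ b ∂D.ν ξ, b ∈ Set.Ioo (0 : ℝ) 1) {h k : L} (hh : h ∈ 𝒦) (hk : k ∈ 𝒦) :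
    Integrable (fun b => b⁻¹) (D.ν (h + Complex.I • k)) := by
  refine ⟨measurable_inv.aestronglyMeasurable, ?_⟩
  rw [hasFiniteIntegral_iff_ofReal]
  · exact (lintegral_inv_le D hD hh hk).trans_lt ENNReal.ofReal_lt_top
  · filter_upwards [hD _] with b hb
    exact (inv_pos.2 hb.1).le

theorem tendsto_apply_invApprox (D : SpectralData (halfProj 𝒦))
    (hD : ∀ ξ, ∀ᵐ b ∂D.ν ξ, b ∈ Set.Ioo (0 : ℝ) 1) (η : L) :
    Tendsto (fun n => halfProj 𝒦 (cfc (invApprox n) (halfProj 𝒦) η)) atTop (𝓝 η) := by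
  rw [tendsto_iff_norm_sub_tendsto_zero]
  have h1 : ∀ n, ‖halfProj 𝒦 (cfc (invApprox n) (halfProj 𝒦) η) - η‖ ^ 2 =
      ∫ b, (b * invApprox n b - 1) * (b * invApprox n b - 1) ∂D.ν η := fun n => by
    have hc := continuous_invApprox n
    rw [← D.norm_cfc_sq η (f := fun b => b * invApprox n b - 1) (by fun_prop), D.apply_cfc η hc,
      cfc_sub (fun b => b * invApprox n b) (fun _ => 1) (halfProj 𝒦) (by fun_prop) (by fun_prop),
      cfc_const_one ℝ (halfProj 𝒦) D.sa]
    rfl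
  have h2 : Tendsto (fun n => ∫ b, (b * invApprox n b - 1) * (b * invApprox n b - 1) ∂D.ν η)
      atTop (𝓝 (∫ _, (0 : ℝ) ∂D.ν η)) := by
    refine tendsto_integral_of_dominated_convergence (fun _ => 1) (fun n => ?_)
      (integrable_const _) (fun n => ?_) ?_
    · have hc := continuous_invApprox n
      exact Continuous.aestronglyMeasurable (by fun_prop)
    · filter_upwards [hD η] with b hb
      have h3 := mul_invApprox_le_one n hb.1
      have h4 := mul_nonneg hb.1.le (invApprox_nonneg n b)
      rw [Real.norm_eq_abs, abs_le]
      constructor <;> nlinarith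
    · filter_upwards [hD η] with b hb
      have h3 := ((tendsto_invApprox hb.1).const_mul b).sub_const 1
      rw [mul_inv_cancel₀ hb.1.ne', sub_self] at h3
      simpa using h3.mul h3
  simp only [← h1, integral_zero] at h2
  have h3 := (Real.continuous_sqrt.tendsto _).comp h2
  simpa [Function.comp_def, Real.sqrt_sq (norm_nonneg _)] using h3

theorem variational_le_integral (D : SpectralData (halfProj 𝒦))
    (hD : ∀ ξ, ∀ᵐ b ∂D.ν ξ, b ∈ Set.Ioo (0 : ℝ) 1) {h k : L} (hh : h ∈ 𝒦) (hk : k ∈ 𝒦) (ξ : L) :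
    2 * ⟪ξ, h + Complex.I • k⟫_ℝ - (⟪ξ, halfProj 𝒦 ξ⟫_ℂ).re ≤
      ∫ b, b⁻¹ ∂D.ν (h + Complex.I • k) := by
  set η := h + Complex.I • k with hη
  set x : ℕ → L := fun n => cfc (invApprox n) (halfProj 𝒦) η
  have h1 : ∀ n, 2 * ⟪ξ, halfProj 𝒦 (x n)⟫_ℝ - (⟪ξ, halfProj 𝒦 ξ⟫_ℂ).re ≤ ∫ b, b⁻¹ ∂D.ν η := by
    intro n
    have hc := continuous_invApprox n
    have h2 := re_inner_nonneg_of_nonneg (halfProj_nonneg 𝒦) (ξ - x n)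
    have h3 : ⟪x n, halfProj 𝒦 ξ⟫_ℝ = ⟪ξ, halfProj 𝒦 (x n)⟫_ℝ := by
      rw [real_inner_halfProj, real_inner_halfProj, real_inner_comm (𝒦.starProjection ξ),
        real_inner_comm (𝒦.starProjection (Complex.I • ξ))]
    rw [map_sub, ← real_inner_eq_re, inner_sub_left, inner_sub_right, inner_sub_right, h3,
      real_inner_eq_re ξ (halfProj 𝒦 ξ), real_inner_eq_re (x n)] at h2
    have h4 : (⟪x n, halfProj 𝒦 (x n)⟫_ℂ).re ≤ ∫ b, b⁻¹ ∂D.ν η := by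
      rw [D.apply_cfc η hc, D.inner_cfc_cfc η hc (by fun_prop), Complex.ofReal_re]
      refine integral_mono_ae (D.integrable η _ (by fun_prop)) (integrable_inv D hD hh hk) ?_
      filter_upwards [hD η] with b hb
      exact (mul_le_of_le_one_right (invApprox_nonneg n b)
        (mul_invApprox_le_one n hb.1)).trans (invApprox_le_inv n hb.1)
    linarith
  have h5 : Tendsto (fun n => 2 * ⟪ξ, halfProj 𝒦 (x n)⟫_ℝ - (⟪ξ, halfProj 𝒦 ξ⟫_ℂ).re) atTop
      (𝓝 (2 * ⟪ξ, η⟫_ℝ - (⟪ξ, halfProj 𝒦 ξ⟫_ℂ).re)) :=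
    ((tendsto_const_nhds.inner (tendsto_apply_invApprox D hD η)).const_mul 2).sub_const _
  exact le_of_tendsto' h5 h1

theorem integral_inv_eq (D : SpectralData (halfProj 𝒦))
    (hD : ∀ ξ, ∀ᵐ b ∂D.ν ξ, b ∈ Set.Ioo (0 : ℝ) 1)
    (hi : ∀ k ∈ 𝒦, Complex.I • k ∈ 𝒦 → k = 0) {h k : L} (hh : h ∈ 𝒦)
    (hk : k ∈ 𝒦) :
    ∫ b, b⁻¹ ∂D.ν (h + Complex.I • k) = 2 * ‖h‖ ^ 2 + 2 * ‖k‖ ^ 2 := by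
  refine le_antisymm ?_ (le_of_forall_pos_le_add fun ε hε => ?_)
  · have h1 := lintegral_inv_le D hD hh hk
    rw [← ofReal_integral_eq_lintegral_ofReal (integrable_inv D hD hh hk)] at h1
    · exact (ENNReal.ofReal_le_ofReal_iff (by positivity)).1 h1
    · filter_upwards [hD _] with b hb
      exact (inv_pos.2 hb.1).le
  · obtain ⟨ξ, hξ⟩ := exists_starProjection_near 𝒦 hi (𝒦.smul_mem (2 : ℝ) hh)
      (𝒦.smul_mem (-2 : ℝ) hk) (mul_pos two_pos hε)
    have h1 := variational_le_integral D hD hh hk ξ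
    rw [variational_le 𝒦 hh hk] at h1
    linarith

/-- The modular relation `⟨Δ η, η⟩ = ‖h - ik‖²` for `η = h + ik`. -/
theorem lintegral_inv_sub_one (D : SpectralData (halfProj 𝒦))
    (hD : ∀ ξ, ∀ᵐ b ∂D.ν ξ, b ∈ Set.Ioo (0 : ℝ) 1)
    (hi : ∀ k ∈ 𝒦, Complex.I • k ∈ 𝒦 → k = 0) {h k : L} (hh : h ∈ 𝒦)
    (hk : k ∈ 𝒦) :
    ∫⁻ b, ENNReal.ofReal (b⁻¹ - 1) ∂D.ν (h + Complex.I • k) =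
      ENNReal.ofReal (‖h - Complex.I • k‖ ^ 2) := by
  have h0 := integrable_inv D hD hh hk
  have h1 : Integrable (fun b => b⁻¹ - 1) (D.ν (h + Complex.I • k)) := h0.sub (integrable_const 1)
  rw [← ofReal_integral_eq_lintegral_ofReal h1,
    integral_sub h0 (integrable_const 1), integral_inv_eq D hD hi hh hk, integral_const,
    D.real_univ]
  · congr 1
    have := norm_add_sub_I_smul h k
    simp only [smul_eq_mul, mul_one]
    linarith
  · filter_upwards [hD _] with b hb
    exact sub_nonneg.2 ((one_le_inv₀ hb.1).2 hb.2.le)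

theorem integral_le_of_defect {η : L} {c : ℝ} (hc : ∀ h ∈ 𝒦, ∀ k ∈ 𝒦,
    c ≤ ‖η - (h + Complex.I • k)‖ ^ 2 + ‖h - Complex.I • k‖ ^ 2) :
    ∫ b, b ∂D.ν η ≤ ‖η‖ ^ 2 - c := by
  obtain ⟨h, hh, k, hk, h1, h2⟩ := exists_halfProj_decomp 𝒦 η
  have h3 := hc h hh k hk
  have h4 := norm_sub_sq_real η (halfProj 𝒦 η)
  rw [real_inner_eq_re] at h4
  rw [← h1, h2, h4] at h3
  rw [← D.inner_self]
  linarith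

theorem lintegral_div_le (D : SpectralData (halfProj 𝒦))
    (hD : ∀ ξ, ∀ᵐ b ∂D.ν ξ, b ∈ Set.Ioo (0 : ℝ) 1)
    {η : L} {C : ℝ} (hC0 : 0 ≤ C) (hC : ∀ h ∈ 𝒦, ∀ k ∈ 𝒦,
    ‖⟪η, h + Complex.I • k⟫_ℂ‖ ^ 2 ≤ C * ‖h - Complex.I • k‖ ^ 2) :
    ∫⁻ b, ENNReal.ofReal (b * (1 - b)⁻¹) ∂D.ν η ≤ ENNReal.ofReal C := by
  have hc : ∀ n, Continuous fun b => invApprox n (1 - b) := fun n =>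
    (continuous_invApprox n).comp (by fun_prop)
  refine lintegral_le_of_integral_le (g := fun n b => b * invApprox n (1 - b)) (fun n => ?_)
    (fun n => ?_) (fun n => ?_) ?_
  · have := hc n
    exact D.integrable _ _ (by fun_prop)
  · filter_upwards [hD η] with b hb
    exact mul_nonneg hb.1.le (invApprox_nonneg _ _)
  · have hcn := hc n
    set f : ℝ → ℝ := fun b => invApprox n (1 - b) with hf
    set ξ := cfc f (halfProj 𝒦) η
    obtain ⟨h, hh, k, hk, h1, h2⟩ := exists_halfProj_decomp 𝒦 ξ
    have h3 := hC h hh k hk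
    have h4 : halfProj 𝒦 ξ = cfc (fun b => b * f b) (halfProj 𝒦) η := D.apply_cfc η hcn
    rw [← h1, h2, h4, D.inner_cfc η _ (by fun_prop), D.inner_cfc_cfc η hcn (by fun_prop),
      Complex.ofReal_re, D.norm_cfc_sq η (by fun_prop),
      ← integral_sub (D.integrable _ _ (by fun_prop)) (D.integrable _ _ (by fun_prop)),
      Complex.norm_real, Real.norm_eq_abs, sq_abs] at h3
    have h5 : ∫ b, (f b * (b * f b) - b * f b * (b * f b)) ∂D.ν η ≤ ∫ b, b * f b ∂D.ν η := by
      refine integral_mono_ae (D.integrable _ _ (by fun_prop)) (D.integrable _ _ (by fun_prop)) ?_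
      filter_upwards [hD η] with b hb
      have h6 := mul_invApprox_le_one n (sub_pos.2 hb.2)
      have h7 := mul_nonneg hb.1.le (invApprox_nonneg n (1 - b))
      simp only [hf]
      nlinarith
    have h6 := h3.trans (mul_le_mul_of_nonneg_left h5 hC0)
    by_contra hlt
    push Not at hlt
    nlinarith
  · filter_upwards [hD η] with b hb
    exact (tendsto_invApprox (sub_pos.2 hb.2)).const_mul b

/-- Spectral data of the modular operator attached to a closed real subspace `𝒦`. -/
structure ModularSpectrum (𝒦 : Submodule ℝ L) where
  P : Set ℝ → (L →L[ℂ] L)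
  P_sa : ∀ S, IsSelfAdjoint (P S)
  P_idem : ∀ S, P S * P S = P S
  P_inter : ∀ S T : Set ℝ, MeasurableSet S → MeasurableSet T → P (S ∩ T) = P S * P T
  P_univ : P Set.univ = 1
  P_nonpos : P (Set.Iic 0) = 0
  P_sigma : ∀ S : ℕ → Set ℝ, (∀ n, MeasurableSet (S n)) → Pairwise (Function.onFun Disjoint S) →
    ∀ ξ : L, HasSum (fun n => P (S n) ξ) (P (⋃ n, S n) ξ)
  μ : L → Measure ℝ
  μ_eq : ∀ (ξ : L) (S : Set ℝ), MeasurableSet S → μ ξ S = ENNReal.ofReal (⟪ξ, P S ξ⟫_ℂ).re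
  rel : ∀ h ∈ 𝒦, ∀ k ∈ 𝒦, ∫⁻ l, ENNReal.ofReal l ∂μ (h + Complex.I • k) =
    ENNReal.ofReal (‖h - Complex.I • k‖ ^ 2)
  res : ℝ → (L →L[ℂ] L)
  res_eq : ∀ t : ℝ, 0 < t → ∀ ξ : L, ⟪ξ, res t ξ⟫_ℂ = ((∫ l, (l + t)⁻¹ ∂μ ξ : ℝ) : ℂ)
  defect_le : ∀ (η : L) (c : ℝ), (∀ h ∈ 𝒦, ∀ k ∈ 𝒦,
    c ≤ ‖η - (h + Complex.I • k)‖ ^ 2 + ‖h - Complex.I • k‖ ^ 2) →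
    ∫⁻ l, ENNReal.ofReal (1 + l)⁻¹ ∂μ η ≤ ENNReal.ofReal (‖η‖ ^ 2 - c)
  bound_le : ∀ (η : L) (C : ℝ), 0 ≤ C → (∀ h ∈ 𝒦, ∀ k ∈ 𝒦,
    ‖⟪η, h + Complex.I • k⟫_ℂ‖ ^ 2 ≤ C * ‖h - Complex.I • k‖ ^ 2) →
    ∫⁻ l, ENNReal.ofReal l⁻¹ ∂μ η ≤ ENNReal.ofReal C

theorem measurable_inv_sub_one : Measurable fun b : ℝ => b⁻¹ - 1 :=
  measurable_inv.sub_const 1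

/-- The function of `(1 + Δ)⁻¹` which gives `(Δ + t)⁻¹`. -/
def resFun (t b : ℝ) : ℝ := max 0 (min b 1) / (1 - max 0 (min b 1) + t * max 0 (min b 1))

theorem continuous_resFun {t : ℝ} (ht : 0 < t) : Continuous (resFun t) := by
  refine Continuous.div (by fun_prop) (by fun_prop) fun b => ne_of_gt ?_
  have h1 : max 0 (min b 1) ≤ 1 := max_le zero_le_one (min_le_right _ _)
  have h0 : 0 ≤ max 0 (min b 1) := le_max_left _ _
  rcases h0.eq_or_lt with h | h
  · rw [← h]; norm_num
  · have := mul_pos ht h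
    linarith

theorem resFun_eq {t b : ℝ} (ht : 0 < t) (hb : b ∈ Set.Ioo (0 : ℝ) 1) :
    resFun t b = (b⁻¹ - 1 + t)⁻¹ := by
  unfold resFun
  rw [min_eq_left hb.2.le, max_eq_right hb.1.le]
  have h1 : 0 < 1 - b + t * b := by nlinarith [hb.1, hb.2, mul_pos ht hb.1]
  have h2 := hb.1.ne'
  rw [show b⁻¹ - 1 + t = (1 - b + t * b) / b by field_simp, inv_div]

theorem nonempty_modularSpectrum (hd : ∀ η : L, (∀ k ∈ 𝒦, ⟪η, k⟫_ℂ = 0) → η = 0)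
    (hi : ∀ k ∈ 𝒦, Complex.I • k ∈ 𝒦 → k = 0) : Nonempty (ModularSpectrum 𝒦) := by
  obtain ⟨D⟩ := nonempty_spectralData (halfProj_isSelfAdjoint 𝒦)
  have hD := D.ae_mem_Ioo (halfProj_nonneg 𝒦) (halfProj_le_one 𝒦)
    (fun _ => eq_zero_of_inner_halfProj 𝒦 hd) fun _ => eq_zero_of_inner_one_sub_halfProj 𝒦 hi
  have hm := measurable_inv_sub_one
  have hlm : ∀ (f : ℝ → ℝ) (ξ : L), Measurable f →
      ∫⁻ l, ENNReal.ofReal (f l) ∂(D.ν ξ).map (fun b => b⁻¹ - 1) =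
        ∫⁻ b, ENNReal.ofReal (f (b⁻¹ - 1)) ∂D.ν ξ := fun f ξ hf =>
    lintegral_map hf.ennreal_ofReal hm
  refine ⟨{
    P := fun S => D.E ((fun b => b⁻¹ - 1) ⁻¹' S)
    P_sa := fun S => D.E_sa _
    P_idem := fun S => D.E_idem _
    P_inter := fun S T hS hT => by rw [Set.preimage_inter, D.E_inter _ _ (hm hS) (hm hT)]
    P_univ := by rw [Set.preimage_univ, D.E_univ]
    P_nonpos := ?_
    P_sigma := fun S hS hSd ξ => ?_
    μ := fun ξ => (D.ν ξ).map (fun b => b⁻¹ - 1)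
    μ_eq := fun ξ S hS => ?_
    rel := fun h hh k hk => ?_
    res := fun t => cfc (resFun t) (halfProj 𝒦)
    res_eq := fun t ht ξ => ?_
    defect_le := fun η c hc => ?_
    bound_le := fun η C hC0 hC => ?_ }⟩
  · refine D.E_eq_zero (hm measurableSet_Iic) fun ξ => ?_
    refine measure_mono_null (t := (Set.Ioo (0 : ℝ) 1)ᶜ) (fun b hb hb' => ?_) (hD ξ)
    exact absurd (Set.mem_Iic.1 hb) (not_le.2 (sub_pos.2 ((one_lt_inv₀ hb'.1).2 hb'.2)))
  · rw [Set.preimage_iUnion]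
    exact D.E_sigma _ (fun n => hm (hS n)) (fun i j hij => (hSd hij).preimage _) ξ
  · rw [Measure.map_apply hm hS, D.inner_E ξ _ (hm hS), Complex.ofReal_re, ofReal_measureReal]
  · rw [hlm (fun l => l) _ measurable_id]
    exact lintegral_inv_sub_one D hD hi hh hk
  · rw [D.inner_cfc ξ _ (continuous_resFun ht), integral_map hm.aemeasurable]
    · congr 1
      refine integral_congr_ae ?_
      filter_upwards [hD ξ] with b hb
      exact resFun_eq ht hb
    · exact ((measurable_id.add_const t).inv).aestronglyMeasurable
  · rw [hlm (fun l => (1 + l)⁻¹) _ (measurable_id.const_add 1).inv]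
    have h1 : ∫⁻ b, ENNReal.ofReal (1 + (b⁻¹ - 1))⁻¹ ∂D.ν η = ∫⁻ b, ENNReal.ofReal b ∂D.ν η := by
      refine lintegral_congr fun b => ?_
      rw [add_sub_cancel, inv_inv]
    rw [h1, ← ofReal_integral_eq_lintegral_ofReal (D.integrable η (fun b => b) continuous_id)]
    · exact ENNReal.ofReal_le_ofReal (integral_le_of_defect D hc)
    · filter_upwards [hD η] with b hb
      exact hb.1.le
  · rw [hlm (fun l => l⁻¹) _ measurable_inv]
    refine le_trans (le_of_eq ?_) (lintegral_div_le D hD hC0 hC)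
    refine lintegral_congr_ae ?_
    filter_upwards [hD η] with b hb
    have h1 := hb.1.ne'
    have h2 := (sub_pos.2 hb.2).ne'
    congr 1
    rw [show b⁻¹ - 1 = (1 - b) / b by field_simp, inv_div, div_eq_mul_inv]

end ModularSpectrum

section OrbitSpace

variable {K : Type} [NormedAddCommGroup K] [InnerProductSpace ℂ K] [CompleteSpace K]

/-- The orbit map `T ↦ T Ω`. -/
def orbitMap (A : VonNeumannAlgebra K) (Ω : Amp K) : A →ₗ[ℂ] Amp K where
  toFun T := amp (T : K →L[ℂ] K) Ω
  map_add' S T := by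
    change amp ((S : K →L[ℂ] K) + (T : K →L[ℂ] K)) Ω = _
    rw [amp_add]; rfl
  map_smul' c T := by
    change amp (c • (T : K →L[ℂ] K)) Ω = _
    rw [amp_smul]; rfl

/-- The GNS space of the vector functional `Ω` on `𝒜`, realized as the closure of `𝒜 Ω`. -/
def orbitSpace (A : VonNeumannAlgebra K) (Ω : Amp K) : Submodule ℂ (Amp K) :=
  (LinearMap.range (orbitMap A Ω)).topologicalClosure

instance (A : VonNeumannAlgebra K) (Ω : Amp K) : CompleteSpace (orbitSpace A Ω) :=
  Submodule.topologicalClosure.completeSpace _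

variable {A : VonNeumannAlgebra K} {Ω : Amp K}

theorem amp_mem_orbitSpace_of_mem (T : A) {v : Amp K} (hv : v ∈ orbitSpace A Ω) :
    amp (T : K →L[ℂ] K) v ∈ orbitSpace A Ω := by
  refine map_mem_closure (amp (T : K →L[ℂ] K)).continuous hv ?_
  rintro _ ⟨S, rfl⟩
  exact ⟨T * S, amp_mul_apply _ _ _⟩

theorem orbitMap_mem (T : A) : orbitMap A Ω T ∈ orbitSpace A Ω :=
  subset_closure ⟨T, rfl⟩

theorem mem_orbitSpace : Ω ∈ orbitSpace A Ω := by
  have := orbitMap_mem (Ω := Ω) (1 : A)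
  change amp (1 : K →L[ℂ] K) Ω ∈ _ at this
  rwa [amp_one] at this

/-- The representation of `𝒜` on the closure of `𝒜 Ω`. -/
def orbitRep (A : VonNeumannAlgebra K) (Ω : Amp K) : Rep A (orbitSpace A Ω) where
  ρ T := ((amp (T : K →L[ℂ] K)).comp (orbitSpace A Ω).subtypeL).codRestrict _
    fun v => amp_mem_orbitSpace_of_mem T v.2
  map_add S T := by
    ext v : 2
    change amp ((S : K →L[ℂ] K) + (T : K →L[ℂ] K)) v = _
    rw [amp_add]; rfl
  map_smul c T := by
    ext v : 2
    change amp (c • (T : K →L[ℂ] K)) v = _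
    rw [amp_smul]; rfl
  map_mul S T := by
    ext v : 2
    exact amp_mul_apply _ _ _
  map_one := by
    ext v : 2
    change amp (1 : K →L[ℂ] K) v = _
    rw [amp_one]; rfl
  map_star T := by
    rw [ContinuousLinearMap.eq_adjoint_iff]
    intro v w
    exact inner_amp_star (T : K →L[ℂ] K) (v : Amp K) (w : Amp K)
  normal ξ := ⟨fun k => (ξ : Amp K) k, (hasSum_norm_sq (ξ : Amp K)).summable, fun T =>
    hasSum_wv (ξ : Amp K) (T : K →L[ℂ] K)⟩

/-- The cyclic vector of the orbit representation. -/
def orbitVec (A : VonNeumannAlgebra K) (Ω : Amp K) : orbitSpace A Ω := ⟨Ω, mem_orbitSpace⟩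

/-- The orbit map, into the orbit space. -/
def orbitMap' (A : VonNeumannAlgebra K) (Ω : Amp K) : A →ₗ[ℂ] orbitSpace A Ω :=
  (orbitMap A Ω).codRestrict _ orbitMap_mem

theorem orbitMap'_apply (T : A) : orbitMap' A Ω T = (orbitRep A Ω).ρ T (orbitVec A Ω) := rfl

theorem denseRange_orbitMap' : DenseRange (orbitMap' A Ω) := by
  intro v
  rw [Topology.IsInducing.subtypeVal.closure_eq_preimage_closure_image]
  refine closure_mono ?_ v.2
  rintro _ ⟨T, rfl⟩
  exact ⟨_, ⟨T, rfl⟩, rfl⟩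

theorem orbit_cyclic : Dense (↑(Submodule.span ℂ
    (Set.range fun T : A => (orbitRep A Ω).ρ T (orbitVec A Ω))) : Set (orbitSpace A Ω)) :=
  denseRange_orbitMap'.mono Submodule.subset_span

theorem exists_sa_decomp (T : A) : ∃ h k : A, star h = h ∧ star k = k ∧
    T = h + Complex.I • k ∧ star T = h - Complex.I • k := by
  have e : ∀ x : A, (1 / 2 : ℂ) • x + (1 / 2 : ℂ) • x = x := fun x => by
    rw [← add_smul]; norm_num
  have e2 : Complex.I * (-Complex.I / 2) = 1 / 2 := by
    linear_combination (-1 / 2 : ℂ) * Complex.I_mul_I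
  refine ⟨(1 / 2 : ℂ) • (T + star T), (-Complex.I / 2) • (T - star T), ?_, ?_, ?_, ?_⟩
  · rw [star_smul_vn, star_add, star_star, add_comm]
    simp
  · rw [star_smul_vn, star_sub, star_star]
    simp only [star_div₀, star_neg, RCLike.star_def, Complex.conj_I, map_ofNat, neg_neg]
    rw [neg_div, neg_smul, ← smul_neg, neg_sub]
  · rw [smul_smul, e2]
    nth_rewrite 1 [← e T]
    rw [smul_add, smul_sub]
    abel
  · rw [smul_smul, e2]
    nth_rewrite 1 [← e (star T)]
    rw [smul_add, smul_sub]
    abel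

variable (A Ω) in
/-- The real subspace `{h Ω : h = h*}`. -/
def saCore : Submodule ℝ (orbitSpace A Ω) where
  carrier := {v | ∃ h : A, star h = h ∧ orbitMap' A Ω h = v}
  add_mem' := by
    rintro _ _ ⟨h, hh, rfl⟩ ⟨k, hk, rfl⟩
    exact ⟨h + k, by rw [star_add, hh, hk], map_add _ _ _⟩
  zero_mem' := ⟨0, star_zero _, map_zero _⟩
  smul_mem' := by
    rintro c _ ⟨h, hh, rfl⟩
    refine ⟨(c : ℂ) • h, by rw [star_smul_vn, hh]; simp, ?_⟩
    rw [map_smul]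
    exact Subtype.ext (Complex.coe_smul c _)

variable (A Ω) in
/-- The closed real subspace generated by `{h Ω : h = h*}`. -/
def saSpace : Submodule ℝ (orbitSpace A Ω) := (saCore A Ω).topologicalClosure

instance : CompleteSpace (saSpace A Ω) := Submodule.topologicalClosure.completeSpace _

theorem orbitMap'_mem_saSpace {h : A} (hh : star h = h) : orbitMap' A Ω h ∈ saSpace A Ω :=
  subset_closure ⟨h, hh, rfl⟩

theorem eq_zero_of_inner_saSpace {η : orbitSpace A Ω} (h : ∀ k ∈ saSpace A Ω, ⟪η, k⟫_ℂ = 0) :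
    η = 0 := by
  have h1 : ∀ v : orbitSpace A Ω, ⟪η, v⟫_ℂ = 0 := fun v => by
    refine denseRange_orbitMap'.induction_on v
      (isClosed_eq (by fun_prop) continuous_const) fun T => ?_
    obtain ⟨a, b, ha, hb, hT, -⟩ := exists_sa_decomp T
    have h2 : ⟪η, Complex.I • orbitMap' A Ω b⟫_ℂ = 0 := by
      refine (inner_smul_right (𝕜 := ℂ) η (orbitMap' A Ω b) Complex.I).trans ?_
      rw [h _ (orbitMap'_mem_saSpace hb), mul_zero]
    rw [hT, map_add, map_smul, inner_add_right, h2, h _ (orbitMap'_mem_saSpace ha), add_zero]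
  exact inner_self_eq_zero.1 (h1 η)

theorem forall_saSpace {q : orbitSpace A Ω → orbitSpace A Ω → Prop}
    (hq : IsClosed {x : orbitSpace A Ω × orbitSpace A Ω | q x.1 x.2})
    (h : ∀ T : A, q (orbitMap' A Ω T) (orbitMap' A Ω (star T))) :
    ∀ u ∈ saSpace A Ω, ∀ v ∈ saSpace A Ω, q (u + Complex.I • v) (u - Complex.I • v) := by
  intro u hu v hv
  have hcl : IsClosed {x : orbitSpace A Ω × orbitSpace A Ω |
      q (x.1 + Complex.I • x.2) (x.1 - Complex.I • x.2)} :=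
    hq.preimage (f := fun x : orbitSpace A Ω × orbitSpace A Ω =>
      (x.1 + Complex.I • x.2, x.1 - Complex.I • x.2)) (by fun_prop)
  have hmem : (u, v) ∈ closure ((saCore A Ω : Set (orbitSpace A Ω)) ×ˢ
      (saCore A Ω : Set (orbitSpace A Ω))) := by
    rw [closure_prod_eq]
    exact ⟨hu, hv⟩
  refine hcl.closure_subset_iff.2 ?_ hmem
  rintro ⟨_, _⟩ ⟨⟨a, ha, rfl⟩, ⟨b, hb, rfl⟩⟩
  have h1 := h (a + Complex.I • b)
  rw [star_add, star_smul_vn, ha, hb, map_add, map_add, map_smul, map_smul, RCLike.star_def,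
    Complex.conj_I, neg_smul, ← sub_eq_add_neg] at h1
  exact h1

theorem mem_commutant_comm {R : K →L[ℂ] K} (hR : R ∈ A.commutant) (T : A) (v : K) :
    (T : K →L[ℂ] K) (R v) = R ((T : K →L[ℂ] K) v) :=
  congrArg (fun S : K →L[ℂ] K => S v) (VonNeumannAlgebra.mem_commutant_iff.1 hR T T.2)

theorem saSpace_inner_commutant {R : K →L[ℂ] K} (hR : R ∈ A.commutant) (j m : ℕ)
    {κ : orbitSpace A Ω} (hκ : κ ∈ saSpace A Ω) :
    ⟪(κ : Amp K) j, R (Ω m)⟫_ℂ = ⟪star R (Ω j), (κ : Amp K) m⟫_ℂ := by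
  have hev : ∀ i : ℕ, Continuous fun κ : orbitSpace A Ω => (κ : Amp K) i := fun i =>
    (lp.evalCLM ℂ (fun _ : ℕ => K) 2 i).continuous.comp continuous_subtype_val
  have hcl : IsClosed {κ : orbitSpace A Ω |
      ⟪(κ : Amp K) j, R (Ω m)⟫_ℂ = ⟪star R (Ω j), (κ : Amp K) m⟫_ℂ} :=
    isClosed_eq ((hev j).inner continuous_const) (continuous_const.inner (hev m))
  refine hcl.closure_subset_iff.2 ?_ hκ
  rintro _ ⟨h, hh, rfl⟩
  change ⟪(h : K →L[ℂ] K) (Ω j), R (Ω m)⟫_ℂ = ⟪star R (Ω j), (h : K →L[ℂ] K) (Ω m)⟫_ℂ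
  have h1 : IsSelfAdjoint (h : K →L[ℂ] K) := congrArg Subtype.val hh
  rw [ContinuousLinearMap.star_eq_adjoint, ContinuousLinearMap.adjoint_inner_left,
    ← mem_commutant_comm hR]
  exact h1.isSymmetric _ _

theorem inner_commutant_eq_zero {κ : orbitSpace A Ω} (h1 : κ ∈ saSpace A Ω)
    (h2 : Complex.I • κ ∈ saSpace A Ω) {R : K →L[ℂ] K} (hR : R ∈ A.commutant) (j m : ℕ) :
    ⟪(κ : Amp K) j, R (Ω m)⟫_ℂ = 0 := by
  have e1 := saSpace_inner_commutant hR j m h1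
  have e2 := saSpace_inner_commutant hR j m h2
  change ⟪Complex.I • (κ : Amp K) j, R (Ω m)⟫_ℂ =
    ⟪star R (Ω j), Complex.I • (κ : Amp K) m⟫_ℂ at e2
  rw [inner_smul_left, inner_smul_right, ← e1, Complex.conj_I] at e2
  have : (2 * Complex.I) * ⟪(κ : Amp K) j, R (Ω m)⟫_ℂ = 0 := by linear_combination -e2
  simpa using this

theorem eq_zero_of_inner_commutant (hsep : SepVec A Ω) {v : K}
    (hv : ∀ R ∈ A.commutant, ∀ m : ℕ, ⟪v, R (Ω m)⟫_ℂ = 0) : v = 0 := by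
  set W := (Submodule.span ℂ {w : K | ∃ R ∈ A.commutant, ∃ m : ℕ, R (Ω m) = w}).topologicalClosure
  have hW : CompleteSpace W := Submodule.topologicalClosure.completeSpace _
  have hinv : ∀ S ∈ A.commutant, ∀ w ∈ W, S w ∈ W := fun S hS w hw => by
    refine map_mem_closure S.continuous hw fun x hx => ?_
    refine Submodule.span_induction (p := fun x _ => S x ∈ Submodule.span ℂ
      {w : K | ∃ R ∈ A.commutant, ∃ m : ℕ, R (Ω m) = w}) ?_ ?_ ?_ ?_ hx
    · rintro _ ⟨R, hR, m, rfl⟩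
      exact Submodule.subset_span ⟨S * R, mul_mem hS hR, m, rfl⟩
    · rw [map_zero]; exact zero_mem _
    · intro x y _ _ hx hy
      rw [map_add]; exact add_mem hx hy
    · intro c x _ hx
      rw [map_smul]; exact Submodule.smul_mem _ c hx
  have hp : W.starProjection ∈ A := by
    rw [VonNeumannAlgebra.IsStarProjection.mem_iff isStarProjection_starProjection]
    intro S hS
    rw [Submodule.range_starProjection]
    exact hinv S hS
  have h1 : (1 : K →L[ℂ] K) - W.starProjection = 0 := by
    refine hsep _ (sub_mem (one_mem _) hp) ?_
    ext m
    change Ω m - W.starProjection (Ω m) = 0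
    rw [sub_eq_zero, eq_comm, Submodule.starProjection_eq_self_iff]
    exact subset_closure (Submodule.subset_span ⟨1, one_mem _, m, rfl⟩)
  have h2 : v ∈ W := by
    rw [← Submodule.starProjection_eq_self_iff, ← sub_eq_zero.1 h1]
    rfl
  have hcl : IsClosed {w : K | ⟪v, w⟫_ℂ = 0} := isClosed_eq (by fun_prop) continuous_const
  refine inner_self_eq_zero.1 (hcl.closure_subset_iff.2 (fun x hx => ?_) h2)
  refine Submodule.span_induction (p := fun x _ => ⟪v, x⟫_ℂ = 0) ?_ ?_ ?_ ?_ hx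
  · rintro _ ⟨R, hR, m, rfl⟩
    exact hv R hR m
  · exact inner_zero_right _
  · intro x y _ _ hx hy
    rw [inner_add_right, hx, hy, add_zero]
  · intro c x _ hx
    rw [inner_smul_right, hx, mul_zero]

theorem eq_zero_of_I_smul_mem_saSpace (hsep : SepVec A Ω) {κ : orbitSpace A Ω}
    (h1 : κ ∈ saSpace A Ω) (h2 : Complex.I • κ ∈ saSpace A Ω) : κ = 0 := by
  refine Subtype.ext (lp.ext (funext fun j => ?_))
  exact eq_zero_of_inner_commutant hsep fun R hR m => inner_commutant_eq_zero h1 h2 hR j m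

theorem exists_modularSpectrum (hsep : SepVec A Ω) : Nonempty (ModularSpectrum (saSpace A Ω)) :=
  nonempty_modularSpectrum (fun _ => eq_zero_of_inner_saSpace)
    fun _ => eq_zero_of_I_smul_mem_saSpace hsep

end OrbitSpace

section ModularDataConstruction

variable {H : Type} [NormedAddCommGroup H] [InnerProductSpace ℂ H] [CompleteSpace H]
  {K : Type} [NormedAddCommGroup K] [InnerProductSpace ℂ K] [CompleteSpace K]
  {L2M : Type} [NormedAddCommGroup L2M] [InnerProductSpace ℂ L2M] [CompleteSpace L2M]
  {M : VonNeumannAlgebra H} {A : VonNeumannAlgebra K} {τ : M →ₗ[ℂ] ℂ} {inc : Inclusion M A}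

/-- The map `x ↦ x̂` from `M` to `L²(M)`. -/
def GNSRep.map (gns : GNSRep M τ L2M) : M →ₗ[ℂ] L2M where
  toFun x := gns.rep.ρ x gns.Ω
  map_add' x y := by rw [gns.rep.map_add]; rfl
  map_smul' c x := by rw [gns.rep.map_smul]; rfl

theorem GNSRep.denseRange_map (gns : GNSRep M τ L2M) : DenseRange gns.map := by
  have h := gns.cyclic
  have e : (Set.range fun x : M => gns.rep.ρ x gns.Ω) = (LinearMap.range gns.map : Set L2M) := rfl
  rwa [e, Submodule.span_eq] at h

theorem Rep₀.inner_star_mul {L : Type} [NormedAddCommGroup L] [InnerProductSpace ℂ L]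
    [CompleteSpace L] (r : Rep₀ M L) (x y : M) (v w : L) :
    ⟪v, r.ρ (star x * y) w⟫_ℂ = ⟪r.ρ x v, r.ρ y w⟫_ℂ := by
  rw [r.map_mul, r.map_star, ← ContinuousLinearMap.adjoint_inner_right]
  rfl

theorem Rep₀.norm_sq {L : Type} [NormedAddCommGroup L] [InnerProductSpace ℂ L]
    [CompleteSpace L] (r : Rep₀ M L) (x : M) (v : L) :
    ⟪v, r.ρ (star x * x) v⟫_ℂ = ((‖r.ρ x v‖ ^ 2 : ℝ) : ℂ) := by
  rw [r.inner_star_mul, inner_self_eq_norm_sq_to_K]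
  push_cast
  rfl

theorem GNSRep.trace_star_mul_self (gns : GNSRep M τ L2M) (x : M) :
    τ (star x * x) = ((‖gns.rep.ρ x gns.Ω‖ ^ 2 : ℝ) : ℂ) := by
  rw [gns.repr, gns.rep.norm_sq]

theorem HypVec.norm_orbitMap' (gns : GNSRep M τ L2M) {Ω : Amp K} (hΩ : HypVec τ inc Ω) (x : M) :
    ‖orbitMap' A Ω (inc.π x)‖ = ‖gns.map x‖ := by
  have h1 : ((‖amp (inc.hom x) Ω‖ ^ 2 : ℝ) : ℂ) = ((‖gns.map x‖ ^ 2 : ℝ) : ℂ) := by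
    rw [← wv_star_mul_self, ← inc.hom_star, ← inc.hom_mul, hΩ]
    exact gns.trace_star_mul_self x
  have h2 := Complex.ofReal_injective h1
  exact (pow_left_inj₀ (norm_nonneg _) (norm_nonneg _) two_ne_zero).1 h2

theorem HypVec.norm_eq_one {Ω : Amp K} (hΩ : HypVec τ inc Ω) (hτ : τ 1 = 1) : ‖Ω‖ = 1 := by
  have h1 := hΩ 1
  rw [inc.hom_one, wv_one, hτ, ← Complex.ofReal_one] at h1
  have h2 := Complex.ofReal_injective h1
  nlinarith [norm_nonneg Ω]

theorem exists_embedding (gns : GNSRep M τ L2M) {Ω : Amp K} (hΩ : HypVec τ inc Ω) :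
    ∃ J : L2M →ₗᵢ[ℂ] orbitSpace A Ω, ∀ x : M, J (gns.map x) = orbitMap' A Ω (inc.π x) := by
  let f : M →ₗ[ℂ] orbitSpace A Ω := (orbitMap' A Ω).comp inc.π
  have hn : ∀ x, ‖f x‖ = ‖gns.map x‖ := fun x => hΩ.norm_orbitMap' gns x
  let F : L2M →L[ℂ] orbitSpace A Ω := f.extendOfNorm gns.map
  have hF : ∀ x, F (gns.map x) = f x :=
    LinearMap.extendOfNorm_eq gns.denseRange_map ⟨1, fun x => by rw [hn, one_mul]⟩
  refine ⟨⟨F.toLinearMap, fun v => ?_⟩, hF⟩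
  refine gns.denseRange_map.induction_on (p := fun v => ‖F v‖ = ‖v‖) v
    (isClosed_eq (by fun_prop) (by fun_prop)) fun x => ?_
  rw [hF, hn]

theorem exists_modularData (gns : GNSRep M τ L2M) {Ω : Amp K} (hΩ : HypVec τ inc Ω)
    (hsep : SepVec A Ω) (hτ : τ 1 = 1) :
    ∃ md : ModularData τ inc gns (vf A Ω),
      (∀ (x : M) (c : ℝ), (∀ T ∈ A, c ≤ (wv Ω (defect (inc.hom x) T)).re) →
        ∫⁻ l, ENNReal.ofReal (1 + l)⁻¹ ∂md.μ (md.emb (gns.rep.ρ x gns.Ω)) ≤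
          ENNReal.ofReal (‖gns.rep.ρ x gns.Ω‖ ^ 2 - c)) ∧
      ∀ (v : L2M) (C : ℝ), 0 ≤ C →
        (∀ T : A, ‖md.rep.ρ T (md.emb v)‖ ^ 2 ≤ C * ‖md.rep.ρ T md.Ω‖ ^ 2) →
        ∫⁻ l, ENNReal.ofReal l⁻¹ ∂md.μ (md.emb v) ≤ ENNReal.ofReal C := by
  obtain ⟨S⟩ := exists_modularSpectrum hsep
  obtain ⟨J, hJ⟩ := exists_embedding gns hΩ
  have hJΩ : J gns.Ω = orbitVec A Ω := by
    have := hJ 1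
    rw [inc.map_one, orbitMap'_apply, (orbitRep A Ω).map_one] at this
    have e : gns.map 1 = gns.Ω := by
      change gns.rep.ρ 1 gns.Ω = _
      rw [gns.rep.map_one]; rfl
    rw [e] at this
    exact this
  have hJe : ∀ (x : M) (v : L2M), J (gns.rep.ρ x v) = (orbitRep A Ω).ρ (inc.π x) (J v) := by
    intro x v
    refine gns.denseRange_map.induction_on
      (p := fun v => J (gns.rep.ρ x v) = (orbitRep A Ω).ρ (inc.π x) (J v)) v
      (isClosed_eq (J.continuous.comp (gns.rep.ρ x).continuous)
        (((orbitRep A Ω).ρ (inc.π x)).continuous.comp J.continuous)) fun y => ?_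
    have e : gns.rep.ρ x (gns.map y) = gns.map (x * y) := by
      change _ = gns.rep.ρ (x * y) gns.Ω
      rw [gns.rep.map_mul]; rfl
    rw [e, hJ, hJ, inc.map_mul, orbitMap'_apply, (orbitRep A Ω).map_mul]
    rfl
  have hΩ1 : ‖Ω‖ = 1 := hΩ.norm_eq_one hτ
  let md : ModularData τ inc gns (vf A Ω) :=
    { L := orbitSpace A Ω
      rep := orbitRep A Ω
      Ω := orbitVec A Ω
      cyclic := orbit_cyclic
      state_eq := fun T => rfl
      emb := J
      emb_Ω := hJΩ
      emb_equiv := hJe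
      P := S.P
      P_sa := S.P_sa
      P_idem := S.P_idem
      P_inter := S.P_inter
      P_univ := S.P_univ
      P_nonpos := S.P_nonpos
      P_sigma := S.P_sigma
      μ := S.μ
      μ_eq := S.μ_eq
      modular_rel := fun T => by
        obtain ⟨h, k, hh, hk, hT, hT'⟩ := exists_sa_decomp T
        rw [← orbitMap'_apply, ← orbitMap'_apply, hT', hT, map_add, map_sub, map_smul]
        exact S.rel _ (orbitMap'_mem_saSpace hh) _ (orbitMap'_mem_saSpace hk)
      res := S.res
      res_eq := S.res_eq }
  refine ⟨md, fun x c hc => ?_, fun v C hC h => ?_⟩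
  · have e : J (gns.rep.ρ x gns.Ω) = orbitMap' A Ω (inc.π x) := hJ x
    have e2 : ‖gns.rep.ρ x gns.Ω‖ = ‖orbitMap' A Ω (inc.π x)‖ := (hΩ.norm_orbitMap' gns x).symm
    change ∫⁻ l, ENNReal.ofReal (1 + l)⁻¹ ∂S.μ (J (gns.rep.ρ x gns.Ω)) ≤ _
    rw [e, e2]
    refine S.defect_le _ _ (forall_saSpace (q := fun u w =>
      c ≤ ‖orbitMap' A Ω (inc.π x) - u‖ ^ 2 + ‖w‖ ^ 2)
      (isClosed_le (by fun_prop) (by fun_prop)) fun T => ?_)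
    have h1 := hc T T.2
    rw [wv_defect, Complex.ofReal_re, amp_sub] at h1
    exact h1
  · refine S.bound_le _ _ hC (forall_saSpace (q := fun u w => ‖⟪J v, u⟫_ℂ‖ ^ 2 ≤ C * ‖w‖ ^ 2)
      (isClosed_le (by fun_prop) (by fun_prop)) fun T => ?_)
    refine le_trans ?_ (h (star T))
    have e : ⟪J v, orbitMap' A Ω T⟫_ℂ = ⟪(orbitRep A Ω).ρ (star T) (J v), orbitVec A Ω⟫_ℂ := by
      rw [orbitMap'_apply, (orbitRep A Ω).map_star, ContinuousLinearMap.adjoint_inner_left]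
    have e3 : ‖orbitVec A Ω‖ = 1 := hΩ1
    refine (congrArg (fun c : ℂ => ‖c‖ ^ 2) e).le.trans ?_
    refine pow_le_pow_left₀ (norm_nonneg _) ?_ 2
    refine (norm_inner_le_norm (𝕜 := ℂ) ((orbitRep A Ω).ρ (star T) (J v)) (orbitVec A Ω)).trans ?_
    exact (congrArg _ e3).le.trans (mul_one _).le

end ModularDataConstruction

section EntropyEstimate

open MeasureTheory

theorem neg_log_le_sq_add {l s : ℝ} (hl : 0 < l) (hs : 0 < s) :
    -Real.log l ≤ 4 * s * ((l - 1) ^ 2 / (4 * (l + 1))) + s⁻¹ * l⁻¹ := by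
  set r := √l with hr
  have hr0 : 0 < r := Real.sqrt_pos.2 hl
  have hrl : r ^ 2 = l := Real.sq_sqrt hl.le
  have h1 : -Real.log l ≤ 2 * (r⁻¹ - 1) := by
    have := Real.log_le_sub_one_of_pos (inv_pos.2 hr0)
    rw [Real.log_inv] at this
    rw [← hrl, Real.log_pow]
    push_cast
    linarith
  have h2 : 2 * (r⁻¹ - 1) ≤ s * (1 - r) ^ 2 + s⁻¹ * l⁻¹ := by
    have h := sq_nonneg (s * (1 - r) - r⁻¹)
    have e : 2 * (r⁻¹ - 1) = 2 * ((1 - r) * r⁻¹) := by field_simp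
    have e2 : s * (1 - r) ^ 2 + s⁻¹ * l⁻¹ - 2 * ((1 - r) * r⁻¹) =
        s⁻¹ * (s * (1 - r) - r⁻¹) ^ 2 := by
      rw [← hrl]; field_simp; ring
    have h3 : 0 ≤ s⁻¹ * (s * (1 - r) - r⁻¹) ^ 2 := by positivity
    linarith
  have h3 : (1 - r) ^ 2 ≤ 4 * ((l - 1) ^ 2 / (4 * (l + 1))) := by
    have e : 4 * ((l - 1) ^ 2 / (4 * (l + 1))) = (l - 1) ^ 2 / (l + 1) := by
      field_simp
    rw [e, le_div_iff₀ (by positivity), ← hrl]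
    nlinarith [mul_nonneg (sq_nonneg (1 - r)) hr0.le]
  have h4 : s * (1 - r) ^ 2 ≤ s * (4 * ((l - 1) ^ 2 / (4 * (l + 1)))) :=
    mul_le_mul_of_nonneg_left h3 hs.le
  linarith

theorem neg_log_le_log_add {l a : ℝ} (hl : 0 < l) (ha : 0 < a) :
    -Real.log l ≤ Real.log (2 / a) + a / 2 * l⁻¹ := by
  have h := Real.log_le_sub_one_of_pos (x := a / 2 * l⁻¹) (by positivity)
  rw [Real.log_mul (by positivity) (by positivity), Real.log_inv,
    Real.log_div ha.ne' two_ne_zero] at h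
  rw [Real.log_div two_ne_zero ha.ne']
  linarith

theorem ae_pos_of_Iic {ν : Measure ℝ} (h : ν (Set.Iic 0) = 0) : ∀ᵐ l ∂ν, 0 < l := by
  rw [ae_iff]
  simp only [not_lt]
  exact h

/-- The positive part of `-log` is controlled by a bound on `∫ l⁻¹`. -/
theorem mul_lintegral_neg_log_le {κ : Measure ℝ} {a : ℝ} (ha : 0 ≤ a) (ha1 : a ≤ 1)
    (h0 : κ (Set.Iic 0) = 0) (h1 : κ Set.univ = 1)
    (hb : 0 < a → ∫⁻ l, ENNReal.ofReal l⁻¹ ∂κ ≤ ENNReal.ofReal (2 / a)) :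
    ENNReal.ofReal a * ∫⁻ l, ENNReal.ofReal (-Real.log l) ∂κ ≤
      ENNReal.ofReal (a * Real.log 2 - a * Real.log a + a) := by
  rcases ha.eq_or_lt with rfl | ha'
  · simp
  have hlog : 0 ≤ Real.log (2 / a) :=
    Real.log_nonneg (by rw [le_div_iff₀ ha']; linarith)
  have h2 : ∫⁻ l, ENNReal.ofReal (-Real.log l) ∂κ ≤ ENNReal.ofReal (Real.log (2 / a) + 1) := by
    calc ∫⁻ l, ENNReal.ofReal (-Real.log l) ∂κ
        ≤ ∫⁻ l, (ENNReal.ofReal (Real.log (2 / a)) +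
            ENNReal.ofReal (a / 2) * ENNReal.ofReal l⁻¹) ∂κ := by
          refine lintegral_mono_ae ((ae_pos_of_Iic h0).mono fun l hl => ?_)
          rw [← ENNReal.ofReal_mul (by positivity), ← ENNReal.ofReal_add hlog (by positivity)]
          exact ENNReal.ofReal_le_ofReal (neg_log_le_log_add hl ha')
      _ = ENNReal.ofReal (Real.log (2 / a)) +
            ENNReal.ofReal (a / 2) * ∫⁻ l, ENNReal.ofReal l⁻¹ ∂κ := by
          rw [lintegral_add_left measurable_const, lintegral_const, h1, mul_one,
            lintegral_const_mul _ (by fun_prop)]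
      _ ≤ ENNReal.ofReal (Real.log (2 / a)) +
            ENNReal.ofReal (a / 2) * ENNReal.ofReal (2 / a) := by gcongr; exact hb ha'
      _ = ENNReal.ofReal (Real.log (2 / a) + 1) := by
          rw [← ENNReal.ofReal_mul (by positivity), ← ENNReal.ofReal_add hlog (by positivity)]
          congr 2
          field_simp
  calc ENNReal.ofReal a * ∫⁻ l, ENNReal.ofReal (-Real.log l) ∂κ
      ≤ ENNReal.ofReal a * ENNReal.ofReal (Real.log (2 / a) + 1) := by gcongr
    _ = ENNReal.ofReal (a * Real.log 2 - a * Real.log a + a) := by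
        rw [← ENNReal.ofReal_mul ha, Real.log_div two_ne_zero ha'.ne']
        congr 1; ring

theorem mul_lintegral_neg_log_le_of_defect {κ : Measure ℝ} {a s : ℝ} (ha : 0 ≤ a) (hs : 0 < s)
    (h0 : κ (Set.Iic 0) = 0)
    (hb : 0 < a → ∫⁻ l, ENNReal.ofReal l⁻¹ ∂κ ≤ ENNReal.ofReal (2 / a)) {β : ℝ≥0∞}
    (hβ : ENNReal.ofReal a * ∫⁻ l, ENNReal.ofReal ((l - 1) ^ 2 / (4 * (l + 1))) ∂κ ≤ β) :
    ENNReal.ofReal a * ∫⁻ l, ENNReal.ofReal (-Real.log l) ∂κ ≤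
      ENNReal.ofReal (4 * s) * β + ENNReal.ofReal (2 / s) := by
  rcases ha.eq_or_lt with rfl | ha'
  · simp
  have h2 : ∫⁻ l, ENNReal.ofReal (-Real.log l) ∂κ ≤
      ENNReal.ofReal (4 * s) * ∫⁻ l, ENNReal.ofReal ((l - 1) ^ 2 / (4 * (l + 1))) ∂κ +
        ENNReal.ofReal s⁻¹ * ENNReal.ofReal (2 / a) := by
    calc ∫⁻ l, ENNReal.ofReal (-Real.log l) ∂κ
        ≤ ∫⁻ l, (ENNReal.ofReal (4 * s) * ENNReal.ofReal ((l - 1) ^ 2 / (4 * (l + 1))) +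
            ENNReal.ofReal s⁻¹ * ENNReal.ofReal l⁻¹) ∂κ := by
          refine lintegral_mono_ae ((ae_pos_of_Iic h0).mono fun l hl => ?_)
          rw [← ENNReal.ofReal_mul (by positivity), ← ENNReal.ofReal_mul (by positivity),
            ← ENNReal.ofReal_add (by positivity) (by positivity)]
          exact ENNReal.ofReal_le_ofReal (neg_log_le_sq_add hl hs)
      _ = ENNReal.ofReal (4 * s) * ∫⁻ l, ENNReal.ofReal ((l - 1) ^ 2 / (4 * (l + 1))) ∂κ +
            ENNReal.ofReal s⁻¹ * ∫⁻ l, ENNReal.ofReal l⁻¹ ∂κ := by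
          rw [lintegral_add_left (by fun_prop), lintegral_const_mul _ (by fun_prop),
            lintegral_const_mul _ (by fun_prop)]
      _ ≤ _ := by gcongr; exact hb ha'
  calc ENNReal.ofReal a * ∫⁻ l, ENNReal.ofReal (-Real.log l) ∂κ
      ≤ ENNReal.ofReal a * (ENNReal.ofReal (4 * s) *
          ∫⁻ l, ENNReal.ofReal ((l - 1) ^ 2 / (4 * (l + 1))) ∂κ +
        ENNReal.ofReal s⁻¹ * ENNReal.ofReal (2 / a)) := by gcongr
    _ = ENNReal.ofReal (4 * s) * (ENNReal.ofReal a *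
          ∫⁻ l, ENNReal.ofReal ((l - 1) ^ 2 / (4 * (l + 1))) ∂κ) + ENNReal.ofReal (2 / s) := by
        rw [mul_add, mul_left_comm, ← ENNReal.ofReal_mul (by positivity),
          ← ENNReal.ofReal_mul ha]
        congr 2
        field_simp
    _ ≤ _ := by gcongr

theorem lintegral_sq_div_le {ν : Measure ℝ} {c d : ℝ} (hc : 0 ≤ c) (hd : 0 ≤ d)
    (h0 : ν (Set.Iic 0) = 0) (h1 : ν Set.univ = ENNReal.ofReal c)
    (hl : ∫⁻ l, ENNReal.ofReal l ∂ν = ENNReal.ofReal c)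
    (hb : ∫⁻ l, ENNReal.ofReal (1 + l)⁻¹ ∂ν ≤ ENNReal.ofReal (c / 2 + d)) :
    ∫⁻ l, ENNReal.ofReal ((l - 1) ^ 2 / (4 * (l + 1))) ∂ν ≤ ENNReal.ofReal d := by
  have e : ∫⁻ l, ENNReal.ofReal ((l - 1) ^ 2 / (4 * (l + 1))) ∂ν + ENNReal.ofReal (3 / 4 * c) =
      ∫⁻ l, ENNReal.ofReal (1 + l)⁻¹ ∂ν + ENNReal.ofReal (1 / 4 * c) := by
    rw [ENNReal.ofReal_mul (by norm_num), ENNReal.ofReal_mul (by norm_num)]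
    nth_rewrite 1 [← h1]
    rw [← hl, ← lintegral_const, ← lintegral_const_mul _ (by fun_prop),
      ← lintegral_add_right _ (by fun_prop), ← lintegral_add_right _ (by fun_prop)]
    refine lintegral_congr_ae ((ae_pos_of_Iic h0).mono fun l hl => ?_)
    simp only
    rw [← ENNReal.ofReal_mul (by norm_num), ← ENNReal.ofReal_add (by positivity) (by positivity),
      ← ENNReal.ofReal_add (by positivity) (by positivity)]
    congr 1
    field_simp
    ring
  have h2 : ∫⁻ l, ENNReal.ofReal ((l - 1) ^ 2 / (4 * (l + 1))) ∂ν + ENNReal.ofReal (3 / 4 * c) ≤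
      ENNReal.ofReal d + ENNReal.ofReal (3 / 4 * c) := by
    rw [e, ← ENNReal.ofReal_add hd (by positivity)]
    refine (add_le_add_left hb _).trans ?_
    rw [← ENNReal.ofReal_add (by positivity) (by positivity)]
    exact ENNReal.ofReal_le_ofReal (by linarith)
  exact (ENNReal.add_le_add_iff_right ENNReal.ofReal_ne_top).1 h2

theorem lintegral_one_add_inv_le {ν : Measure ℝ} (h0 : ν (Set.Iic 0) = 0) :
    ∫⁻ l, ENNReal.ofReal (1 + l)⁻¹ ∂ν ≤ ν Set.univ := by
  rw [← lintegral_one]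
  refine lintegral_mono_ae ((ae_pos_of_Iic h0).mono fun l hl => ?_)
  rw [← ENNReal.ofReal_one]
  exact ENNReal.ofReal_le_ofReal (inv_le_one_of_one_le₀ (by linarith))

theorem neg_integral_log_nonneg {ν : Measure ℝ} {c : ℝ} (hc : 0 ≤ c)
    (h0 : ν (Set.Iic 0) = 0) (h1 : ν Set.univ = ENNReal.ofReal c)
    (hl : ∫⁻ l, ENNReal.ofReal l ∂ν = ENNReal.ofReal c) : 0 ≤ -∫ l, Real.log l ∂ν := by
  by_cases hi : Integrable Real.log ν
  swap
  · rw [integral_undef hi, neg_zero]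
  have hfin : IsFiniteMeasure ν := ⟨by rw [h1]; exact ENNReal.ofReal_lt_top⟩
  have hpos := ae_pos_of_Iic h0
  have hli : Integrable (fun l : ℝ => l) ν := by
    refine ⟨by fun_prop, ?_⟩
    rw [hasFiniteIntegral_iff_ofReal (hpos.mono fun _ h => h.le), hl]
    exact ENNReal.ofReal_lt_top
  have e1 : ∫ l, l ∂ν = c := by
    rw [integral_eq_lintegral_of_nonneg_ae (hpos.mono fun _ h => h.le) (by fun_prop), hl,
      ENNReal.toReal_ofReal hc]
  have e2 : ∫ l, (l - 1) ∂ν = 0 := by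
    rw [integral_sub hli (integrable_const _), e1, integral_const, measureReal_def, h1,
      ENNReal.toReal_ofReal hc]
    simp
  have := integral_mono_ae hi (hli.sub (integrable_const 1))
    (hpos.mono fun l hl => Real.log_le_sub_one_of_pos hl)
  simp only [Pi.sub_apply] at this
  linarith

theorem ofReal_neg_integral_log_le {ν : Measure ℝ} :
    ENNReal.ofReal (-∫ l, Real.log l ∂ν) ≤ ∫⁻ l, ENNReal.ofReal (-Real.log l) ∂ν := by
  rw [← integral_neg]
  by_cases hi : Integrable (fun l => -Real.log l) ν
  swap
  · rw [integral_undef hi, ENNReal.ofReal_zero]; exact zero_le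
  rw [integral_eq_lintegral_pos_part_sub_lintegral_neg_part hi]
  refine (ENNReal.ofReal_le_ofReal (sub_le_self _ ENNReal.toReal_nonneg)).trans ?_
  exact ENNReal.ofReal_toReal_le

theorem exists_forall_lintegral_neg_log_le {a c : ℕ → ℝ} (ha0 : ∀ k, 0 ≤ a k)
    (ha1 : ∀ k, a k ≤ 1) (hsa : Summable a) (hfin : Summable fun k => a k * Real.log (a k))
    (hc0 : ∀ n, 0 ≤ c n) (hsc : Summable c) {δ : ℝ} (hδ : 0 < δ) :
    ∃ N : ℕ, ∃ ε : ℝ, 0 < ε ∧ ∀ ν κ : ℕ → Measure ℝ,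
      (∀ n, ν n (Set.Iic 0) = 0) → (∀ n, ν n Set.univ = ENNReal.ofReal (c n)) →
      (∀ n, ∫⁻ l, ENNReal.ofReal l ∂ν n = ENNReal.ofReal (c n)) →
      (∀ k, κ k (Set.Iic 0) = 0) → (∀ k, κ k Set.univ = 1) →
      (∀ k, 0 < a k → ∫⁻ l, ENNReal.ofReal l⁻¹ ∂κ k ≤ ENNReal.ofReal (2 / a k)) →
      Measure.sum ν = Measure.sum (fun k => ENNReal.ofReal (a k) • κ k) →
      (∀ n < N, ∫⁻ l, ENNReal.ofReal (1 + l)⁻¹ ∂ν n ≤ ENNReal.ofReal (c n / 2 + ε)) →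
      ∑' n, ∫⁻ l, ENNReal.ofReal (-Real.log l) ∂ν n ≤ ENNReal.ofReal δ := by
  set b : ℕ → ℝ := fun k => a k * Real.log 2 - a k * Real.log (a k) + a k with hb
  have hb0 : ∀ k, 0 ≤ b k := fun k => by
    have h1 : a k * Real.log (a k) ≤ 0 :=
      mul_nonpos_of_nonneg_of_nonpos (ha0 k) (Real.log_nonpos (ha0 k) (ha1 k))
    have h2 : 0 ≤ a k * Real.log 2 := mul_nonneg (ha0 k) (Real.log_nonneg one_le_two)
    have h3 := ha0 k
    change 0 ≤ a k * Real.log 2 - a k * Real.log (a k) + a k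
    linarith
  have hsb : Summable b := ((hsa.mul_right _).sub hfin).add hsa
  have htail : ∀ f : ℕ → ℝ, ∀ r : ℝ, 0 < r → ∃ k₀, ∑' k, f (k + k₀) < r := fun f r hr =>
    ((tendsto_sum_nat_add f).eventually_lt_const hr).exists
  obtain ⟨k₀, hk₀⟩ := htail b (δ / 3) (by positivity)
  set s : ℝ := 6 * (k₀ + 1) / δ with hs
  have hs0 : 0 < s := by positivity
  set β : ℝ := δ / (12 * s * (k₀ + 1)) with hβ
  have hβ0 : 0 < β := by positivity
  obtain ⟨N, hN⟩ := htail c (β / 2) (by positivity)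
  refine ⟨N, β / (2 * (N + 1)), by positivity, fun ν κ hν0 hν1 hνl hκ0 hκ1 hκb hex hdef => ?_⟩
  have hexch : ∀ f : ℝ → ℝ≥0∞, ∑' n, ∫⁻ l, f l ∂ν n =
      ∑' k, ENNReal.ofReal (a k) * ∫⁻ l, f l ∂κ k := fun f => by
    rw [← lintegral_sum_measure, hex, lintegral_sum_measure]
    simp only [lintegral_smul_measure, smul_eq_mul]
  have hρN : ∑' n, ∫⁻ l, ENNReal.ofReal ((l - 1) ^ 2 / (4 * (l + 1))) ∂ν n ≤
      ENNReal.ofReal β := by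
    rw [← ENNReal.summable.sum_add_tsum_nat_add' (k := N)]
    have h1 : ∑ n ∈ Finset.range N, ∫⁻ l, ENNReal.ofReal ((l - 1) ^ 2 / (4 * (l + 1))) ∂ν n ≤
        ENNReal.ofReal (β / 2) := by
      calc _ ≤ ∑ n ∈ Finset.range N, ENNReal.ofReal (β / (2 * (N + 1))) :=
            Finset.sum_le_sum fun n hn => lintegral_sq_div_le (hc0 n) (by positivity) (hν0 n)
              (hν1 n) (hνl n) (hdef n (Finset.mem_range.1 hn))
        _ = ENNReal.ofReal (N * (β / (2 * (N + 1)))) := by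
            rw [Finset.sum_const, Finset.card_range, nsmul_eq_mul,
              ENNReal.ofReal_mul (Nat.cast_nonneg N), ENNReal.ofReal_natCast]
        _ ≤ ENNReal.ofReal (β / 2) := by
            refine ENNReal.ofReal_le_ofReal ?_
            rw [mul_div_assoc', div_le_div_iff₀ (by positivity) two_pos]
            nlinarith
    have h2 : ∑' n, ∫⁻ l, ENNReal.ofReal ((l - 1) ^ 2 / (4 * (l + 1))) ∂ν (n + N) ≤
        ENNReal.ofReal (β / 2) := by
      calc _ ≤ ∑' n, ENNReal.ofReal (c (n + N)) := ENNReal.tsum_le_tsum fun n => by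
            refine (lintegral_sq_div_le (d := c (n + N) / 2) (hc0 _) (by linarith [hc0 (n + N)])
              (hν0 _) (hν1 _) (hνl _) ?_).trans
              (ENNReal.ofReal_le_ofReal (by linarith [hc0 (n + N)]))
            rw [add_halves, ← hν1]
            exact lintegral_one_add_inv_le (hν0 _)
        _ = ENNReal.ofReal (∑' n, c (n + N)) :=
            (ENNReal.ofReal_tsum_of_nonneg (fun n => hc0 _) ((summable_nat_add_iff N).2 hsc)).symm
        _ ≤ _ := ENNReal.ofReal_le_ofReal hN.le
    calc _ ≤ ENNReal.ofReal (β / 2) + ENNReal.ofReal (β / 2) := add_le_add h1 h2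
      _ = ENNReal.ofReal β := by
          rw [← ENNReal.ofReal_add (by positivity) (by positivity), add_halves]
  rw [hexch, ← ENNReal.summable.sum_add_tsum_nat_add' (k := k₀)]
  have h1 : ∑ k ∈ Finset.range k₀, ENNReal.ofReal (a k) *
      ∫⁻ l, ENNReal.ofReal (-Real.log l) ∂κ k ≤ ENNReal.ofReal (2 * δ / 3) := by
    calc _ ≤ ∑ k ∈ Finset.range k₀,
          (ENNReal.ofReal (4 * s) * ENNReal.ofReal β + ENNReal.ofReal (2 / s)) :=
          Finset.sum_le_sum fun k _ => mul_lintegral_neg_log_le_of_defect (ha0 k) hs0 (hκ0 k)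
            (hκb k) (((ENNReal.le_tsum k).trans (hexch _).ge).trans hρN)
      _ = ENNReal.ofReal (k₀ * (4 * s * β + 2 / s)) := by
          rw [Finset.sum_const, Finset.card_range, nsmul_eq_mul,
            ENNReal.ofReal_mul (Nat.cast_nonneg k₀), ENNReal.ofReal_natCast,
            ENNReal.ofReal_add (by positivity) (by positivity),
            ENNReal.ofReal_mul (p := 4 * s) (by positivity)]
      _ ≤ _ := by
          refine ENNReal.ofReal_le_ofReal ?_
          have e1 : 4 * s * β = δ / 3 / (k₀ + 1) := by rw [hβ]; field_simp; norm_num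
          have e2 : 2 / s = δ / 3 / (k₀ + 1) := by rw [hs]; field_simp; norm_num
          rw [e1, e2, ← two_mul, ← mul_div_assoc, ← mul_div_assoc, div_le_iff₀ (by positivity)]
          nlinarith
  have h2 : ∑' k, ENNReal.ofReal (a (k + k₀)) *
      ∫⁻ l, ENNReal.ofReal (-Real.log l) ∂κ (k + k₀) ≤ ENNReal.ofReal (δ / 3) := by
    calc _ ≤ ∑' k, ENNReal.ofReal (b (k + k₀)) := ENNReal.tsum_le_tsum fun k =>
          mul_lintegral_neg_log_le (ha0 _) (ha1 _) (hκ0 _) (hκ1 _) (hκb _)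
      _ = ENNReal.ofReal (∑' k, b (k + k₀)) :=
          (ENNReal.ofReal_tsum_of_nonneg (fun n => hb0 _) ((summable_nat_add_iff k₀).2 hsb)).symm
      _ ≤ _ := ENNReal.ofReal_le_ofReal hk₀.le
  calc _ ≤ ENNReal.ofReal (2 * δ / 3) + ENNReal.ofReal (δ / 3) := add_le_add h1 h2
    _ = ENNReal.ofReal δ := by
        rw [← ENNReal.ofReal_add (by positivity) (by positivity)]
        congr 1; ring

theorem neg_tsum_integral_log_mem_Icc {ν : ℕ → Measure ℝ} {c : ℕ → ℝ} (hc0 : ∀ n, 0 ≤ c n)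
    (hν0 : ∀ n, ν n (Set.Iic 0) = 0) (hν1 : ∀ n, ν n Set.univ = ENNReal.ofReal (c n))
    (hνl : ∀ n, ∫⁻ l, ENNReal.ofReal l ∂ν n = ENNReal.ofReal (c n)) {δ : ℝ} (hδ : 0 ≤ δ)
    (h : ∑' n, ∫⁻ l, ENNReal.ofReal (-Real.log l) ∂ν n ≤ ENNReal.ofReal δ) :
    -∑' n, ∫ l, Real.log l ∂ν n ∈ Set.Icc 0 δ := by
  have h0 : ∀ n, 0 ≤ -∫ l, Real.log l ∂ν n := fun n =>
    neg_integral_log_nonneg (hc0 n) (hν0 n) (hν1 n) (hνl n)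
  rw [← tsum_neg]
  refine ⟨tsum_nonneg h0, ?_⟩
  by_cases hs : Summable fun n => -∫ l, Real.log l ∂ν n
  swap
  · rwa [tsum_eq_zero_of_not_summable hs]
  rw [← ENNReal.ofReal_le_ofReal_iff hδ, ENNReal.ofReal_tsum_of_nonneg h0 hs]
  exact (ENNReal.tsum_le_tsum fun n => ofReal_neg_integral_log_le).trans h

end EntropyEstimate

section TraceExchange

variable {E : Type} [NormedAddCommGroup E] [InnerProductSpace ℂ E] [CompleteSpace E]
  {F : Type} [NormedAddCommGroup F] [InnerProductSpace ℂ F] [CompleteSpace F]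

theorem tsum_ofReal_of_hasSum {ι : Type*} {f : ι → ℝ} {s : ℝ} (h0 : ∀ i, 0 ≤ f i)
    (h : HasSum f s) : ∑' i, ENNReal.ofReal (f i) = ENNReal.ofReal s := by
  rw [← ENNReal.ofReal_tsum_of_nonneg h0 h.summable, h.tsum_eq]

theorem inner_mul_inner_swap_eq (x y : E) : ⟪x, y⟫_ℂ * ⟪y, x⟫_ℂ = ((‖⟪x, y⟫_ℂ‖ ^ 2 : ℝ) : ℂ) := by
  rw [← inner_conj_symm y x, Complex.mul_conj, Complex.normSq_eq_norm_sq]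

/-- Parseval's identity. -/
theorem tsum_ofReal_norm_inner_sq {ι : Type*} (b : HilbertBasis ι ℂ F) (x : F) :
    ∑' i, ENNReal.ofReal (‖⟪b i, x⟫_ℂ‖ ^ 2) = ENNReal.ofReal (‖x‖ ^ 2) := by
  refine tsum_ofReal_of_hasSum (fun _ => sq_nonneg _) ?_
  have h := b.hasSum_inner_mul_inner x x
  simp only [inner_mul_inner_swap_eq] at h
  have e : ⟪x, x⟫_ℂ = ((‖x‖ ^ 2 : ℝ) : ℂ) := by
    rw [inner_self_eq_norm_sq_to_K]; push_cast; rfl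
  rw [e, Complex.hasSum_ofReal] at h
  simpa only [norm_inner_symm] using h

/-- Two decompositions of a normal positive functional have the same trace against `S* S`. -/
theorem tsum_norm_sq_exchange {φ : (E →L[ℂ] E) →ₗ[ℂ] ℂ} {v : ℕ → E}
    (hv : ∀ T : E →L[ℂ] E, HasSum (fun n => ⟪v n, T (v n)⟫_ℂ) (φ T)) {Aop : E →L[ℂ] E}
    (hAop : ∀ ξ η : E, φ ((innerSL ℂ η).smulRight ξ) = ⟪η, Aop ξ⟫_ℂ) {e : ℕ → E} {a : ℕ → ℝ}
    (ha0 : ∀ k, 0 ≤ a k)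
    (hspec : ∀ ξ : E, HasSum (fun k => ((a k : ℂ) * ⟪e k, ξ⟫_ℂ) • e k) (Aop ξ))
    (S : E →L[ℂ] F) :
    ∑' n, ENNReal.ofReal (‖S (v n)‖ ^ 2) =
      ∑' k, ENNReal.ofReal (a k) * ENNReal.ofReal (‖S (e k)‖ ^ 2) := by
  have h1 : ∀ w : E, ∑' n, ENNReal.ofReal (‖⟪w, v n⟫_ℂ‖ ^ 2) =
      ∑' k, ENNReal.ofReal (a k) * ENNReal.ofReal (‖⟪w, e k⟫_ℂ‖ ^ 2) := fun w => by
    have h2 : HasSum (fun n => ((‖⟪w, v n⟫_ℂ‖ ^ 2 : ℝ) : ℂ)) ⟪w, Aop w⟫_ℂ := by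
      rw [← hAop]
      refine (congrArg (HasSum · _) (funext fun n => ?_)).mpr (hv ((innerSL ℂ w).smulRight w))
      rw [← inner_mul_inner_swap_eq, ContinuousLinearMap.smulRight_apply, inner_smul_right]
      rfl
    have h3 : HasSum (fun k => ((a k * ‖⟪w, e k⟫_ℂ‖ ^ 2 : ℝ) : ℂ)) ⟪w, Aop w⟫_ℂ := by
      have := (innerSL ℂ w).hasSum (hspec w)
      refine (congrArg (HasSum · _) (funext fun k => ?_)).mpr this
      rw [Complex.ofReal_mul, ← inner_mul_inner_swap_eq]
      change _ = ⟪w, ((a k : ℂ) * ⟪e k, w⟫_ℂ) • e k⟫_ℂ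
      rw [inner_smul_right]
      ring
    have h4 := Complex.reCLM.hasSum h2
    have h5 := Complex.reCLM.hasSum h3
    rw [tsum_ofReal_of_hasSum (fun _ => sq_nonneg _) h4,
      ← tsum_ofReal_of_hasSum (fun k => mul_nonneg (ha0 k) (sq_nonneg _)) h5]
    exact tsum_congr fun k => ENNReal.ofReal_mul (ha0 k)
  obtain ⟨w, b, -⟩ := exists_hilbertBasis ℂ F
  have h2 : ∀ x : E, ENNReal.ofReal (‖S x‖ ^ 2) =
      ∑' i, ENNReal.ofReal (‖⟪ContinuousLinearMap.adjoint S (b i), x⟫_ℂ‖ ^ 2) := fun x => by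
    simp only [ContinuousLinearMap.adjoint_inner_left]
    exact (tsum_ofReal_norm_inner_sq b (S x)).symm
  simp only [h2]
  rw [ENNReal.tsum_comm]
  simp only [h1, ← ENNReal.tsum_mul_left]
  rw [ENNReal.tsum_comm]

end TraceExchange

section VanishingEntropy

open MeasureTheory

variable {H : Type} [NormedAddCommGroup H] [InnerProductSpace ℂ H] [CompleteSpace H]
  {K : Type} [NormedAddCommGroup K] [InnerProductSpace ℂ K] [CompleteSpace K]
  {L2M : Type} [NormedAddCommGroup L2M] [InnerProductSpace ℂ L2M] [CompleteSpace L2M]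
  {M : VonNeumannAlgebra H} {A : VonNeumannAlgebra K} {τ : M →ₗ[ℂ] ℂ} {inc : Inclusion M A}
  {gns : GNSRep M τ L2M}

section Measure

variable {ζ : A →ₗ[ℂ] ℂ} (md : ModularData τ inc gns ζ)

theorem ModularData.μ_apply (ξ : md.L) {S : Set ℝ} (hS : MeasurableSet S) :
    md.μ ξ S = ENNReal.ofReal (‖md.P S ξ‖ ^ 2) := by
  have h : ⟪ξ, md.P S ξ⟫_ℂ = ⟪md.P S ξ, md.P S ξ⟫_ℂ := by
    nth_rewrite 1 [← md.P_idem S]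
    exact ((md.P_sa S).isSymmetric ξ (md.P S ξ)).symm
  rw [md.μ_eq ξ S hS, h, inner_self_eq_norm_sq_to_K]
  congr 1
  norm_cast

theorem ModularData.μ_univ (ξ : md.L) : md.μ ξ Set.univ = ENNReal.ofReal (‖ξ‖ ^ 2) := by
  rw [md.μ_apply ξ MeasurableSet.univ, md.P_univ]
  rfl

theorem ModularData.μ_Iic (ξ : md.L) : md.μ ξ (Set.Iic 0) = 0 := by
  rw [md.μ_apply ξ measurableSet_Iic, md.P_nonpos]
  simp

theorem ModularData.sum_μ_eq {v e : ℕ → L2M} {a : ℕ → ℝ}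
    (h : ∀ S : L2M →L[ℂ] md.L, ∑' n, ENNReal.ofReal (‖S (v n)‖ ^ 2) =
      ∑' k, ENNReal.ofReal (a k) * ENNReal.ofReal (‖S (e k)‖ ^ 2)) :
    Measure.sum (fun n => md.μ (md.emb (v n))) =
      Measure.sum (fun k => ENNReal.ofReal (a k) • md.μ (md.emb (e k))) := by
  refine Measure.ext fun s hs => ?_
  rw [Measure.sum_apply _ hs, Measure.sum_apply _ hs]
  simp only [Measure.smul_apply, smul_eq_mul, md.μ_apply _ hs]
  exact h ((md.P s).comp md.emb.toContinuousLinearMap)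

theorem ModularData.emb_hat (x : M) : md.emb (gns.rep.ρ x gns.Ω) = md.rep.ρ (inc.π x) md.Ω := by
  rw [md.emb_equiv, md.emb_Ω]

theorem GNSRep.norm_star (hτ : IsTracialOn M τ) (x : M) :
    ‖gns.rep.ρ (star x) gns.Ω‖ ^ 2 = ‖gns.rep.ρ x gns.Ω‖ ^ 2 := by
  have h1 := gns.trace_star_mul_self (star x)
  rw [hτ, star_star, gns.trace_star_mul_self] at h1
  exact (Complex.ofReal_injective h1).symm

theorem ModularData.lintegral_hat (hτ : IsTracialOn M τ) (x : M) :
    ∫⁻ l, ENNReal.ofReal l ∂md.μ (md.emb (gns.rep.ρ x gns.Ω)) =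
      ENNReal.ofReal (‖gns.rep.ρ x gns.Ω‖ ^ 2) := by
  rw [md.emb_hat, md.modular_rel, ← inc.map_star, ← md.emb_hat, md.emb.norm_map,
    GNSRep.norm_star hτ]

end Measure

theorem GoodVec.tsum_norm_sq_le {z : ℕ → M} {Ω : Amp K} (h : GoodVec τ inc z Ω)
    (md : ModularData τ inc gns (vf A Ω)) (T : A) :
    ∑' n, ENNReal.ofReal (‖md.rep.ρ T (md.emb (stdVecs gns z n))‖ ^ 2) ≤
      ENNReal.ofReal (2 * ‖md.rep.ρ T md.Ω‖ ^ 2) := by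
  have e : ∀ S : A, (‖md.rep.ρ S md.Ω‖ ^ 2 : ℝ) = ‖amp (S : K →L[ℂ] K) Ω‖ ^ 2 := fun S => by
    have h1 := md.state_eq (star S * S)
    rw [md.rep.norm_sq] at h1
    exact Complex.ofReal_injective (h1.symm.trans (wv_star_mul_self Ω (S : K →L[ℂ] K)))
  have e2 : ∀ Ω' : Amp K, (wv Ω' (star (T : K →L[ℂ] K) * T)).re =
      ‖amp (T : K →L[ℂ] K) Ω'‖ ^ 2 := fun Ω' => by
    rw [wv_star_mul_self, Complex.ofReal_re]
  have e3 : ∀ n, ‖md.rep.ρ T (md.emb (stdVecs gns z n))‖ ^ 2 =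
      ‖amp (T : K →L[ℂ] K) (amp (inc.hom (star (z n))) Ω)‖ ^ 2 := fun n => by
    have h1 : md.rep.ρ T (md.emb (stdVecs gns z n)) = md.rep.ρ (T * inc.π (star (z n))) md.Ω := by
      rw [stdVecs, md.emb_hat, md.rep.map_mul]; rfl
    rw [h1, e, ← amp_mul_apply]
    rfl
  refine ENNReal.tsum_le_of_sum_range_le fun N => ?_
  rw [← ENNReal.ofReal_sum_of_nonneg fun _ _ => sq_nonneg _]
  refine ENNReal.ofReal_le_ofReal ?_
  have h1 := h.sum_le N (star_mul_self_nonneg (T : K →L[ℂ] K))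
  simp only [e2] at h1
  simp only [e3, e]
  exact h1

theorem exists_modularData_fEntropy_mem_Icc [TopologicalSpace.SeparableSpace K]
    (hM : IsII1Factor M τ) {ψ : A →ₗ[ℂ] ℂ} (hψ : IsHypertrace τ inc ψ)
    {φ : (L2M →L[ℂ] L2M) →ₗ[ℂ] ℂ} {z : ℕ → M} (hφh : IsHyperstateB τ gns φ)
    (hstd : IsStdFormOf τ gns φ z) (hreg : IsRegularSeq z) {Aop : L2M →L[ℂ] L2M}
    (hAop : ∀ ξ η : L2M, φ ((innerSL ℂ η).smulRight ξ) = ⟪η, Aop ξ⟫_ℂ)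
    {evec : ℕ → L2M} {a : ℕ → ℝ} (hON : Orthonormal ℂ evec) (ha0 : ∀ k, 0 ≤ a k)
    (hspec : ∀ ξ : L2M, HasSum (fun k => ((a k : ℂ) * ⟪evec k, ξ⟫_ℂ) • evec k) (Aop ξ))
    (hfin : Summable fun k => a k * Real.log (a k)) {δ : ℝ} (hδ : 0 < δ) :
    ∃ (ζ : A →ₗ[ℂ] ℂ) (md : ModularData τ inc gns ζ),
      (IsHyperstate τ inc ζ ∧ IsNormalOn A ζ ∧ IsFaithfulOn A ζ) ∧
        fEntropy md (stdVecs gns z) ∈ Set.Icc 0 δ := by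
  set v := stdVecs gns z with hv
  set c : ℕ → ℝ := fun n => ‖v n‖ ^ 2 with hc
  have hc0 : ∀ n, 0 ≤ c n := fun n => sq_nonneg _
  have hcs : HasSum c 1 := by
    have h1 := hstd.2 1
    rw [hφh.1.1] at h1
    have h2 := Complex.reCLM.hasSum h1
    refine (congrArg (HasSum · _) (funext fun n => ?_)).mpr h2
    change _ = (⟪v n, v n⟫_ℂ).re
    rw [inner_self_eq_norm_sq_to_K]
    norm_cast
  have hexch : ∀ {F : Type} [NormedAddCommGroup F] [InnerProductSpace ℂ F] [CompleteSpace F]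
      (S : L2M →L[ℂ] F), ∑' n, ENNReal.ofReal (‖S (v n)‖ ^ 2) =
        ∑' k, ENNReal.ofReal (a k) * ENNReal.ofReal (‖S (evec k)‖ ^ 2) := fun S =>
    tsum_norm_sq_exchange hstd.2 hAop ha0 hspec S
  have hasum : ∑' k, ENNReal.ofReal (a k) = 1 := by
    have h1 := hexch (ContinuousLinearMap.id ℂ L2M)
    simp only [ContinuousLinearMap.id_apply, hON.1, one_pow, ENNReal.ofReal_one, mul_one] at h1
    rw [← h1, tsum_ofReal_of_hasSum hc0 hcs, ENNReal.ofReal_one]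
  have hsa : Summable a := by
    have h1 := ENNReal.summable_toReal (f := fun k => ENNReal.ofReal (a k))
      (by rw [hasum]; exact ENNReal.one_ne_top)
    simpa only [ENNReal.toReal_ofReal (ha0 _)] using h1
  have ha1 : ∀ k, a k ≤ 1 := fun k => by
    rw [← ENNReal.ofReal_le_one, ← hasum]
    exact ENNReal.le_tsum k
  obtain ⟨N, ε, hε, hmain⟩ :=
    exists_forall_lintegral_neg_log_le ha0 ha1 hsa hfin hc0 hcs.summable hδ
  obtain ⟨Ω, hΩ, hdef⟩ := exists_goodVec_le_defect hM hψ hreg N hε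
  obtain ⟨md, hmd1, hmd2⟩ := exists_modularData gns hΩ.hyp hΩ.sep hM.state.1
  have hν1 : ∀ n, md.μ (md.emb (v n)) Set.univ = ENNReal.ofReal (c n) := fun n => by
    rw [md.μ_univ, md.emb.norm_map]
  have hνl : ∀ n, ∫⁻ l, ENNReal.ofReal l ∂md.μ (md.emb (v n)) = ENNReal.ofReal (c n) := fun n =>
    md.lintegral_hat hM.tracial _
  refine ⟨vf A Ω, md, ⟨⟨isStateOn_vf (hΩ.hyp.norm_eq_one hM.state.1), hΩ.hyp⟩, isNormalOn_vf Ω, fun x hx => ?_⟩, ?_⟩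
  · refine Subtype.ext (hΩ.sep x x.2 ?_)
    have h1 : ((‖amp (x : K →L[ℂ] K) Ω‖ ^ 2 : ℝ) : ℂ) = 0 :=
      (wv_star_mul_self Ω (x : K →L[ℂ] K)).symm.trans hx
    simpa using h1
  · refine neg_tsum_integral_log_mem_Icc hc0 (fun n => md.μ_Iic _) hν1 hνl hδ.le
      (hmain _ (fun k => md.μ (md.emb (evec k))) (fun n => md.μ_Iic _) hν1 hνl
        (fun k => md.μ_Iic _) (fun k => ?_) (fun k hk => ?_) (md.sum_μ_eq fun S => hexch S)
        fun n hn => ?_)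
    · rw [md.μ_univ, md.emb.norm_map, hON.1]
      simp
    · refine hmd2 _ _ (by positivity) fun T => ?_
      have h1 : ENNReal.ofReal (a k * ‖md.rep.ρ T (md.emb (evec k))‖ ^ 2) ≤
          ENNReal.ofReal (2 * ‖md.rep.ρ T md.Ω‖ ^ 2) := by
        rw [ENNReal.ofReal_mul (ha0 k)]
        refine le_trans ?_ (hΩ.tsum_norm_sq_le md T)
        refine le_trans ?_ (hexch ((md.rep.ρ T).comp md.emb.toContinuousLinearMap)).ge
        exact ENNReal.le_tsum (f := fun k => ENNReal.ofReal (a k) *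
          ENNReal.ofReal (‖md.rep.ρ T (md.emb (evec k))‖ ^ 2)) k
      rw [ENNReal.ofReal_le_ofReal_iff (by positivity)] at h1
      rw [div_mul_eq_mul_div, le_div_iff₀ hk]
      linarith
    · refine (hmd1 (star (z n)) (c n / 2 - ε) fun T hT => ?_).trans
        (ENNReal.ofReal_le_ofReal ?_)
      · refine le_trans (le_of_eq ?_) (hdef n hn T hT)
        have h1 := gns.trace_star_mul_self (star (z n))
        rw [star_star] at h1
        rw [h1, Complex.ofReal_re]
        rfl
      · change c n - (c n / 2 - ε) ≤ _
        linarith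

end VanishingEntropy

end Paper

namespace Paper

/-- Let `(M,τ)` be a separable `II₁` factor and `M ⊆ 𝒜` a (separable)
inclusion admitting an `(M,τ)`-hypertrace but no normal conditional expectation onto `M`.
Then `M ⊆ 𝒜` admits vanishing Furstenberg entropy: for every normal regular strongly
generating hyperstate `φ` on `B(L²(M))` of finite entropy `H(φ) < ∞`, there is a net of
normal faithful hyperstates `(ζᵢ)` on `𝒜` with `h_φ(𝒜,ζᵢ) → 0`. -/
theorem vanishing_entropy_of_hypertrace_no_normal_condExp
    {H : Type} [NormedAddCommGroup H] [InnerProductSpace ℂ H] [CompleteSpace H]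
    [TopologicalSpace.SeparableSpace H]
    (M : VonNeumannAlgebra H) (τ : M →ₗ[ℂ] ℂ) (hM : IsII1Factor M τ)
    {K : Type} [NormedAddCommGroup K] [InnerProductSpace ℂ K] [CompleteSpace K]
    [TopologicalSpace.SeparableSpace K]
    (A : VonNeumannAlgebra K) (inc : Inclusion M A)
    (hht : ∃ ψ : A →ₗ[ℂ] ℂ, IsHypertrace τ inc ψ)
    (hnce : ¬ ∃ CE : CondExp inc, CE.IsNormal)
    {L2M : Type} [NormedAddCommGroup L2M] [InnerProductSpace ℂ L2M] [CompleteSpace L2M]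
    (gns : GNSRep M τ L2M)
    (φ : (L2M →L[ℂ] L2M) →ₗ[ℂ] ℂ) (z : ℕ → M)
    (hφn : IsNormalB φ) (hφh : IsHyperstateB τ gns φ) (hstd : IsStdFormOf τ gns φ z)
    (hreg : IsRegularSeq z) (hgen : IsStronglyGenerating z)
    (Aop : L2M →L[ℂ] L2M)
    (hAop : ∀ ξ η : L2M, φ ((innerSL ℂ η).smulRight ξ) = ⟪η, Aop ξ⟫_ℂ)
    (evec : ℕ → L2M) (a : ℕ → ℝ)
    (hON : Orthonormal ℂ evec) (ha0 : ∀ k, 0 ≤ a k)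
    (hspec : ∀ ξ : L2M, HasSum (fun k => ((a k : ℂ) * ⟪evec k, ξ⟫_ℂ) • evec k) (Aop ξ))
    (hfin : Summable fun k => a k * Real.log (a k)) :
    ∃ (ι : Type) (F : Filter ι), F.NeBot ∧
      ∃ (ζ : ι → (A →ₗ[ℂ] ℂ)) (md : ∀ i, ModularData τ inc gns (ζ i)),
        (∀ i, IsHyperstate τ inc (ζ i) ∧ IsNormalOn A (ζ i) ∧ IsFaithfulOn A (ζ i)) ∧
        Filter.Tendsto (fun i => fEntropy (md i) (stdVecs gns z)) F (nhds 0) := by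
  obtain ⟨ψ, hψ⟩ := hht
  choose ζ md hζ hE using fun i : ℕ => exists_modularData_fEntropy_mem_Icc hM hψ hφh hstd hreg
    hAop hON ha0 hspec hfin (Nat.one_div_pos_of_nat (α := ℝ) (n := i))
  exact ⟨ℕ, atTop, inferInstance, ζ, md, hζ, squeeze_zero (fun i => (hE i).1)
    (fun i => (hE i).2) tendsto_one_div_add_atTop_nhds_zero_nat⟩

end Paper
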